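/- arXiv:1811.05846 — 6 statements merged into one kernel-verified Lean document; each statement's English description precedes it below -/
import Mathlib

section
/- The number of sequences [c_0,...,c_n] of positive integers with c_n = 1, c_i ≥ 2 for 0 ≤ i < n, and c_{i+1} + 1 ≥ c_i for all 0 ≤ i < n, equals the Catalan number C(n) = binomial(2n,n)/(n+1). -/
namespace Nak

/-- `p` is a Dyck path of semilength `n`: a list of `2n` steps (`true` = horizontal,
`false` = vertical) with `n` horizontal steps, never going below the diagonal. -/
def IsDyck (n : ℕ) (p : List Bool) : Prop :=
  p.length = 2 * n ∧ p.count true = n ∧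
    ∀ i ≤ 2 * n, (p.take i).count false ≤ (p.take i).count true

/-- The path `p` touches the main diagonal after `i` steps. -/
def balancedAt (p : List Bool) (i : ℕ) : Prop :=
  (p.take i).count true = (p.take i).count false

/-- Number of peaks: horizontal steps immediately followed by a vertical step. -/
noncomputable def numPeaks (p : List Bool) : ℕ :=
  Nat.card {i : ℕ // p[i]? = some true ∧ p[i + 1]? = some false}

/-- Number of returns (vertical steps ending on the main diagonal) which are not
1-hills (i.e. not immediately preceded by a horizontal step starting on the diagonal). -/
noncomputable def numReturnsNotOneHill (p : List Bool) : ℕ :=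
  Nat.card {i : ℕ // p[i]? = some false ∧ balancedAt p (i + 1) ∧
    ¬(1 ≤ i ∧ p[i - 1]? = some true ∧ balancedAt p (i - 1))}

/-- Number of 1-rises: horizontal steps neither preceded nor followed by a horizontal step. -/
noncomputable def numOneRises (p : List Bool) : ℕ :=
  Nat.card {i : ℕ // p[i]? = some true ∧ (i = 0 ∨ p[i - 1]? = some false) ∧
    p[i + 1]? ≠ some true}

/-- Number of 2-hills: two consecutive horizontal steps starting on the main diagonal
immediately followed by two consecutive vertical steps. -/
noncomputable def numTwoHills (p : List Bool) : ℕ :=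
  Nat.card {i : ℕ // balancedAt p i ∧ p[i]? = some true ∧ p[i + 1]? = some true ∧
    p[i + 2]? = some false ∧ p[i + 3]? = some false}

/-- Number of valleys (a vertical step followed by a horizontal step) not on the main
diagonal. -/
noncomputable def numOffDiagValleys (p : List Bool) : ℕ :=
  Nat.card {i : ℕ // p[i]? = some false ∧ p[i + 1]? = some true ∧ ¬balancedAt p (i + 1)}

/-- The Dyck path has height at most 2, i.e. all entries of its area sequence are at
most 3: the path never rises more than 2 above the main diagonal. -/
def HeightLE2 (p : List Bool) : Prop :=
  ∀ i ≤ p.length, (p.take i).count true ≤ (p.take i).count false + 2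

def KupischSeq (n : ℕ) (c : Fin (n + 1) → ℕ) : Prop :=
  (∀ i, 1 ≤ c i) ∧ c (Fin.last n) = 1 ∧
    (∀ i : Fin n, 2 ≤ c i.castSucc) ∧ ∀ i : Fin n, c i.castSucc ≤ c i.succ + 1

/-- The Kupisch sequences of length `n + 1` whose first entry is at least `a`. -/
def kupischFrom (n a : ℕ) : Set (Fin (n + 1) → ℕ) :=
  {c | KupischSeq n c ∧ a ≤ c 0}

theorem kupischSeq_zero_iff (c : Fin 1 → ℕ) : KupischSeq 0 c ↔ c = fun _ => 1 := by
  constructor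
  · rintro ⟨-, h, -, -⟩
    funext i
    rw [Subsingleton.elim i (Fin.last 0), h]
  · rintro rfl
    exact ⟨fun _ => le_rfl, rfl, fun i => i.elim0, fun i => i.elim0⟩

theorem kupischSeq_cons_iff (n a : ℕ) (c : Fin (n + 1) → ℕ) :
    KupischSeq (n + 1) (Fin.cons a c : Fin (n + 2) → ℕ) ↔
      KupischSeq n c ∧ 2 ≤ a ∧ a ≤ c 0 + 1 := by
  simp only [KupischSeq, Fin.forall_fin_succ (n := n + 1), Fin.forall_fin_succ (n := n),
    ← Fin.succ_last, Fin.castSucc_zero, Fin.cons_zero, Fin.cons_succ, ← Fin.succ_castSucc]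
  constructor
  · rintro ⟨⟨-, h0, h1⟩, h2, ⟨h3, h4⟩, h5, h6⟩
    exact ⟨⟨⟨h0, h1⟩, h2, h4, h6⟩, h3, h5⟩
  · rintro ⟨⟨⟨h0, h1⟩, h2, h4, h6⟩, h3, h5⟩
    exact ⟨⟨by omega, h0, h1⟩, h2, ⟨h3, h4⟩, h5, h6⟩

theorem KupischSeq.apply_zero_le {n : ℕ} {c : Fin (n + 1) → ℕ} (h : KupischSeq n c) :
    c 0 ≤ n + 1 := by
  induction n with
  | zero => exact (h.2.1 : c 0 = 1).le
  | succ n ih =>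
    rw [← Fin.cons_self_tail c, kupischSeq_cons_iff] at h
    have := ih h.1
    omega

theorem kupischFrom_eq_empty (n : ℕ) : kupischFrom n (n + 2) = ∅ := by
  ext c
  simp only [kupischFrom, Set.mem_ofPred_eq, Set.mem_empty_iff_false, iff_false, not_and]
  intro h
  have := h.apply_zero_le
  omega

theorem kupischFrom_succ_one (n : ℕ) : kupischFrom (n + 1) 1 = kupischFrom (n + 1) 2 := by
  ext c
  constructor
  · rintro ⟨h, -⟩
    exact ⟨h, h.2.2.1 0⟩
  · rintro ⟨h, -⟩
    exact ⟨h, h.1 0⟩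

theorem kupischFrom_succ (n a : ℕ) (ha : 1 ≤ a) :
    kupischFrom (n + 1) (a + 1) =
      kupischFrom (n + 1) (a + 2) ∪
        Fin.cons (α := fun _ => ℕ) (a + 1) '' kupischFrom n a := by
  ext c
  simp only [kupischFrom, Set.mem_union, Set.mem_image, Set.mem_ofPred_eq]
  constructor
  · rintro ⟨h, hc⟩
    rcases hc.lt_or_eq with hlt | heq
    · exact Or.inl ⟨h, hlt⟩
    · refine Or.inr ⟨Fin.tail c, ?_, by rw [heq, Fin.cons_self_tail]⟩
      rw [← Fin.cons_self_tail c, kupischSeq_cons_iff] at h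
      exact ⟨h.1, by omega⟩
  · rintro (⟨h, hc⟩ | ⟨d, ⟨hd, had⟩, rfl⟩)
    · exact ⟨h, by omega⟩
    · exact ⟨(kupischSeq_cons_iff ..).2 ⟨hd, by omega, by omega⟩, by simp⟩

theorem encard_kupischFrom_succ (n a : ℕ) (ha : 1 ≤ a) :
    (kupischFrom (n + 1) (a + 1)).encard =
      (kupischFrom (n + 1) (a + 2)).encard + (kupischFrom n a).encard := by
  rw [kupischFrom_succ n a ha, Set.encard_union_eq,
    (Fin.cons_right_injective (α := fun _ => ℕ) (a + 1)).encard_image]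
  rw [Set.disjoint_left]
  rintro _ ⟨-, h⟩ ⟨d, -, rfl⟩
  simp at h

/-- The number of Kupisch sequences with first entry at least `a`, where `a + m = n + 1`, is
the ballot number `(n + m).choose n - (n + m).choose (n + 1)`. -/
theorem exists_encard_kupischFrom (n m a : ℕ) (ha : 1 ≤ a) (h : a + m = n + 1) :
    ∃ t : ℕ, (kupischFrom n a).encard = t ∧
      t + (n + m).choose (n + 1) = (n + m).choose n := by
  induction n generalizing m a with
  | zero =>
    obtain ⟨rfl, rfl⟩ : a = 1 ∧ m = 0 := by omega
    refine ⟨1, ?_, by simp⟩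
    have : kupischFrom 0 1 = {fun _ => 1} := by
      ext c
      simp only [kupischFrom, kupischSeq_zero_iff, Set.mem_ofPred_eq, Set.mem_singleton_iff]
      exact ⟨fun h => h.1, fun h => ⟨h, by simp [h]⟩⟩
    simp [this]
  | succ n ihn =>
    induction m generalizing a with
    | zero =>
      obtain rfl : a = n + 1 + 1 := by omega
      obtain ⟨t, ht, hc⟩ := ihn 0 (n + 1) (by omega) rfl
      refine ⟨t, ?_, by simpa using hc⟩
      rw [encard_kupischFrom_succ _ _ (by omega), kupischFrom_eq_empty (n + 1), ht]
      simp
    | succ m ihm =>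
      obtain ⟨t, ht, hc⟩ := ihm (a + 1) (by omega) (by omega)
      have e : n + 1 + (m + 1) = n + 1 + m + 1 := by omega
      have p1 := Nat.choose_succ_succ (n + 1 + m) n
      have p2 := Nat.choose_succ_succ (n + 1 + m) (n + 1)
      rw [e]
      simp only [Nat.succ_eq_add_one] at p1 p2
      rcases ha.eq_or_lt with rfl | ha'
      · obtain rfl : m = n := by omega
        refine ⟨t, by rw [kupischFrom_succ_one, ht], ?_⟩
        have hs : (m + 1 + m).choose m = (m + 1 + m).choose (m + 1) :=
          Nat.choose_symm_of_eq_add (by omega)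
        omega
      · obtain ⟨b, rfl⟩ : ∃ b, a = b + 1 := ⟨a - 1, by omega⟩
        obtain ⟨s, hs, hd⟩ := ihn (m + 1) b (by omega) (by omega)
        refine ⟨t + s, ?_, ?_⟩
        · rw [encard_kupischFrom_succ _ _ (by omega), ht, hs]
          simp
        · rw [show n + (m + 1) = n + 1 + m by omega] at hd
          omega

/-- The number of sequences `[c 0, …, c n]` of positive integers with
`c n = 1`, `c i ≥ 2` for `i < n` and `c (i+1) + 1 ≥ c i` equals the Catalan number
`binomial (2n) n / (n+1)`. -/
theorem kupisch_count (n : ℕ) :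
    Nat.card {c : Fin (n + 1) → ℕ // KupischSeq n c} = (2 * n).choose n / (n + 1) := by
  obtain ⟨t, ht, hc⟩ := exists_encard_kupischFrom n n 1 le_rfl (by omega)
  have hset : kupischFrom n 1 = {c | KupischSeq n c} := by
    ext c
    exact ⟨fun h => h.1, fun h => ⟨h, h.1 0⟩⟩
  have hcard : Nat.card {c : Fin (n + 1) → ℕ // KupischSeq n c} = t := by
    change Nat.card {c | KupischSeq n c} = t
    rw [Nat.card_coe_set_eq, ← hset, Set.ncard_def, ht, ENat.toNat_natCast]
  have hr := Nat.choose_succ_right_eq (2 * n) n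
  rw [← two_mul] at hc
  rw [show 2 * n - n = n by omega] at hr
  rw [hcard]
  refine (Nat.div_eq_of_eq_mul_left (Nat.succ_pos n) ?_).symm
  nlinarith

end Nak
end

section
/- Let A be an n-Nakayama algebra with Kupisch series [c_0,...,c_{n-1}] and coKupisch series [d_0,...,d_{n-1}]. A simple non-projective module S_i is 1-regular if and only if c_i - c_{i+1} = 1 and d_{i+1} - d_i = 1. -/
namespace Nak

/-- Condition for `c` to be the Kupisch series of a (connected) `n`-Nakayama algebra:
entries are positive, satisfy `c i ≤ c (i+1) + 1` cyclically, and at most one vertex is a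
sink (i.e. at most one `c i = 1`; if one exists the algebra is an LNakayama algebra,
otherwise a CNakayama algebra). -/
def IsKupisch {n : ℕ} (c : ZMod n → ℕ) : Prop :=
  (∀ i, 1 ≤ c i) ∧ (∀ i, c i ≤ c (i + 1) + 1) ∧ (∀ i j, c i = 1 → c j = 1 → i = j)

/-- Condition for `c` to be the Kupisch series of an `(n+1)`-LNakayama algebra
(linear quiver with sink at vertex `n`). -/
def IsLKupisch (n : ℕ) (c : ZMod (n + 1) → ℕ) : Prop :=
  (∀ i, 1 ≤ c i) ∧ (∀ i, c i ≤ c (i + 1) + 1) ∧ c (n : ZMod (n + 1)) = 1 ∧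
    ∀ i, i ≠ (n : ZMod (n + 1)) → 2 ≤ c i

/-- The coKupisch series determined by the Kupisch series `c`:
`d i = min {k | k ≥ c (i - k)}`, the dimension of the indecomposable injective at vertex `i`. -/
noncomputable def coK {n : ℕ} (c : ZMod n → ℕ) (i : ZMod n) : ℕ :=
  sInf {k : ℕ | 1 ≤ k ∧ c (i - (k : ZMod n)) ≤ k}

/-- `PdIs c i k m` : for the Nakayama algebra with Kupisch series `c`, the indecomposable
uniserial module with top at vertex `i` and dimension `k` (with `1 ≤ k ≤ c i`) has
projective dimension `m`.  It is projective iff `k = c i`, and otherwise its first syzygy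
is the uniserial module with top `i + k` and dimension `c i - k`.  In particular
`PdIs c i 1 m` states that the simple module `S i` has projective dimension `m`. -/
inductive PdIs {n : ℕ} (c : ZMod n → ℕ) : ZMod n → ℕ → ℕ → Prop
  | proj (i : ZMod n) (k : ℕ) (h : k = c i) : PdIs c i k 0
  | step (i : ZMod n) (k m : ℕ) (h : k < c i)
      (h' : PdIs c (i + (k : ZMod n)) (c i - k) m) : PdIs c i k (m + 1)

/-- `CoSyz c s k l s' k'` : the `l`-th cosyzygy (in a minimal injective coresolution) of
the indecomposable uniserial module with socle at vertex `s` and dimension `k` is the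
uniserial module with socle `s'` and dimension `k'`.  The module is injective iff
`k = coK c s`, and otherwise its first cosyzygy has socle `s - k` and dimension
`coK c s - k`. -/
inductive CoSyz {n : ℕ} (c : ZMod n → ℕ) : ZMod n → ℕ → ℕ → ZMod n → ℕ → Prop
  | zero (s : ZMod n) (k : ℕ) : CoSyz c s k 0 s k
  | step (s : ZMod n) (k l : ℕ) (s' : ZMod n) (k' : ℕ)
      (h : CoSyz c s k l s' k') (h' : k' < coK c s') :
      CoSyz c s k (l + 1) (s' - (k' : ZMod n)) (coK c s' - k')

/-- The dimension of `Ext^l(S i, A)`: for a minimal injective coresolution of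
`A = ⊕_r e_r A`, this is the number of indecomposable projectives `e_r A` (which have
socle at vertex `r + c r - 1` and dimension `c r`) whose `l`-th cosyzygy has socle `S i`. -/
noncomputable def extDim {n : ℕ} (c : ZMod n → ℕ) (i : ZMod n) (l : ℕ) : ℕ :=
  Nat.card {r : ZMod n // ∃ m, CoSyz c (r + (c r : ZMod n) - 1) (c r) l i m}

/-- The simple module `S i` is `k`-regular: it has projective dimension `k`,
`Ext^j(S i, A) = 0` for `j < k`, and `dim Ext^k(S i, A) = 1`. -/
def IsRegular {n : ℕ} (c : ZMod n → ℕ) (k : ℕ) (i : ZMod n) : Prop :=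
  PdIs c i 1 k ∧ (∀ j < k, extDim c i j = 0) ∧ extDim c i k = 1

/-- The set of which `coK c i` is the infimum is nonempty. -/
theorem coK_mem {n : ℕ} (hn : 0 < n) {c : ZMod n → ℕ} (hc : ∀ i, 1 ≤ c i) (i : ZMod n) :
    1 ≤ coK c i ∧ c (i - (coK c i : ZMod n)) ≤ coK c i := by
  refine Nat.sInf_mem (s := {k : ℕ | 1 ≤ k ∧ c (i - (k : ZMod n)) ≤ k}) ⟨n * c i, ?_, ?_⟩
  · exact Nat.mul_pos hn (hc i)
  · simpa using Nat.le_mul_of_pos_left (c i) hn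

theorem coK_le {n : ℕ} {c : ZMod n → ℕ} {i : ZMod n} {k : ℕ} (hk : 1 ≤ k)
    (h : c (i - (k : ZMod n)) ≤ k) : coK c i ≤ k :=
  Nat.sInf_le ⟨hk, h⟩

theorem le_apply_add_natCast {n : ℕ} {c : ZMod n → ℕ} (hc : ∀ i, c i ≤ c (i + 1) + 1)
    (r : ZMod n) (j : ℕ) : c r ≤ c (r + (j : ZMod n)) + j := by
  induction j with
  | zero => simp
  | succ j ih =>
    have h := hc (r + (j : ZMod n))
    rw [add_assoc, ← Nat.cast_add_one] at h
    omega

/-- The projective at `r` embeds into the injective hull of its socle. -/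
theorem le_coK_socle {n : ℕ} (hn : 0 < n) {c : ZMod n → ℕ} (hc : IsKupisch c) (r : ZMod n) :
    c r ≤ coK c (r + (c r : ZMod n) - 1) := by
  obtain ⟨h1, h2⟩ := coK_mem hn hc.1 (r + (c r : ZMod n) - 1)
  by_contra! hlt
  obtain ⟨j, hj⟩ : ∃ j, c r = coK c (r + (c r : ZMod n) - 1) + 1 + j :=
    Nat.exists_eq_add_of_lt hlt |>.imp fun j hj => by omega
  generalize coK c (r + (c r : ZMod n) - 1) = d at *
  have h := le_apply_add_natCast hc.2.1 r j
  have e : r + (c r : ZMod n) - 1 - (d : ZMod n) = r + (j : ZMod n) := by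
    rw [hj]; push_cast; ring
  rw [e] at h2
  omega

theorem coK_add_one_le {n : ℕ} (hn : 0 < n) {c : ZMod n → ℕ} (hc : ∀ i, 1 ≤ c i) (i : ZMod n) :
    coK c (i + 1) ≤ coK c i + 1 := by
  have h := (coK_mem hn hc i).2
  refine coK_le (by omega) ?_
  rw [Nat.cast_succ, add_sub_add_right_eq_sub]
  omega

/-- The injective dimensions at `i` and `i + 1` differ by one exactly when `S i` is not the
socle of a projective. -/
theorem coK_add_one_eq_iff {n : ℕ} (hn : 0 < n) {c : ZMod n → ℕ} (hc : IsKupisch c)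
    (i : ZMod n) :
    coK c (i + 1) = coK c i + 1 ↔ ∀ r : ZMod n, r + (c r : ZMod n) - 1 ≠ i := by
  constructor
  · rintro h r rfl
    have h1 := le_coK_socle hn hc r
    have h2 : coK c (r + (c r : ZMod n) - 1 + 1) ≤ c r := coK_le (hc.1 r) (by simp)
    omega
  · intro h
    refine le_antisymm (coK_add_one_le hn hc.1 i) ?_
    obtain ⟨h1, h2⟩ := coK_mem hn hc.1 (i + 1)
    obtain ⟨k, hk⟩ := Nat.exists_eq_add_of_le' h1
    rw [hk] at h2 ⊢
    rw [Nat.cast_succ, add_sub_add_right_eq_sub] at h2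
    have hpos := hc.1 (i - (k : ZMod n))
    rcases h2.eq_or_lt with he | hlt
    · refine absurd ?_ (h (i - (k : ZMod n)))
      rw [he]; push_cast; ring
    · exact Nat.succ_le_succ (coK_le (by omega) (by omega))

theorem pdIs_zero_iff {n : ℕ} {c : ZMod n → ℕ} {i : ZMod n} {k : ℕ} :
    PdIs c i k 0 ↔ k = c i :=
  ⟨fun h => by cases h; assumption, PdIs.proj i k⟩

theorem pdIs_simple_one_iff {n : ℕ} {c : ZMod n → ℕ} {i : ZMod n} (hi : 2 ≤ c i) :
    PdIs c i 1 1 ↔ c i = c (i + 1) + 1 := by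
  constructor
  · intro h
    cases h with
    | step _ _ _ h h' =>
      rw [pdIs_zero_iff, Nat.cast_one] at h'
      omega
  · intro h
    refine PdIs.step i 1 0 hi (pdIs_zero_iff.2 ?_)
    rw [Nat.cast_one]
    omega

theorem coSyz_zero_iff {n : ℕ} {c : ZMod n → ℕ} {s s' : ZMod n} {k k' : ℕ} :
    CoSyz c s k 0 s' k' ↔ s' = s ∧ k' = k := by
  constructor
  · intro h
    cases h
    exact ⟨rfl, rfl⟩
  · rintro ⟨rfl, rfl⟩
    exact CoSyz.zero _ _

theorem exists_coSyz_one_iff {n : ℕ} {c : ZMod n → ℕ} {s i : ZMod n} {k : ℕ} :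
    (∃ m, CoSyz c s k 1 i m) ↔ i = s - (k : ZMod n) ∧ k < coK c s := by
  constructor
  · rintro ⟨m, h⟩
    cases h with
    | step _ s' k' h h' =>
      obtain ⟨rfl, rfl⟩ := coSyz_zero_iff.1 h
      exact ⟨rfl, h'⟩
  · rintro ⟨rfl, h⟩
    exact ⟨_, CoSyz.step s k 0 s k (CoSyz.zero s k) h⟩

theorem extDim_zero_eq_zero_iff {n : ℕ} (hn : 0 < n) (c : ZMod n → ℕ) (i : ZMod n) :
    extDim c i 0 = 0 ↔ ∀ r : ZMod n, r + (c r : ZMod n) - 1 ≠ i := by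
  have : NeZero n := ⟨hn.ne'⟩
  simp only [extDim, coSyz_zero_iff, exists_and_left, exists_eq, and_true]
  rw [Finite.card_eq_zero_iff, isEmpty_subtype]
  exact forall_congr' fun r => not_congr eq_comm

theorem extDim_one_eq_one {n : ℕ} {c : ZMod n → ℕ} {i : ZMod n}
    (h : c (i + 1) < coK c (i + (c (i + 1) : ZMod n))) : extDim c i 1 = 1 := by
  have e : ∀ r : ZMod n, (∃ m, CoSyz c (r + (c r : ZMod n) - 1) (c r) 1 i m) ↔ r = i + 1 := by
    intro r
    rw [exists_coSyz_one_iff]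
    constructor
    · rintro ⟨hr, -⟩
      rw [hr]; ring
    · rintro rfl
      refine ⟨by ring, ?_⟩
      rwa [add_right_comm, add_sub_cancel_right]
  simp only [extDim, e, Nat.card_unique]

/-- For an `n`-Nakayama algebra with Kupisch series `c` and coKupisch
series `d = coK c`, a simple non-projective module `S i` is `1`-regular iff
`c i - c (i+1) = 1` and `d (i+1) - d i = 1`. -/
theorem one_regular_iff {n : ℕ} (hn : 0 < n) (c : ZMod n → ℕ) (hc : IsKupisch c)
    (i : ZMod n) (hnp : 2 ≤ c i) :
    IsRegular c 1 i ↔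
      (c i : ℤ) - c (i + 1) = 1 ∧ (coK c (i + 1) : ℤ) - coK c i = 1 := by
  have hj : (∀ j < 1, extDim c i j = 0) ↔ coK c (i + 1) = coK c i + 1 := by
    simp only [Nat.lt_one_iff, forall_eq, extDim_zero_eq_zero_iff hn, coK_add_one_eq_iff hn hc]
  rw [IsRegular, pdIs_simple_one_iff hnp, hj]
  constructor
  · rintro ⟨h1, h2, -⟩
    omega
  · rintro ⟨h1, h2⟩
    have hci : c i = c (i + 1) + 1 := by omega
    refine ⟨hci, by omega, extDim_one_eq_one ?_⟩
    have h := le_coK_socle hn hc i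
    have e : i + (c i : ZMod n) - 1 = i + (c (i + 1) : ZMod n) := by
      rw [hci]; push_cast; ring
    rw [e] at h
    omega

end Nak
end

section
/- The number of Dyck paths of semilength n with exactly ℓ peaks equals the Narayana number (1/n) * binomial(n, ℓ-1) * binomial(n, ℓ). Consequently, the number of (n+1)-LNakayama algebras with exactly ℓ simple modules of projective dimension 1 equals this Narayana number. -/
namespace Nak

/-- The number of lattice words with `a` steps of one kind and `b` of the other, staying weakly
on one side of the diagonal and having `k` peaks, for `b ≤ a + 1`. -/
def ballotNarayana (a : ℕ) : ℕ → ℕ → ℤ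
  | 0, k => (0 : ℕ).choose k
  | b + 1, k => a.choose k * (b + 1).choose k - (a + 1).choose k * b.choose k

theorem ballotNarayana_succ_self (a k : ℕ) : ballotNarayana a (a + 1) k = 0 := by
  simp only [ballotNarayana]
  ring

theorem ballotNarayana_succ_zero_right (a b : ℕ) : ballotNarayana a (b + 1) 0 = 0 := by
  simp [ballotNarayana]

theorem ballotNarayana_rec (a b k : ℕ) :
    ballotNarayana (a + 1) (b + 1) (k + 1) - ballotNarayana a (b + 1) (k + 1) =
      ballotNarayana (a + 1) b (k + 1) - ballotNarayana a b (k + 1) + ballotNarayana a b k := by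
  cases b with
  | zero =>
    cases k <;> simp [ballotNarayana, Nat.choose_succ_succ]
  | succ b =>
    simp only [ballotNarayana, Nat.choose_succ_succ (a + 1) k, Nat.choose_succ_succ a k,
      Nat.choose_succ_succ (b + 1) k, Nat.choose_succ_succ b k]
    push_cast
    ring

theorem mul_ballotNarayana_self (n k : ℕ) (hn : 0 < n) :
    n * ballotNarayana n n (k + 1) = n.choose k * n.choose (k + 1) := by
  obtain ⟨m, rfl⟩ : ∃ m, n = m + 1 := ⟨n - 1, by omega⟩
  have h₁ : ((m + 1).choose (k + 1) : ℤ) * (k + 1) = (m + 1).choose k * (m + 1 - k) := by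
    rcases le_or_gt k (m + 1) with h | h
    · have := Nat.choose_succ_right_eq (m + 1) k
      zify [h] at this
      exact this
    · simp [Nat.choose_eq_zero_of_lt h, Nat.choose_eq_zero_of_lt (h.trans k.lt_succ_self)]
  have h₂ : ((m + 1 : ℕ) : ℤ) * m.choose k = (m + 1).choose (k + 1) * (k + 1) := by
    exact_mod_cast Nat.add_one_mul_choose_eq m k
  have h₃ : ((m + 1).choose (k + 1) : ℤ) = m.choose k + m.choose (k + 1) := by
    exact_mod_cast Nat.choose_succ_succ m k
  have h₄ : ((m + 1 + 1).choose (k + 1) : ℤ) = (m + 1).choose k + (m + 1).choose (k + 1) := by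
    exact_mod_cast Nat.choose_succ_succ (m + 1) k
  have h₅ : ((m + 1 : ℕ) : ℤ) * m.choose (k + 1) = (m + 1).choose (k + 1) * (m - k) := by
    push_cast at *
    linear_combination -(m + 1 : ℤ) * h₃ - h₂
  simp only [ballotNarayana, h₄]
  push_cast at *
  linear_combination ((m + 1).choose (k + 1) : ℤ) * h₁ -
    ((m + 1).choose k + (m + 1).choose (k + 1) : ℤ) * h₅

/-- The recurrences characterising `ballotNarayana`; `d a` counts the increments of `w`
from `a` to `a + 1`. -/
theorem eq_ballotNarayana_of_rec {w d : ℕ → ℕ → ℕ → ℕ}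
    (w_zero : ∀ k, w 0 0 k = (0 : ℕ).choose k)
    (w_diag : ∀ a k, w a (a + 1) k = 0)
    (w_succ : ∀ a b k, b ≤ a + 1 → w (a + 1) b k = w a b k + d a b k)
    (d_zero : ∀ a k, d a 0 k = 0)
    (d_succ_zero : ∀ a b, b ≤ a → d a (b + 1) 0 = d a b 0)
    (d_succ_succ : ∀ a b k, b ≤ a → d a (b + 1) (k + 1) = d a b (k + 1) + w a b k)
    (a b k : ℕ) (hb : b ≤ a + 1) :
    (w a b k : ℤ) = ballotNarayana a b k ∧
      (d a b k : ℤ) = ballotNarayana (a + 1) b k - ballotNarayana a b k := by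
  have d_eq (a : ℕ) (hw : ∀ b k, b ≤ a + 1 → (w a b k : ℤ) = ballotNarayana a b k) (b : ℕ) :
      ∀ k, b ≤ a + 1 →
        (d a b k : ℤ) = ballotNarayana (a + 1) b k - ballotNarayana a b k := by
    induction b with
    | zero => intro k _; simp [d_zero, ballotNarayana]
    | succ b ih =>
      rintro (_ | k) hb
      · rw [d_succ_zero a b (by omega), ih 0 (by omega)]
        cases b <;> simp [ballotNarayana]
      · rw [d_succ_succ a b k (by omega), Nat.cast_add, ih _ (by omega), hw _ _ (by omega),
          ballotNarayana_rec]
  have w_eq (a : ℕ) : ∀ b k, b ≤ a + 1 → (w a b k : ℤ) = ballotNarayana a b k := by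
    induction a with
    | zero =>
      intro b k hb
      obtain rfl | rfl : b = 0 ∨ b = 1 := by omega
      · simp [w_zero, ballotNarayana]
      · simp [w_diag 0 k, ballotNarayana_succ_self 0 k]
    | succ a ih =>
      intro b k hb
      rcases hb.eq_or_lt with rfl | hb
      · simp [w_diag, ballotNarayana_succ_self]
      · rw [w_succ a b k (by omega), Nat.cast_add, ih _ _ (by omega), d_eq a ih _ _ (by omega)]
        ring
  exact ⟨w_eq a b k hb, d_eq a (w_eq a) b k hb⟩

theorem numPeaks_nil : numPeaks [] = 0 := by simp [numPeaks]

theorem numPeaks_cons (x : Bool) (q : List Bool) :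
    numPeaks (x :: q) = numPeaks q + if x = true ∧ q[0]? = some false then 1 else 0 := by
  let s : Set ℕ := {i | q[i]? = some true ∧ q[i + 1]? = some false}
  have hs : s.Finite := (Set.finite_lt_nat q.length).subset fun i hi =>
    (List.getElem?_eq_some_iff.1 hi.1).1
  have hq : numPeaks q = (Nat.succ '' s).ncard :=
    (Set.ncard_image_of_injective s Nat.succ_injective).symm
  rw [hq]
  change Set.ncard {i | (x :: q)[i]? = some true ∧ (x :: q)[i + 1]? = some false} = _
  split_ifs with h
  · rw [← Set.ncard_insert_of_notMem (a := 0) (by simp) (hs.image _)]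
    congr 1
    ext (_ | i) <;> simp [s, h]
  · rw [add_zero]
    congr 1
    ext (_ | i) <;> simp_all [s]

/-- Words with `a` vertical and `b` horizontal steps and `k` peaks that can be completed on the
left to a Dyck path. -/
def dyckSuffixes (a b k : ℕ) : Set (List Bool) :=
  {q | q.count false = a ∧ q.count true = b ∧
    (∀ s, s <:+ q → s.count true ≤ s.count false) ∧ numPeaks q = k}

theorem dyckSuffixes_finite (a b k : ℕ) : (dyckSuffixes a b k).Finite :=
  (List.finite_length_eq Bool (a + b)).subset fun q hq => by
    have := List.count_true_add_count_false q
    simp only [dyckSuffixes, Set.mem_ofPred_eq] at hq ⊢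
    omega

theorem forall_suffix_cons (P : List Bool → Prop) (x : Bool) (q : List Bool) :
    (∀ s, s <:+ x :: q → P s) ↔ P (x :: q) ∧ ∀ s, s <:+ q → P s := by
  simp [List.suffix_cons_iff, or_imp, forall_and]

theorem false_cons_mem_dyckSuffixes {a b k : ℕ} {q : List Bool} :
    false :: q ∈ dyckSuffixes (a + 1) b k ↔ q ∈ dyckSuffixes a b k := by
  simp only [dyckSuffixes, Set.mem_ofPred_eq, forall_suffix_cons, numPeaks_cons]
  constructor
  · rintro ⟨h₁, h₂, ⟨-, h₃⟩, h₄⟩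
    exact ⟨by simpa using h₁, by simpa using h₂, h₃, by simpa using h₄⟩
  · rintro ⟨h₁, h₂, h₃, h₄⟩
    have := h₃ q List.suffix_rfl
    refine ⟨by simpa using h₁, by simpa using h₂, ⟨?_, h₃⟩, by simpa using h₄⟩
    simp
    omega

theorem true_cons_mem_dyckSuffixes {a b k : ℕ} (hb : b + 1 ≤ a) {q : List Bool} :
    true :: q ∈ dyckSuffixes a (b + 1) k ↔ ∃ j, q ∈ dyckSuffixes a b j ∧
      j + (if q[0]? = some false then 1 else 0) = k := by
  simp only [dyckSuffixes, Set.mem_ofPred_eq, forall_suffix_cons, numPeaks_cons]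
  constructor
  · rintro ⟨h₁, h₂, ⟨-, h₃⟩, h₄⟩
    exact ⟨_, ⟨by simpa using h₁, by simpa using h₂, h₃, rfl⟩, by simpa using h₄⟩
  · rintro ⟨_, ⟨h₁, h₂, h₃, rfl⟩, h₄⟩
    refine ⟨by simpa using h₁, by simpa using h₂, ⟨?_, h₃⟩, by simpa using h₄⟩
    simp
    omega

/-- The elements of `dyckSuffixes` whose first step is horizontal. -/
def dyckSuffixesTrue (a b k : ℕ) : Set (List Bool) :=
  {q ∈ dyckSuffixes a b k | q[0]? = some true}

theorem dyckSuffixesTrue_finite (a b k : ℕ) : (dyckSuffixesTrue a b k).Finite :=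
  (dyckSuffixes_finite a b k).subset fun _ h => h.1

theorem dyckSuffixes_succ (a b k : ℕ) : dyckSuffixes (a + 1) b k =
    List.cons false '' dyckSuffixes a b k ∪ dyckSuffixesTrue (a + 1) b k := by
  ext (_ | ⟨_ | _, q⟩)
  · simp [dyckSuffixes, dyckSuffixesTrue]
  · simp [dyckSuffixesTrue, false_cons_mem_dyckSuffixes]
  · simp [dyckSuffixesTrue]

theorem dyckSuffixesTrue_succ_zero (a b : ℕ) (hb : b ≤ a) :
    dyckSuffixesTrue (a + 1) (b + 1) 0 = List.cons true '' dyckSuffixesTrue (a + 1) b 0 := by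
  ext (_ | ⟨_ | _, q⟩)
  · simp [dyckSuffixesTrue]
  · simp [dyckSuffixesTrue]
  · rcases q with (_ | ⟨_ | _, q⟩) <;>
      simp [dyckSuffixesTrue, true_cons_mem_dyckSuffixes (Nat.succ_le_succ hb)]
    simp [dyckSuffixes]

theorem dyckSuffixesTrue_succ_succ (a b k : ℕ) (hb : b ≤ a) :
    dyckSuffixesTrue (a + 1) (b + 1) (k + 1) =
      List.cons true '' dyckSuffixesTrue (a + 1) b (k + 1) ∪
        (List.cons true ∘ List.cons false) '' dyckSuffixes a b k := by
  ext (_ | ⟨_ | _, q⟩)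
  · simp [dyckSuffixesTrue]
  · simp [dyckSuffixesTrue]
  · rcases q with (_ | ⟨_ | _, q⟩) <;>
      simp [dyckSuffixesTrue, true_cons_mem_dyckSuffixes (Nat.succ_le_succ hb),
        false_cons_mem_dyckSuffixes]
    simp [dyckSuffixes]

theorem ncard_dyckSuffixes (a b k : ℕ) (hb : b ≤ a + 1) :
    ((dyckSuffixes a b k).ncard : ℤ) = ballotNarayana a b k := by
  refine (eq_ballotNarayana_of_rec (w := fun a b k => (dyckSuffixes a b k).ncard)
    (d := fun a b k => (dyckSuffixesTrue (a + 1) b k).ncard)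
    ?_ ?_ ?_ ?_ ?_ ?_ a b k hb).1
  · intro k
    have h (q : List Bool) : q ∈ dyckSuffixes 0 0 k ↔ q = [] ∧ k = 0 := by
      constructor
      · rintro ⟨h₁, h₂, -, h₄⟩
        have := List.count_true_add_count_false q
        obtain rfl : q = [] := List.length_eq_zero_iff.1 (by omega)
        exact ⟨rfl, by rw [← h₄, numPeaks_nil]⟩
      · rintro ⟨rfl, rfl⟩
        simp [dyckSuffixes, numPeaks_nil]
    cases k with
    | zero => simp [show dyckSuffixes 0 0 0 = {[]} by ext; simp [h]]
    | succ k => simp [show dyckSuffixes 0 0 (k + 1) = ∅ by ext; simp [h]]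
  · intro a k
    rw [Set.ncard_eq_zero (dyckSuffixes_finite _ _ _), Set.eq_empty_iff_forall_notMem]
    rintro q ⟨h₁, h₂, h₃, -⟩
    have := h₃ q List.suffix_rfl
    omega
  · intro a b k _
    rw [dyckSuffixes_succ, Set.ncard_union_eq _ ((dyckSuffixes_finite _ _ _).image _)
      (dyckSuffixesTrue_finite _ _ _), Set.ncard_image_of_injective _ List.cons_injective]
    rw [Set.disjoint_left]
    rintro _ ⟨q, -, rfl⟩ ⟨-, h⟩
    simp at h
  · intro a k
    rw [Set.ncard_eq_zero (dyckSuffixesTrue_finite _ _ _), Set.eq_empty_iff_forall_notMem]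
    rintro (_ | ⟨_ | _, q⟩) <;> simp [dyckSuffixesTrue, dyckSuffixes]
  · intro a b hb
    rw [dyckSuffixesTrue_succ_zero a b hb, Set.ncard_image_of_injective _ List.cons_injective]
  · intro a b k hb
    rw [dyckSuffixesTrue_succ_succ a b k hb, Set.ncard_union_eq _
      ((dyckSuffixesTrue_finite _ _ _).image _) ((dyckSuffixes_finite _ _ _).image _),
      Set.ncard_image_of_injective _ List.cons_injective,
      Set.ncard_image_of_injective _ (List.cons_injective.comp List.cons_injective)]
    rw [Set.disjoint_left]
    rintro _ ⟨q, ⟨-, h⟩, rfl⟩ ⟨r, -, h'⟩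
    simp only [Function.comp_apply, List.cons.injEq, true_and] at h'
    simp [← h'] at h

theorem isDyck_and_numPeaks_iff (n k : ℕ) (p : List Bool) :
    IsDyck n p ∧ numPeaks p = k ↔ p ∈ dyckSuffixes n n k := by
  have hl := List.count_true_add_count_false p
  have key (i : ℕ) (x : Bool) : (p.take i).count x + (p.drop i).count x = p.count x := by
    rw [← List.count_append, List.take_append_drop]
  constructor
  · rintro ⟨⟨h₁, h₂, h₃⟩, h₄⟩
    refine ⟨by omega, h₂, fun s hs => ?_, h₄⟩
    obtain ⟨i, rfl⟩ : ∃ i, s = p.drop i := ⟨_, List.suffix_iff_eq_drop.1 hs⟩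
    rcases le_total i (2 * n) with hi | hi
    · have := h₃ i hi
      have := key i true
      have := key i false
      omega
    · simp [List.drop_eq_nil_of_le (h₁.trans_le hi)]
  · rintro ⟨h₁, h₂, h₃, h₄⟩
    refine ⟨⟨by omega, h₂, fun i _ => ?_⟩, h₄⟩
    have := h₃ _ (List.drop_suffix i p)
    have := key i true
    have := key i false
    omega

theorem card_dyck (n k : ℕ) :
    (Nat.card {p : List Bool // IsDyck n p ∧ numPeaks p = k} : ℤ) = ballotNarayana n n k := by
  rw [← ncard_dyckSuffixes n n k n.le_succ, ← Nat.card_coe_set_eq]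
  simp only [isDyck_and_numPeaks_iff]

/-- Kupisch series of linear Nakayama algebras with `n + 1` vertices, indexed by `Fin (n + 1)`,
with exactly `k` indices `i` such that `c i ≤ c (i + 1)`. -/
def kupischSeries (n k : ℕ) : Set (Fin (n + 1) → ℕ) :=
  {c | c (Fin.last n) = 1 ∧
    (∀ i : Fin n, 2 ≤ c i.castSucc ∧ c i.castSucc ≤ c i.succ + 1) ∧
    Finset.card {i : Fin n | c i.castSucc ≤ c i.succ} = k}

theorem add_le_of_mem_kupischSeries {n k : ℕ} {c : Fin (n + 1) → ℕ} (hc : c ∈ kupischSeries n k)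
    (i : Fin (n + 1)) : c i + i ≤ n + 1 := by
  induction i using Fin.reverseInduction with
  | last => simp [hc.1, add_comm]
  | cast i ih =>
    have := hc.2.1 i
    simp only [Fin.val_succ, Fin.val_castSucc] at ih ⊢
    omega

theorem apply_zero_le_of_mem_kupischSeries {n k : ℕ} {c : Fin (n + 1) → ℕ}
    (hc : c ∈ kupischSeries n k) : c 0 ≤ n + 1 := by
  simpa using add_le_of_mem_kupischSeries hc 0

theorem two_le_of_mem_kupischSeries {n k : ℕ} {c : Fin (n + 2) → ℕ}
    (hc : c ∈ kupischSeries (n + 1) k) : 2 ≤ c 0 := by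
  simpa using (hc.2.1 0).1

theorem kupischSeries_finite (n k : ℕ) : (kupischSeries n k).Finite :=
  (Set.finite_Icc 0 fun _ => n + 1).subset fun _ hc =>
    ⟨fun _ => Nat.zero_le _, fun i => (Nat.le_add_right _ _).trans
      (add_le_of_mem_kupischSeries hc i)⟩

theorem cons_mem_kupischSeries {n k x : ℕ} {c : Fin (n + 1) → ℕ} :
    (Fin.cons x c : Fin (n + 2) → ℕ) ∈ kupischSeries (n + 1) k ↔
      2 ≤ x ∧ x ≤ c 0 + 1 ∧ ∃ j, c ∈ kupischSeries n j ∧ j + (if x ≤ c 0 then 1 else 0) = k := by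
  simp only [kupischSeries, Set.mem_ofPred_eq, Fin.forall_fin_succ (n := n),
    Fin.card_filter_univ_succ, ← Fin.succ_last, Fin.cons_succ, Fin.castSucc_zero, Fin.cons_zero,
    Fin.castSucc_succ]
  constructor
  · rintro ⟨h₁, ⟨⟨h₂, h₃⟩, h₄⟩, h₅⟩
    refine ⟨h₂, h₃, _, ⟨h₁, h₄, rfl⟩, ?_⟩
    rw [← h₅]
    split_ifs <;> simp
  · rintro ⟨h₂, h₃, _, ⟨h₁, h₄, rfl⟩, h₅⟩
    refine ⟨h₁, ⟨⟨h₂, h₃⟩, h₄⟩, ?_⟩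
    rw [← h₅]
    split_ifs <;> simp

/-- The elements of `kupischSeries` with prescribed first entry. -/
def kupischSeriesEq (a b k : ℕ) : Set (Fin (a + 2) → ℕ) :=
  {c ∈ kupischSeries (a + 1) k | c 0 + b = a + 2}

/-- The elements of `kupischSeries` with first entry bounded below. -/
def kupischSeriesLT (a b k : ℕ) : Set (Fin (a + 2) → ℕ) :=
  {c | ∃ j, c ∈ kupischSeries (a + 1) j ∧ j + 1 = k ∧ a + 2 < c 0 + b}

theorem kupischSeriesEq_finite (a b k : ℕ) : (kupischSeriesEq a b k).Finite :=
  (kupischSeries_finite _ _).subset fun _ h => h.1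

theorem kupischSeriesLT_zero (a b : ℕ) : kupischSeriesLT a b 0 = ∅ := by
  simp [kupischSeriesLT]

theorem kupischSeriesLT_succ (a b k : ℕ) :
    kupischSeriesLT a b (k + 1) = {c ∈ kupischSeries (a + 1) k | a + 2 < c 0 + b} := by
  simp [kupischSeriesLT]

theorem kupischSeriesLT_finite (a b k : ℕ) : (kupischSeriesLT a b k).Finite := by
  cases k with
  | zero => simp [kupischSeriesLT_zero]
  | succ k =>
    rw [kupischSeriesLT_succ]
    exact (kupischSeries_finite _ _).subset fun _ h => h.1

theorem kupischSeriesEq_succ (a b k : ℕ) (hb : b ≤ a + 1) : kupischSeriesEq (a + 1) b k =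
    Fin.cons (α := fun _ => ℕ) (a + 3 - b) ''
      (kupischSeriesEq a b k ∪ kupischSeriesLT a b k) := by
  ext c
  obtain ⟨x, c, rfl⟩ : ∃ (x : ℕ) (t : Fin (a + 2) → ℕ), c = Fin.cons x t :=
    ⟨c 0, Fin.tail c, (Fin.cons_self_tail c).symm⟩
  simp only [kupischSeriesEq, kupischSeriesLT, Set.mem_image, Set.mem_union, Set.mem_ofPred_eq,
    cons_mem_kupischSeries, Fin.cons_inj, Fin.cons_zero]
  constructor
  · rintro ⟨⟨-, h, j, hj, rfl⟩, hx⟩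
    refine ⟨c, ?_, by omega, rfl⟩
    split_ifs with hxc
    · exact .inr ⟨j, hj, rfl, by omega⟩
    · exact .inl ⟨hj, by omega⟩
  · rintro ⟨c, ⟨hc, h⟩ | ⟨j, hj, rfl, h⟩, rfl, rfl⟩
    · exact ⟨⟨by omega, by omega, k, hc, by rw [if_neg (by omega)]; rfl⟩, by omega⟩
    · exact ⟨⟨by omega, by omega, j, hj, by rw [if_pos (by omega)]⟩, by omega⟩

theorem ncard_kupischSeriesLT (a b k : ℕ) (hb : b ≤ a + 1) :
    ((kupischSeriesLT a b k).ncard : ℤ) =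
      ballotNarayana (a + 1) b k - ballotNarayana a b k := by
  refine (eq_ballotNarayana_of_rec (w := fun a b k => (kupischSeriesEq a b k).ncard)
    (d := fun a b k => (kupischSeriesLT a b k).ncard) ?_ ?_ ?_ ?_ ?_ ?_ a b k hb).2
  · intro k
    have h (c : Fin 2 → ℕ) : c ∈ kupischSeriesEq 0 0 k ↔ c = ![2, 1] ∧ k = 0 := by
      constructor
      · rintro ⟨⟨h₁, -, h₃⟩, h₄⟩
        have h₁ : c 1 = 1 := h₁
        have h₄ : c 0 = 2 := h₄
        refine ⟨by ext i; fin_cases i <;> simp [h₁, h₄], ?_⟩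
        rw [← h₃]
        simp [h₁, h₄]
      · rintro ⟨rfl, rfl⟩
        simp [kupischSeriesEq, kupischSeries]
    cases k with
    | zero => simp [show kupischSeriesEq 0 0 0 = {![2, 1]} by ext; simp [h]]
    | succ k => simp [show kupischSeriesEq 0 0 (k + 1) = ∅ by ext; simp [h]]
  · intro a k
    rw [Set.ncard_eq_zero (kupischSeriesEq_finite _ _ _), Set.eq_empty_iff_forall_notMem]
    rintro c ⟨hc, h⟩
    have := two_le_of_mem_kupischSeries hc
    omega
  · intro a b k hb
    rw [kupischSeriesEq_succ a b k hb, Set.ncard_image_of_injective _ (Fin.cons_right_injective _),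
      Set.ncard_union_eq _ (kupischSeriesEq_finite _ _ _) (kupischSeriesLT_finite _ _ _)]
    rw [Set.disjoint_left]
    rintro c ⟨-, h⟩ ⟨_, -, -, h'⟩
    omega
  · intro a k
    rw [Set.ncard_eq_zero (kupischSeriesLT_finite _ _ _), Set.eq_empty_iff_forall_notMem]
    rintro c ⟨_, hc, -, h⟩
    have := apply_zero_le_of_mem_kupischSeries hc
    omega
  · intro a b _
    simp [kupischSeriesLT_zero]
  · intro a b k _
    rw [← Set.ncard_union_eq _ (kupischSeriesLT_finite _ _ _) (kupischSeriesEq_finite _ _ _)]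
    · congr 1
      ext c
      simp only [kupischSeriesLT_succ, kupischSeriesEq, Set.mem_union, Set.mem_ofPred_eq,
        ← and_or_left]
      exact and_congr_right fun _ => by omega
    · rw [kupischSeriesLT_succ, Set.disjoint_left]
      rintro c ⟨-, h⟩ ⟨-, h'⟩
      omega

theorem ncard_kupischSeries (n k : ℕ) (hn : 0 < n) :
    ((kupischSeries n k).ncard : ℤ) = ballotNarayana n n (k + 1) := by
  obtain ⟨m, rfl⟩ : ∃ m, n = m + 1 := ⟨n - 1, by omega⟩
  have h : kupischSeries (m + 1) k = kupischSeriesLT m (m + 1) (k + 1) := by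
    ext c
    simp only [kupischSeriesLT_succ, Set.mem_ofPred_eq, iff_self_and]
    intro hc
    have := two_le_of_mem_kupischSeries hc
    omega
  rw [h, ncard_kupischSeriesLT _ _ _ le_rfl, ballotNarayana_succ_self, sub_zero]

theorem pdIs_one_one_iff {n : ℕ} (c : ZMod n → ℕ) (i : ZMod n) :
    PdIs c i 1 1 ↔ 1 < c i ∧ c i = c (i + 1) + 1 := by
  constructor
  · rintro (_ | ⟨_, _, _, h, _ | _⟩)
    rename_i h'
    rw [Nat.cast_one] at h'
    omega
  · rintro ⟨h, h'⟩
    refine .step i 1 0 h (.proj _ _ ?_)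
    rw [Nat.cast_one]
    omega

theorem pdIs_one_one_iff_fin {n : ℕ} (c : Fin (n + 1) → ℕ) (i : Fin (n + 1)) :
    PdIs (n := n + 1) c i 1 1 ↔ 1 < c i ∧ c i = c (i + 1) + 1 :=
  pdIs_one_one_iff (n := n + 1) c i

theorem isLKupisch_iff_fin (n : ℕ) (c : Fin (n + 1) → ℕ) :
    IsLKupisch n c ↔ (∀ i, 1 ≤ c i) ∧ (∀ i, c i ≤ c (i + 1) + 1) ∧ c (Fin.last n) = 1 ∧
      ∀ i, i ≠ Fin.last n → 2 ≤ c i := by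
  rw [← Fin.natCast_eq_last]
  exact Iff.rfl

theorem isLKupisch_iff (n : ℕ) (c : Fin (n + 1) → ℕ) :
    IsLKupisch n c ↔ c (Fin.last n) = 1 ∧
      ∀ i : Fin n, 2 ≤ c i.castSucc ∧ c i.castSucc ≤ c i.succ + 1 := by
  rw [isLKupisch_iff_fin]
  constructor
  · rintro ⟨-, h₂, h₃, h₄⟩
    refine ⟨h₃, fun i => ⟨h₄ i.castSucc (Fin.castSucc_ne_last i), ?_⟩⟩
    rw [← Fin.coeSucc_eq_succ]
    exact h₂ i.castSucc
  · rintro ⟨h₁, h₂⟩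
    have h₃ (i : Fin (n + 1)) (hi : i ≠ Fin.last n) : 2 ≤ c i := by
      obtain ⟨i, rfl⟩ := Fin.exists_castSucc_eq.2 hi
      exact (h₂ i).1
    refine ⟨fun i => ?_, fun i => ?_, h₁, h₃⟩
    · by_cases hi : i = Fin.last n
      · rw [hi, h₁]
      · exact one_le_two.trans (h₃ i hi)
    · by_cases hi : i = Fin.last n
      · rw [hi, h₁]
        omega
      · obtain ⟨i, rfl⟩ := Fin.exists_castSucc_eq.2 hi
        rw [Fin.coeSucc_eq_succ]
        exact (h₂ i).2

theorem card_pdIs_one_one (n : ℕ) (c : Fin (n + 1) → ℕ) (hc : IsLKupisch n c) :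
    Nat.card {i : ZMod (n + 1) // PdIs c i 1 1} +
      Finset.card {i : Fin n | c i.castSucc ≤ c i.succ} = n := by
  obtain ⟨h₁, h₂⟩ := (isLKupisch_iff n c).1 hc
  have key : {i : Fin (n + 1) | PdIs (n := n + 1) c i 1 1} =
      Fin.castSucc '' {i : Fin n | ¬ c i.castSucc ≤ c i.succ} := by
    ext i
    simp only [Set.mem_ofPred_eq, pdIs_one_one_iff_fin, Set.mem_image]
    constructor
    · rintro ⟨h, h'⟩
      obtain ⟨i, rfl⟩ : ∃ j : Fin n, j.castSucc = i :=
        Fin.exists_castSucc_eq.2 fun hi => by rw [hi, h₁] at h; exact h.false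
      rw [Fin.coeSucc_eq_succ] at h'
      exact ⟨i, by omega, rfl⟩
    · rintro ⟨i, h, rfl⟩
      rw [Fin.coeSucc_eq_succ]
      have := h₂ i
      omega
  change Set.ncard {i : Fin (n + 1) | PdIs (n := n + 1) c i 1 1} + _ = n
  rw [key, Set.ncard_image_of_injective _ (Fin.castSucc_injective n), add_comm]
  have := Finset.card_filter_add_card_filter_not (s := (Finset.univ : Finset (Fin n)))
    (fun i => c i.castSucc ≤ c i.succ)
  rw [Finset.card_univ, Fintype.card_fin] at this
  rw [← Set.ncard_coe_finset {i : Fin n | ¬ c i.castSucc ≤ c i.succ}, Finset.coe_filter] at this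
  simpa using this

theorem card_lKupisch (n l : ℕ) (hn : 0 < n) (hl : l ≤ n) :
    (Nat.card {c : ZMod (n + 1) → ℕ // IsLKupisch n c ∧
      Nat.card {i : ZMod (n + 1) // PdIs c i 1 1} = l} : ℤ) =
        ballotNarayana n n (n - l + 1) := by
  rw [← ncard_kupischSeries n (n - l) hn]
  change ((Set.ncard {c : Fin (n + 1) → ℕ | IsLKupisch n c ∧
      Nat.card {i : ZMod (n + 1) // PdIs c i 1 1} = l} : ℕ) : ℤ) = _
  congr 2
  ext c
  simp only [kupischSeries, Set.mem_ofPred_eq, ← and_assoc]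
  rw [and_congr_left_iff.2 fun _ => isLKupisch_iff n c, and_congr_right_iff]
  intro hc
  have := card_pdIs_one_one n c ((isLKupisch_iff n c).2 hc)
  omega

theorem card_lKupisch_of_lt (n l : ℕ) (hl : n < l) :
    Nat.card {c : ZMod (n + 1) → ℕ // IsLKupisch n c ∧
      Nat.card {i : ZMod (n + 1) // PdIs c i 1 1} = l} = 0 := by
  have : IsEmpty {c : ZMod (n + 1) → ℕ // IsLKupisch n c ∧
      Nat.card {i : ZMod (n + 1) // PdIs c i 1 1} = l} := by
    refine ⟨fun ⟨c, hc, h⟩ => ?_⟩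
    have := card_pdIs_one_one n c hc
    omega
  exact Nat.card_of_isEmpty

theorem ballotNarayana_self_zero (n : ℕ) (hn : 0 < n) : ballotNarayana n n 0 = 0 := by
  obtain ⟨m, rfl⟩ : ∃ m, n = m + 1 := ⟨n - 1, by omega⟩
  exact ballotNarayana_succ_zero_right _ _

/-- The number of Dyck paths of semilength `n` with exactly `l` peaks
equals the Narayana number `(1/n) * binomial n (l-1) * binomial n l` (interpreted as `0`
for `l = 0`).  Consequently, the number of `(n+1)`-LNakayama algebras with exactly `l`
simple modules of projective dimension `1` equals this Narayana number. -/
theorem narayana_count (n l : ℕ) (hn : 0 < n) :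
    (Nat.card {p : List Bool // IsDyck n p ∧ numPeaks p = l} : ℚ) =
        (1 : ℚ) / n * (if l = 0 then 0 else (n.choose (l - 1) : ℚ)) * (n.choose l : ℚ) ∧
      (Nat.card {c : ZMod (n + 1) → ℕ // IsLKupisch n c ∧
            Nat.card {i : ZMod (n + 1) // PdIs c i 1 1} = l} : ℚ) =
        (1 : ℚ) / n * (if l = 0 then 0 else (n.choose (l - 1) : ℚ)) * (n.choose l : ℚ) := by
  have hn' : (n : ℚ) ≠ 0 := by exact_mod_cast hn.ne'
  have eq_of {x : ℕ} {z : ℤ} (a b : ℕ) (hx : (x : ℤ) = z) (hz : n * z = a * b) :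
      (x : ℚ) = 1 / n * a * b := by
    have h : (n : ℚ) * x = a * b := by exact_mod_cast hx ▸ hz
    field_simp
    linarith
  constructor
  · cases l with
    | zero =>
      have h := card_dyck n 0
      rw [ballotNarayana_self_zero n hn] at h
      simpa using h
    | succ l => simpa using eq_of _ _ (card_dyck n (l + 1)) (mul_ballotNarayana_self n l hn)
  · rcases lt_or_ge n l with hl | hl
    · simp [card_lKupisch_of_lt n l hl, Nat.choose_eq_zero_of_lt hl]
    · have h := eq_of _ _ (card_lKupisch n l hn hl) (mul_ballotNarayana_self n (n - l) hn)
      rw [h, Nat.choose_symm hl]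
      cases l with
      | zero => simp
      | succ l =>
        rw [show n - (l + 1) + 1 = n - l by omega, Nat.choose_symm (by omega)]
        simp
        ring

end Nak
end

section
/- For n ≥ 1, the number of Dyck paths of semilength n with no 2-hill equals Σ_{k=0}^{⌊n/2⌋} (-1)^k * ((k+1)/(n-k+1)) * binomial(2n-3k, n-k). Consequently this is the number of (n+1)-LNakayama algebras A such that the category of finitely generated projective A-modules has a unique exact structure. -/
namespace Nak

/-- The generating function of the Catalan numbers, with rational coefficients. -/
noncomputable def catalanSeriesRat : PowerSeries ℚ :=
  PowerSeries.map (Nat.castRingHom ℚ) PowerSeries.catalanSeries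

theorem coeff_catalanSeriesRat (n : ℕ) :
    PowerSeries.coeff n catalanSeriesRat = (catalan n : ℚ) := by
  simp [catalanSeriesRat]

theorem catalanSeriesRat_eq : catalanSeriesRat = catalanSeriesRat ^ 2 * PowerSeries.X + 1 := by
  have h := congrArg (PowerSeries.map (Nat.castRingHom ℚ))
    PowerSeries.catalanSeries_sq_mul_X_add_one
  simpa [catalanSeriesRat] using h.symm

theorem coeff_succ_catalanSeriesRat_pow_succ (k m : ℕ) :
    PowerSeries.coeff (m + 1) (catalanSeriesRat ^ (k + 1)) =
      PowerSeries.coeff (m + 1) (catalanSeriesRat ^ k) +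
        PowerSeries.coeff m (catalanSeriesRat ^ (k + 2)) := by
  have h : catalanSeriesRat ^ (k + 1) =
      catalanSeriesRat ^ k + catalanSeriesRat ^ (k + 2) * PowerSeries.X := by
    calc catalanSeriesRat ^ (k + 1)
        = catalanSeriesRat ^ k * catalanSeriesRat := pow_succ _ _
      _ = catalanSeriesRat ^ k * (catalanSeriesRat ^ 2 * PowerSeries.X + 1) := by
          rw [← catalanSeriesRat_eq]
      _ = _ := by ring
  rw [h, map_add, PowerSeries.coeff_succ_mul_X]

theorem coeff_catalanSeriesRat_pow (m k : ℕ) :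
    PowerSeries.coeff m (catalanSeriesRat ^ (k + 1)) =
      ((k : ℚ) + 1) / ((m : ℚ) + k + 1) * ((2 * m + k).choose (m + k) : ℚ) := by
  induction m generalizing k with
  | zero =>
    have h : PowerSeries.constantCoeff catalanSeriesRat = 1 := by
      simpa using coeff_catalanSeriesRat 0
    have h' : (k : ℚ) + 1 ≠ 0 := by positivity
    simp [h, h']
  | succ m ihm =>
    induction k with
    | zero =>
      rw [coeff_succ_catalanSeriesRat_pow_succ, ihm, show 2 * (m + 1) + 0 = (2 * m + 1) + 1 by ring,
        show m + 1 + 0 = m + 1 by ring, Nat.choose_succ_succ' (2 * m + 1) m]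
      have h := Nat.choose_succ_right_eq (2 * m + 1) m
      rw [show 2 * m + 1 - m = m + 1 by omega] at h
      have h' := Nat.eq_of_mul_eq_mul_right m.succ_pos h
      rw [h']
      simp only [pow_zero, PowerSeries.coeff_one]
      push_cast
      simp
      field_simp
    | succ k ihk =>
      rw [coeff_succ_catalanSeriesRat_pow_succ, ihm, ihk,
        show 2 * (m + 1) + (k + 1) = (2 * m + k + 2) + 1 by ring,
        show 2 * (m + 1) + k = 2 * m + k + 2 by ring,
        show 2 * m + (k + 1 + 1) = 2 * m + k + 2 by ring,
        show m + 1 + (k + 1) = (m + k + 1) + 1 by ring,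
        show m + 1 + k = m + k + 1 by ring,
        show m + (k + 1 + 1) = m + k + 1 + 1 by ring,
        Nat.choose_succ_succ' (2 * m + k + 2) (m + k + 1)]
      have h := Nat.choose_succ_right_eq (2 * m + k + 2) (m + k + 1)
      rw [show 2 * m + k + 2 - (m + k + 1) = m + 1 by omega] at h
      have h' : ((2 * m + k + 2).choose (m + k + 1 + 1) : ℚ) =
          (2 * m + k + 2).choose (m + k + 1) * (m + 1) / (m + k + 2) := by
        rw [eq_div_iff (by positivity)]
        have := congrArg (Nat.cast (R := ℚ)) h
        push_cast at this
        linarith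
      push_cast
      rw [h']
      field_simp
      ring

/-- A sequence whose generating function `F` satisfies `F * (1 + X ^ 2 * C) = C`, where `C` is
the Catalan generating function, expands as an alternating sum of ballot numbers. -/
theorem eq_alternating_sum_of_catalan_rec (F : ℕ → ℕ)
    (hF : ∀ n, catalan n = F n + ∑ i ∈ Finset.range (n - 1), F i * catalan (n - 2 - i)) (n : ℕ) :
    (F n : ℚ) = ∑ k ∈ Finset.range (n / 2 + 1), (-1 : ℚ) ^ k *
      (((k : ℚ) + 1) / ((n : ℚ) - k + 1)) * ((2 * n - 3 * k).choose (n - k) : ℚ) := by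
  set f : PowerSeries ℚ := PowerSeries.mk fun n => (F n : ℚ) with hf
  have hmul : f + f * catalanSeriesRat * PowerSeries.X ^ 2 = catalanSeriesRat := by
    ext n
    rw [map_add, PowerSeries.coeff_mul_X_pow', coeff_catalanSeriesRat, hF n]
    simp only [hf, PowerSeries.coeff_mk]
    push_cast
    congr 1
    split_ifs with h
    · rw [PowerSeries.coeff_mul, Finset.Nat.sum_antidiagonal_eq_sum_range_succ_mk,
        show (n - 2).succ = n - 1 by omega]
      simp [coeff_catalanSeriesRat]
    · rw [show n - 1 = 0 by omega]
      simp
  have hpow : ∀ n k, PowerSeries.coeff n (f * catalanSeriesRat ^ k) =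
      ∑ j ∈ Finset.range (n / 2 + 1),
        (-1 : ℚ) ^ j * PowerSeries.coeff (n - 2 * j) (catalanSeriesRat ^ (k + j + 1)) := by
    intro n
    induction n using Nat.strong_induction_on with
    | _ n ih =>
      intro k
      have h : f * catalanSeriesRat ^ k =
          catalanSeriesRat ^ (k + 1) - f * catalanSeriesRat ^ (k + 1) * PowerSeries.X ^ 2 := by
        rw [pow_succ, ← sub_eq_zero]
        linear_combination (catalanSeriesRat ^ k) * hmul
      rw [h, map_sub, PowerSeries.coeff_mul_X_pow', Finset.sum_range_succ']
      split_ifs with h2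
      · rw [ih (n - 2) (by omega), show (n - 2) / 2 + 1 = n / 2 by omega, sub_eq_add_neg, add_comm,
          ← Finset.sum_neg_distrib]
        congr 1
        · refine Finset.sum_congr rfl fun j _ => ?_
          rw [show n - 2 - 2 * j = n - 2 * (j + 1) by omega,
            show k + 1 + j + 1 = k + (j + 1) + 1 by ring]
          ring
        · simp
      · rw [show n / 2 = 0 by omega]
        simp
  have h0 := hpow n 0
  simp only [pow_zero, mul_one] at h0
  rw [show (F n : ℚ) = PowerSeries.coeff n f by simp [hf], h0]
  refine Finset.sum_congr rfl fun k hk => ?_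
  have hk' : 2 * k ≤ n := by
    have := Finset.mem_range.mp hk
    omega
  rw [zero_add, coeff_catalanSeriesRat_pow, show 2 * (n - 2 * k) + k = 2 * n - 3 * k by omega,
    show n - 2 * k + k = n - k by omega, Nat.cast_sub hk']
  push_cast
  rw [show (n : ℚ) - 2 * k + k + 1 = n - k + 1 by ring]
  ring

/-- Partition a finite type according to the least index at which `R w` holds. -/
theorem card_eq_card_none_add_sum_card_first {T : Type*} [Finite T] (R : T → ℕ → Prop) (N : ℕ)
    (hN : ∀ w i, R w i → i < N) :
    Nat.card T = Nat.card {w // ∀ i, ¬R w i} +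
      ∑ i ∈ Finset.range N, Nat.card {w // R w i ∧ ∀ j < i, ¬R w j} := by
  classical
  have e : T ≃ {w // ∀ i, ¬R w i} ⊕ Σ i : Fin N, {w // R w i ∧ ∀ j < (i : ℕ), ¬R w j} :=
    { toFun := fun w => if h : ∃ i, R w i then
          Sum.inr ⟨⟨Nat.find h, hN w _ (Nat.find_spec h)⟩, w, Nat.find_spec h,
            fun j hj => Nat.find_min h hj⟩
        else Sum.inl ⟨w, not_exists.mp h⟩
      invFun := Sum.elim (fun w => w.1) (fun w => w.2.1)
      left_inv := fun w => by
        by_cases h : ∃ i, R w i <;> simp [h]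
      right_inv := by
        rintro (⟨w, hw⟩ | ⟨⟨i, hi⟩, w, hw, hw'⟩)
        · simp [hw]
        · have h : ∃ i, R w i := ⟨i, hw⟩
          have hfind : Nat.find h = i := (Nat.find_eq_iff h).mpr ⟨hw, hw'⟩
          subst hfind
          exact dif_pos h }
  rw [Nat.card_congr e, Nat.card_sum, Nat.card_sigma,
    Fin.sum_univ_eq_sum_range (fun i => Nat.card {w // R w i ∧ ∀ j < i, ¬R w j})]

/-- A `2`-hill of the path `p` starts after `k` steps. -/
def HasTwoHillAt (p : List Bool) (k : ℕ) : Prop :=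
  balancedAt p k ∧ p[k]? = some true ∧ p[k + 1]? = some true ∧
    p[k + 2]? = some false ∧ p[k + 3]? = some false

theorem numTwoHills_eq_zero_iff (p : List Bool) :
    numTwoHills p = 0 ↔ ∀ k, ¬HasTwoHillAt p k := by
  have hfin : Finite {k : ℕ // HasTwoHillAt p k} := by
    refine Set.Finite.subset (Set.finite_lt_nat p.length) fun k hk => ?_
    exact (List.getElem?_eq_some_iff.mp hk.2.1).1
  change Nat.card {k : ℕ // HasTwoHillAt p k} = 0 ↔ _
  rw [Finite.card_eq_zero_iff, isEmpty_subtype]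

theorem count_true_add_count_false (p : List Bool) : p.count true + p.count false = p.length := by
  induction p with
  | nil => rfl
  | cons b p ih => cases b <;> simp <;> omega

theorem IsDyck.count_false {n : ℕ} {p : List Bool} (h : IsDyck n p) : p.count false = n := by
  have := count_true_add_count_false p
  have := h.1
  have := h.2.1
  omega

theorem IsDyck.take_count_le {n : ℕ} {p : List Bool} (h : IsDyck n p) (i : ℕ) :
    (p.take i).count false ≤ (p.take i).count true := by
  rcases le_total i (2 * n) with hi | hi
  · exact h.2.2 i hi
  · rw [List.take_of_length_le (by rw [h.1]; exact hi), h.2.1, h.count_false]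

theorem isDyck_append_iff {a n : ℕ} {p q : List Bool} (hp : p.length = 2 * a)
    (hbal : p.count true = a) :
    IsDyck (a + n) (p ++ q) ↔ IsDyck a p ∧ IsDyck n q := by
  have hbal' : p.count false = a := by
    have := count_true_add_count_false p
    omega
  constructor
  · intro h
    refine ⟨⟨hp, hbal, fun i hi => ?_⟩, ?_, ?_, fun i _ => ?_⟩
    · have := h.take_count_le i
      rwa [List.take_append_of_le_length (by omega)] at this
    · have := h.1
      rw [List.length_append] at this
      omega
    · have := h.2.1
      rw [List.count_append] at this
      omega
    · have := h.take_count_le (p.length + i)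
      rw [List.take_length_add_append, List.count_append, List.count_append] at this
      omega
  · rintro ⟨h, h'⟩
    refine ⟨?_, ?_, fun i _ => ?_⟩
    · rw [List.length_append, h.1, h'.1]
      ring
    · rw [List.count_append, h.2.1, h'.2.1]
    · rw [List.take_append, List.count_append, List.count_append]
      exact Nat.add_le_add (h.take_count_le _) (h'.take_count_le _)

theorem isDyck_two_hill : IsDyck 2 [true, true, false, false] := by
  refine ⟨rfl, rfl, ?_⟩
  decide

/-- The Bool-valued Dyck paths of semilength `n` are Mathlib's Dyck words. -/
def isDyckEquivDyckWord (n : ℕ) :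
    {p : List Bool // IsDyck n p} ≃ {w : DyckWord // w.semilength = n} :=
  let e : Bool ≃ DyckStep :=
    { toFun := fun b => if b then DyckStep.U else DyckStep.D
      invFun := fun s => s = DyckStep.U
      left_inv := by decide
      right_inv := by rintro (_ | _) <;> rfl }
  have hcU : ∀ p : List Bool, (p.map e).count DyckStep.U = p.count true := fun p =>
    List.count_map_of_injective p e e.injective true
  have hcD : ∀ p : List Bool, (p.map e).count DyckStep.D = p.count false := fun p =>
    List.count_map_of_injective p e e.injective false
  have hU : ∀ l : List DyckStep, (l.map e.symm).count true = l.count DyckStep.U := fun l =>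
    List.count_map_of_injective l e.symm e.symm.injective DyckStep.U
  have hD : ∀ l : List DyckStep, (l.map e.symm).count false = l.count DyckStep.D := fun l =>
    List.count_map_of_injective l e.symm e.symm.injective DyckStep.D
  { toFun := fun p => ⟨⟨p.1.map e, by rw [hcU, hcD, p.2.2.1, p.2.count_false], fun i => by
        rw [← List.map_take, hcU, hcD]
        exact p.2.take_count_le i⟩, (hcU _).trans p.2.2.1⟩
    invFun := fun w => ⟨w.1.toList.map e.symm, by
        rw [List.length_map, ← w.1.two_mul_semilength_eq_length, w.2], by
        rw [hU]
        exact w.2, fun i _ => by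
        rw [← List.map_take, hU, hD]
        exact w.1.count_D_le_count_U i⟩
    left_inv := fun p => by
      apply Subtype.ext
      simp
    right_inv := fun w => by
      apply Subtype.ext
      apply DyckWord.ext
      simp }

theorem card_isDyck (n : ℕ) : Nat.card {p : List Bool // IsDyck n p} = catalan n := by
  rw [Nat.card_congr (isDyckEquivDyckWord n), Nat.card_eq_fintype_card,
    DyckWord.card_dyckWord_semilength_eq_catalan]

instance finite_isDyck (n : ℕ) : Finite {p : List Bool // IsDyck n p} :=
  Finite.of_equiv _ (isDyckEquivDyckWord n).symm

theorem HasTwoHillAt.even {p : List Bool} {k : ℕ} (h : HasTwoHillAt p k) :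
    ∃ i, k = 2 * i := by
  have h1 := count_true_add_count_false (p.take k)
  have h2 : (p.take k).count true = (p.take k).count false := h.1
  have h3 := (List.getElem?_eq_some_iff.mp h.2.1).1
  rw [List.length_take] at h1
  exact ⟨(p.take k).count true, by omega⟩

theorem HasTwoHillAt.add_three_lt_length {p : List Bool} {k : ℕ} (h : HasTwoHillAt p k) :
    k + 3 < p.length :=
  (List.getElem?_eq_some_iff.mp h.2.2.2.2).1

/-- Appending a `2`-hill and a further path to `p` creates no `2`-hill starting inside `p`. -/
theorem hasTwoHillAt_append_iff {p q : List Bool} {k : ℕ} (hk : k < p.length) :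
    HasTwoHillAt (p ++ [true, true, false, false] ++ q) k ↔ HasTwoHillAt p k := by
  have hbal : balancedAt (p ++ ([true, true, false, false] ++ q)) k ↔ balancedAt p k := by
    unfold balancedAt
    rw [List.take_append_of_le_length hk.le]
  rw [List.append_assoc]
  constructor
  · rintro ⟨h, h0, h1, h2, h3⟩
    have key : k + 3 < p.length := by
      by_contra hlt
      obtain h' | h' | h' : k + 1 = p.length ∨ k + 2 = p.length ∨ k + 3 = p.length := by omega
      · rw [show k + 2 = p.length + 1 by omega] at h2
        simp at h2
      · rw [h'] at h2
        simp at h2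
      · rw [h'] at h3
        simp at h3
    rw [List.getElem?_append_left (by omega)] at h0 h1 h2 h3
    exact ⟨hbal.mp h, h0, h1, h2, h3⟩
  · intro h
    have key := h.add_three_lt_length
    obtain ⟨h, h0, h1, h2, h3⟩ := h
    refine ⟨hbal.mpr h, ?_, ?_, ?_, ?_⟩ <;> rw [List.getElem?_append_left (by omega)] <;>
      assumption

theorem IsDyck.hasTwoHillAt_append {a : ℕ} {p : List Bool} (hp : IsDyck a p) (q : List Bool) :
    HasTwoHillAt (p ++ [true, true, false, false] ++ q) (2 * a) := by
  rw [← hp.1, List.append_assoc]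
  refine ⟨?_, ?_, ?_, ?_, ?_⟩
  · simp [balancedAt, hp.2.1, hp.count_false]
  all_goals simp

theorem HasTwoHillAt.eq_append {p : List Bool} {k : ℕ} (h : HasTwoHillAt p k) :
    p = p.take k ++ [true, true, false, false] ++ p.drop (k + 4) := by
  obtain ⟨-, h0, h1, h2, h3⟩ := h
  obtain ⟨l0, h0⟩ := List.getElem?_eq_some_iff.mp h0
  obtain ⟨l1, h1⟩ := List.getElem?_eq_some_iff.mp h1
  obtain ⟨l2, h2⟩ := List.getElem?_eq_some_iff.mp h2
  obtain ⟨l3, h3⟩ := List.getElem?_eq_some_iff.mp h3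
  conv_lhs => rw [← List.take_append_drop k p, List.drop_eq_getElem_cons l0,
    List.drop_eq_getElem_cons l1, List.drop_eq_getElem_cons l2, List.drop_eq_getElem_cons l3,
    h0, h1, h2, h3]
  simp

/-- Cutting a Dyck path at its first `2`-hill. -/
def firstTwoHillEquiv (a b : ℕ) :
    {p : {p : List Bool // IsDyck (a + 2 + b) p} // HasTwoHillAt p.1 (2 * a) ∧
      ∀ j < a, ¬HasTwoHillAt p.1 (2 * j)} ≃
    {p : {p : List Bool // IsDyck a p} // ∀ j, ¬HasTwoHillAt p.1 (2 * j)} ×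
      {p : List Bool // IsDyck b p} :=
  have hdec : ∀ p : List Bool, IsDyck (a + 2 + b) p → HasTwoHillAt p (2 * a) →
      IsDyck a (p.take (2 * a)) ∧ IsDyck b (p.drop (2 * a + 4)) := by
    intro p hp h
    have hlen := h.add_three_lt_length
    have htake : (p.take (2 * a)).length = 2 * a := by
      rw [List.length_take]
      omega
    have hcount : (p.take (2 * a)).count true = a := by
      have h1 := count_true_add_count_false (p.take (2 * a))
      have h2 : (p.take (2 * a)).count true = (p.take (2 * a)).count false := h.1
      omega
    rw [h.eq_append, List.append_assoc, add_assoc, isDyck_append_iff htake hcount,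
      isDyck_append_iff isDyck_two_hill.1 isDyck_two_hill.2.1] at hp
    exact ⟨hp.1, hp.2.2⟩
  { toFun := fun p => (⟨⟨p.1.1.take (2 * a), (hdec _ p.1.2 p.2.1).1⟩, fun j hj => by
        have hlen := hj.add_three_lt_length
        have hD := (hdec _ p.1.2 p.2.1).1
        have hj' : 2 * j < (p.1.1.take (2 * a)).length := by
          dsimp only at hlen
          omega
        refine p.2.2 j (by rw [hD.1] at hj'; omega) ?_
        rw [p.2.1.eq_append]
        exact (hasTwoHillAt_append_iff hj').mpr hj⟩,
      ⟨p.1.1.drop (2 * a + 4), (hdec _ p.1.2 p.2.1).2⟩)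
    invFun := fun x => ⟨⟨x.1.1.1 ++ [true, true, false, false] ++ x.2.1, by
        rw [List.append_assoc, add_assoc, isDyck_append_iff x.1.1.2.1 x.1.1.2.2.1,
          isDyck_append_iff isDyck_two_hill.1 isDyck_two_hill.2.1]
        exact ⟨x.1.1.2, isDyck_two_hill, x.2.2⟩⟩, x.1.1.2.hasTwoHillAt_append _, fun j hj h => by
        have hlen := x.1.1.2.1
        exact x.1.2 j ((hasTwoHillAt_append_iff (by omega)).mp h)⟩
    left_inv := fun p => by
      apply Subtype.ext
      apply Subtype.ext
      exact p.2.1.eq_append.symm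
    right_inv := fun x => by
      have hlen := x.1.1.2.1
      refine Prod.ext (Subtype.ext (Subtype.ext ?_)) (Subtype.ext ?_)
      · simp [← hlen]
      · simp [← hlen] }

theorem catalan_eq_add_sum_of_split {T : ℕ → Type} [∀ n, Finite (T n)]
    (hT : ∀ n, Nat.card (T n) = catalan n) (R : ∀ n, T n → ℕ → Prop)
    (hR : ∀ n w i, R n w i → i < n - 1)
    (e : ∀ a b, {w : T (a + 2 + b) // R _ w a ∧ ∀ j < a, ¬R _ w j} ≃
      {w : T a // ∀ j, ¬R _ w j} × T b) (n : ℕ) :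
    catalan n = Nat.card {w : T n // ∀ i, ¬R _ w i} +
      ∑ i ∈ Finset.range (n - 1), Nat.card {w : T i // ∀ j, ¬R _ w j} * catalan (n - 2 - i) := by
  rw [← hT n, card_eq_card_none_add_sum_card_first (R n) (n - 1) (hR n)]
  congr 1
  refine Finset.sum_congr rfl fun i hi => ?_
  have hi' := Finset.mem_range.mp hi
  obtain ⟨b, rfl⟩ : ∃ b, n = i + 2 + b := ⟨n - 2 - i, by omega⟩
  rw [Nat.card_congr (e i b), Nat.card_prod, hT, show i + 2 + b - 2 - i = b by omega]

theorem card_isDyck_no_two_hill (n : ℕ) :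
    (Nat.card {p : List Bool // IsDyck n p ∧ numTwoHills p = 0} : ℚ) =
        ∑ k ∈ Finset.range (n / 2 + 1), (-1 : ℚ) ^ k *
          (((k : ℚ) + 1) / ((n : ℚ) - k + 1)) * ((2 * n - 3 * k).choose (n - k) : ℚ) := by
  have hcard : Nat.card {p : List Bool // IsDyck n p ∧ numTwoHills p = 0} =
      Nat.card {p : {p : List Bool // IsDyck n p} // ∀ i, ¬HasTwoHillAt p.1 (2 * i)} := by
    refine Nat.card_congr (Equiv.trans (Equiv.subtypeEquivRight fun p => ?_)
      (Equiv.subtypeSubtypeEquivSubtypeInter (IsDyck n)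
        fun p => ∀ i, ¬HasTwoHillAt p (2 * i)).symm)
    rw [numTwoHills_eq_zero_iff]
    refine and_congr_right fun _ => ⟨fun h i => h _, fun h k hk => ?_⟩
    obtain ⟨i, rfl⟩ := hk.even
    exact h i hk
  rw [hcard]
  refine eq_alternating_sum_of_catalan_rec
    (fun n => Nat.card {p : {p : List Bool // IsDyck n p} // ∀ i, ¬HasTwoHillAt p.1 (2 * i)})
    (catalan_eq_add_sum_of_split card_isDyck (fun n p i => HasTwoHillAt p.1 (2 * i))
      (fun n p i h => ?_) firstTwoHillEquiv) n
  have h1 := h.add_three_lt_length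
  have h2 := p.2.1
  omega

/-- `e j` is the first vertex after the support of the indecomposable projective with top `j`,
for an LNakayama algebra with vertices `0, …, n`, extended by `e j = n + 1` for `j ≥ n`. -/
structure IsSupportEnd (n : ℕ) (e : ℕ → ℕ) : Prop where
  mono : Monotone e
  add_two_le : ∀ j < n, j + 2 ≤ e j
  le_succ : ∀ j, e j ≤ n + 1
  eq_succ : ∀ j, n ≤ j → e j = n + 1

/-- The combinatorial description of `2`-regularity of the simple module at vertex `i`. -/
structure IsTwoRegAt (n : ℕ) (e : ℕ → ℕ) (i : ℕ) : Prop where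
  add_two_le : i + 2 ≤ n
  eq_add_two : e i = i + 2
  eq_next : e (i + 1) = e (i + 2)
  ne_succ : ∀ j, e j ≠ i + 1

instance finite_isSupportEnd (n : ℕ) : Finite {e : ℕ → ℕ // IsSupportEnd n e} := by
  let g : {e : ℕ → ℕ // IsSupportEnd n e} → Fin n → Fin (n + 2) := fun e j =>
    ⟨e.1 j, Nat.lt_succ_of_le (e.2.le_succ j)⟩
  refine Finite.of_injective g fun e e' h => Subtype.ext (funext fun j => ?_)
  rcases lt_or_ge j n with hj | hj
  · exact congrArg Fin.val (congrFun h ⟨j, hj⟩)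
  · rw [e.2.eq_succ j hj, e'.2.eq_succ j hj]

theorem IsSupportEnd.pos {n : ℕ} {e : ℕ → ℕ} (h : IsSupportEnd n e) (j : ℕ) : 1 ≤ e j := by
  rcases lt_or_ge j n with hj | hj
  · have := h.add_two_le j hj
    omega
  · have := h.eq_succ j hj
    omega

theorem IsSupportEnd.shift {a b : ℕ} {e : ℕ → ℕ} (h : IsSupportEnd (a + b) e) :
    IsSupportEnd b fun j => e (a + j) - a where
  mono := fun j k hjk => Nat.sub_le_sub_right (h.mono (Nat.add_le_add_left hjk a)) a
  add_two_le := fun j hj => by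
    have := h.add_two_le (a + j) (by omega)
    omega
  le_succ := fun j => by
    have := h.le_succ (a + j)
    omega
  eq_succ := fun j hj => by
    have := h.eq_succ (a + j) (by omega)
    omega

/-- Cutting at the first vertex `a` whose projective has dimension two. -/
def firstReturnEquiv (a b : ℕ) :
    {e : {e : ℕ → ℕ // IsSupportEnd (a + 1 + b) e} // (a < a + 1 + b ∧ e.1 a = a + 2) ∧
      ∀ j < a, ¬(j < a + 1 + b ∧ e.1 j = j + 2)} ≃
    {e : ℕ → ℕ // IsSupportEnd a e} × {e : ℕ → ℕ // IsSupportEnd b e} where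
  toFun e := (⟨fun j => min (e.1.1 j) (a + 2) - 1, by
      obtain ⟨⟨e, he⟩, ⟨-, h⟩, hj⟩ := e
      dsimp only at h hj ⊢
      refine ⟨fun j k hjk => ?_, fun j hja => ?_, fun j => ?_, fun j hja => ?_⟩
      · have := he.mono hjk
        omega
      · have h1 := hj j hja
        have h2 := he.add_two_le j (by omega)
        omega
      · omega
      · have := he.mono hja
        omega⟩, ⟨_, e.1.2.shift⟩)
  invFun x := ⟨⟨fun j => if j ≤ a then x.1.1 j + 1 else x.2.1 (j - (a + 1)) + (a + 1), by
      obtain ⟨⟨f, hf⟩, ⟨g, hg⟩⟩ := x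
      dsimp only
      refine ⟨fun j k hjk => ?_, fun j hja => ?_, fun j => ?_, fun j hja => ?_⟩
      · have h1 := hf.mono hjk
        have h2 := hg.mono (Nat.sub_le_sub_right hjk (a + 1))
        have h3 := hf.le_succ j
        split_ifs
        · omega
        · have h4 := hg.pos (k - (a + 1))
          omega
        · omega
        · omega
      · split_ifs with h
        · rcases h.lt_or_eq with h | h
          · have := hf.add_two_le j h
            omega
          · have := hf.eq_succ j (by omega)
            omega
        · have := hg.add_two_le (j - (a + 1)) (by omega)
          omega
      · have h1 := hf.le_succ j
        have h2 := hg.le_succ (j - (a + 1))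
        split_ifs <;> omega
      · rw [if_neg (by omega), hg.eq_succ _ (by omega)]
        omega⟩, by
      obtain ⟨⟨f, hf⟩, ⟨g, hg⟩⟩ := x
      dsimp only
      refine ⟨⟨by omega, ?_⟩, fun j hj => ?_⟩
      · rw [if_pos le_rfl, hf.eq_succ a le_rfl]
      · have := hf.add_two_le j hj
        rw [if_pos hj.le]
        omega⟩
  left_inv e := by
    obtain ⟨⟨e, he⟩, ⟨-, h⟩, hj⟩ := e
    refine Subtype.ext (Subtype.ext (funext fun j => ?_))
    dsimp only at h ⊢
    split_ifs with hja
    · have h1 := he.mono hja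
      have h2 := he.add_two_le j (by omega)
      omega
    · have h2 := he.mono (not_le.mp hja).le
      rw [show a + 1 + (j - (a + 1)) = j by omega]
      omega
  right_inv x := by
    obtain ⟨⟨f, hf⟩, ⟨g, hg⟩⟩ := x
    refine Prod.ext (Subtype.ext (funext fun j => ?_)) (Subtype.ext (funext fun j => ?_))
    · dsimp only
      split_ifs with hja
      · have := hf.le_succ j
        omega
      · have h1 := hf.eq_succ j (by omega)
        have h2 := hg.pos (j - (a + 1))
        omega
    · dsimp only
      rw [if_neg (by omega), Nat.add_sub_cancel_left]
      omega

theorem card_isSupportEnd (n : ℕ) : Nat.card {e : ℕ → ℕ // IsSupportEnd n e} = catalan n := by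
  induction n using Nat.strong_induction_on with
  | _ n ih =>
    rcases n with _ | n
    · rw [catalan_zero, Nat.card_eq_one_iff_exists]
      refine ⟨⟨fun _ => 1, monotone_const, fun j hj => by omega, fun j => le_rfl,
        fun j _ => rfl⟩, fun e => Subtype.ext (funext fun j => e.2.eq_succ j (Nat.zero_le j))⟩
    · rw [card_eq_card_none_add_sum_card_first
        (fun (e : {e : ℕ → ℕ // IsSupportEnd (n + 1) e}) i => i < n + 1 ∧ e.1 i = i + 2) (n + 1)
        (fun _ _ h => h.1)]
      have hnone : IsEmpty {e : {e : ℕ → ℕ // IsSupportEnd (n + 1) e} //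
          ∀ i, ¬(i < n + 1 ∧ e.1 i = i + 2)} := by
        refine ⟨fun e => e.2 n ⟨by omega, ?_⟩⟩
        have h1 := e.1.2.add_two_le n (by omega)
        have h2 := e.1.2.le_succ n
        omega
      rw [Nat.card_of_isEmpty, zero_add, catalan_succ,
        ← Fin.sum_univ_eq_sum_range (fun i => Nat.card
          {e : {e : ℕ → ℕ // IsSupportEnd (n + 1) e} // (i < n + 1 ∧ e.1 i = i + 2) ∧
            ∀ j < i, ¬(j < n + 1 ∧ e.1 j = j + 2)})]
      refine Finset.sum_congr rfl fun i _ => ?_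
      rw [← ih i i.2, ← ih (n - i) (by omega), ← Nat.card_prod,
        ← Nat.card_congr (firstReturnEquiv i (n - i)), show (i : ℕ) + 1 + (n - i) = n + 1 by omega]

/-- Cutting at the first `2`-regular vertex. -/
def firstTwoRegEquiv (a b : ℕ) :
    {e : {e : ℕ → ℕ // IsSupportEnd (a + 2 + b) e} // IsTwoRegAt (a + 2 + b) e.1 a ∧
      ∀ j < a, ¬IsTwoRegAt (a + 2 + b) e.1 j} ≃
    {e : {e : ℕ → ℕ // IsSupportEnd a e} // ∀ j, ¬IsTwoRegAt a e.1 j} ×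
      {e : ℕ → ℕ // IsSupportEnd b e} where
  toFun e := (⟨⟨fun j => min (e.1.1 j) (a + 1), by
      obtain ⟨⟨e, he⟩, h, -⟩ := e
      have h2 := h.eq_add_two
      dsimp only at h2 ⊢
      refine ⟨fun j k hjk => ?_, fun j hja => ?_, fun j => ?_, fun j hja => ?_⟩
      · have := he.mono hjk
        omega
      · have := he.add_two_le j (by omega)
        omega
      · omega
      · have := he.mono hja
        omega⟩, by
      obtain ⟨⟨e, he⟩, h, hlt⟩ := e
      dsimp only at h hlt ⊢
      intro j hj
      have h1 := hj.add_two_le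
      have h2 := hj.eq_add_two
      have h3 := hj.eq_next
      refine hlt j (by omega) ⟨by omega, by omega, ?_, fun k hk => hj.ne_succ k ?_⟩
      · have h4 := h.ne_succ (j + 1)
        have h5 := h.ne_succ (j + 2)
        have h6 := he.mono h1
        have h7 := he.mono (Nat.le_succ (j + 1))
        have h8 := h.eq_add_two
        simp only [Nat.succ_eq_add_one, add_assoc, Nat.reduceAdd] at h7
        omega
      · omega⟩, ⟨_, e.1.2.shift⟩)
  invFun x := ⟨⟨fun j => if j ≤ a then (if x.1.1.1 j = a + 1 then a + 2 else x.1.1.1 j)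
        else x.2.1 (j - (a + 2)) + (a + 2), by
      obtain ⟨⟨⟨f, hf⟩, -⟩, ⟨g, hg⟩⟩ := x
      dsimp only
      refine ⟨fun j k hjk => ?_, fun j hja => ?_, fun j => ?_, fun j hja => ?_⟩
      · have h1 := hf.mono hjk
        have h2 := hg.mono (Nat.sub_le_sub_right hjk (a + 2))
        have h3 := hf.le_succ j
        have h4 := hf.le_succ k
        split_ifs <;> omega
      · split_ifs with h h'
        · omega
        · have h1 := hf.eq_succ j
          have h2 := hf.add_two_le j
          omega
        · have h1 := hg.add_two_le (j - (a + 2))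
          have h2 := hg.eq_succ 0
          have h3 := hg.add_two_le 0
          rcases eq_or_ne j (a + 1) with rfl | hj
          · rw [show a + 1 - (a + 2) = 0 by omega]
            omega
          · omega
      · have h1 := hf.le_succ j
        have h2 := hg.le_succ (j - (a + 2))
        split_ifs <;> omega
      · rw [if_neg (by omega), hg.eq_succ _ (by omega)]
        omega⟩, by
      obtain ⟨⟨⟨f, hf⟩, hf'⟩, ⟨g, hg⟩⟩ := x
      dsimp only at hf' ⊢
      refine ⟨⟨by omega, ?_, ?_, fun j => ?_⟩, fun j hj h => ?_⟩
      · simp [hf.eq_succ a le_rfl]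
      · simp
      · have h1 := hf.le_succ j
        split_ifs <;> omega
      · have h2 := h.eq_add_two
        have h3 := h.eq_next
        have h4 := h.ne_succ
        have h5 := hf.add_two_le (j + 1)
        have h6 := hf.eq_succ a le_rfl
        have hja : j + 2 ≤ a := by
          by_contra hlt
          rw [if_pos (by omega)] at h2
          split_ifs at h2 with h7
          · omega
          · have := hf.mono hj.le
            omega
        rw [if_pos (by omega)] at h2
        rw [if_pos (show j + 1 ≤ a by omega), if_pos (show j + 2 ≤ a by omega)] at h3
        have h7 := hf.le_succ (j + 1)
        have h8 := hf.le_succ (j + 2)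
        refine hf' j ⟨hja, ?_, ?_, fun k hk => h4 k ?_⟩
        · split_ifs at h2 <;> omega
        · split_ifs at h3 <;> omega
        · have hka : k ≤ a := by
            by_contra hlt
            have := hf.eq_succ k (by omega)
            omega
          rw [if_pos hka, if_neg (by omega), hk]⟩
  left_inv e := by
    obtain ⟨⟨e, he⟩, h, -⟩ := e
    have h1 := h.eq_add_two
    have h2 := h.eq_next
    refine Subtype.ext (Subtype.ext (funext fun j => ?_))
    dsimp only at h1 h2 ⊢
    split_ifs with hja h'
    · have := he.mono hja
      have := h.ne_succ j
      dsimp only at this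
      omega
    · omega
    · have h3 := he.mono (not_le.mp hja).le
      rcases eq_or_ne j (a + 1) with rfl | hj
      · rw [show a + 2 + (a + 1 - (a + 2)) = a + 2 by omega]
        omega
      · rw [show a + 2 + (j - (a + 2)) = j by omega]
        omega
  right_inv x := by
    obtain ⟨⟨⟨f, hf⟩, -⟩, ⟨g, hg⟩⟩ := x
    refine Prod.ext (Subtype.ext (Subtype.ext (funext fun j => ?_)))
      (Subtype.ext (funext fun j => ?_))
    · have h1 := hf.le_succ j
      have h2 := hf.eq_succ j
      dsimp only
      split_ifs <;> omega
    · dsimp only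
      rw [if_neg (by omega), Nat.add_sub_cancel_left]
      omega

theorem card_isSupportEnd_no_two_reg (n : ℕ) :
    (Nat.card {e : {e : ℕ → ℕ // IsSupportEnd n e} // ∀ i, ¬IsTwoRegAt n e.1 i} : ℚ) =
        ∑ k ∈ Finset.range (n / 2 + 1), (-1 : ℚ) ^ k *
          (((k : ℚ) + 1) / ((n : ℚ) - k + 1)) * ((2 * n - 3 * k).choose (n - k) : ℚ) :=
  eq_alternating_sum_of_catalan_rec
    (fun n => Nat.card {e : {e : ℕ → ℕ // IsSupportEnd n e} // ∀ i, ¬IsTwoRegAt n e.1 i})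
    (catalan_eq_add_sum_of_split card_isSupportEnd (fun n e i => IsTwoRegAt n e.1 i)
      (fun n e i h => by have := h.add_two_le; omega) firstTwoRegEquiv) n

theorem natCast_inj_of_le {n a b : ℕ} (ha : a ≤ n) (hb : b ≤ n) :
    ((a : ZMod (n + 1)) = b) ↔ a = b := by
  rw [ZMod.natCast_eq_natCast_iff', Nat.mod_eq_of_lt (by omega), Nat.mod_eq_of_lt (by omega)]

theorem exists_natCast_eq {n : ℕ} (i : ZMod (n + 1)) : ∃ v ≤ n, (v : ZMod (n + 1)) = i :=
  ⟨i.val, Nat.lt_succ_iff.mp (ZMod.val_lt i), ZMod.natCast_zmod_val i⟩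

theorem pdIs_succ_iff {n : ℕ} {c : ZMod n → ℕ} {i : ZMod n} {k m : ℕ} :
    PdIs c i k (m + 1) ↔ k < c i ∧ PdIs c (i + (k : ZMod n)) (c i - k) m :=
  ⟨fun h => by cases h; constructor <;> assumption, fun h => PdIs.step i k m h.1 h.2⟩

theorem coSyz_succ_iff {n : ℕ} {c : ZMod n → ℕ} {s s' : ZMod n} {k l k' : ℕ} :
    CoSyz c s k (l + 1) s' k' ↔ ∃ s₁ k₁, CoSyz c s k l s₁ k₁ ∧ k₁ < coK c s₁ ∧
      s' = s₁ - (k₁ : ZMod n) ∧ k' = coK c s₁ - k₁ := by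
  constructor
  · intro h
    cases h
    exact ⟨_, _, ‹_›, ‹_›, rfl, rfl⟩
  · rintro ⟨s₁, k₁, h, h', rfl, rfl⟩
    exact CoSyz.step s k l s₁ k₁ h h'

/-- `c` is the Kupisch series with support ends `e`. -/
def HasSupportEnd {n : ℕ} (c : ZMod (n + 1) → ℕ) (e : ℕ → ℕ) : Prop :=
  ∀ j ≤ n, j + c (j : ZMod (n + 1)) = e j

theorem IsSupportEnd.lt_apply {n : ℕ} {e : ℕ → ℕ} (he : IsSupportEnd n e) {j : ℕ} (hj : j ≤ n) :
    j < e j := by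
  rcases hj.lt_or_eq with h | rfl
  · have := he.add_two_le j h
    omega
  · rw [he.eq_succ j le_rfl]
    omega

/-- The first vertex whose projective has `v` in its support. -/
theorem IsSupportEnd.exists_first {n : ℕ} {e : ℕ → ℕ} (he : IsSupportEnd n e) {v : ℕ}
    (hv : v ≤ n) : ∃ u ≤ v, v < e u ∧ ∀ j < u, e j ≤ v := by
  classical
  have h : ∃ u, v < e u := ⟨v, he.lt_apply hv⟩
  exact ⟨Nat.find h, Nat.find_min' h (he.lt_apply hv), Nat.find_spec h,
    fun j hj => not_lt.mp (Nat.find_min h hj)⟩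

section Regular

variable {n : ℕ} {c : ZMod (n + 1) → ℕ} {e : ℕ → ℕ}

theorem coK_natCast (he : IsSupportEnd n e) (hc : HasSupportEnd c e) {u v : ℕ} (hv : v ≤ n)
    (huv : u ≤ v) (hu : v < e u) (hlt : ∀ j < u, e j ≤ v) : coK c (v : ZMod (n + 1)) = v + 1 - u := by
  refine IsLeast.csInf_eq ⟨⟨by omega, ?_⟩, fun k hk => ?_⟩
  · rcases u with _ | u
    · have hn : (v : ZMod (n + 1)) - ((v + 1 - 0 : ℕ) : ZMod (n + 1)) = (n : ZMod (n + 1)) := by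
        have h0 : ((n + 1 : ℕ) : ZMod (n + 1)) = 0 := ZMod.natCast_self _
        push_cast at h0 ⊢
        linear_combination -h0
      have h1 := hc n le_rfl
      have h2 := he.eq_succ n le_rfl
      rw [hn]
      omega
    · rw [← Nat.cast_sub (by omega), show v - (v + 1 - (u + 1)) = u by omega]
      have h1 := hc u (by omega)
      have h2 := hlt u (by omega)
      omega
  · by_contra hlt'
    obtain ⟨hk1, hk2⟩ := hk
    rw [← Nat.cast_sub (by omega)] at hk2
    have h1 := hc (v - k) (by omega)
    have h2 := he.mono (show u ≤ v - k by omega)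
    omega

theorem socle_natCast (he : IsSupportEnd n e) (hc : HasSupportEnd c e) {q : ℕ} (hq : q ≤ n) :
    (q : ZMod (n + 1)) + (c (q : ZMod (n + 1)) : ZMod (n + 1)) - 1 =
      ((e q - 1 : ℕ) : ZMod (n + 1)) := by
  rw [← Nat.cast_add, hc q hq, Nat.cast_sub (he.pos q), Nat.cast_one]

theorem pdIs_one_two_iff (he : IsSupportEnd n e) (hc : HasSupportEnd c e) {v : ℕ} (hv : v ≤ n) :
    PdIs c (v : ZMod (n + 1)) 1 2 ↔ v < n ∧ e v < e (v + 1) ∧ e (e v) = e (v + 1) := by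
  rw [pdIs_succ_iff, pdIs_succ_iff, pdIs_zero_iff]
  have h1 := hc v hv
  have h2 := he.lt_apply hv
  rcases hv.lt_or_eq with hv | rfl
  · have h3 := hc (v + 1) hv
    have h4 := he.lt_apply (show v + 1 ≤ n from hv)
    have h5 := he.add_two_le v hv
    have h6 := he.le_succ (v + 1)
    rw [← Nat.cast_add, ← Nat.cast_add, show v + 1 + (c (v : ZMod (n + 1)) - 1) = e v by omega]
    rcases lt_or_ge (e v) (e (v + 1)) with h | h
    · have h7 := hc (e v) (by omega)
      have h8 := he.lt_apply (show e v ≤ n by omega)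
      omega
    · omega
  · have := he.eq_succ v le_rfl
    omega

theorem extDim_zero_eq_zero_iff_s11 (he : IsSupportEnd n e) (hc : HasSupportEnd c e) {v : ℕ}
    (hv : v ≤ n) : extDim c (v : ZMod (n + 1)) 0 = 0 ↔ ∀ j, e j ≠ v + 1 := by
  rw [extDim, Finite.card_eq_zero_iff, isEmpty_subtype]
  have key : ∀ q ≤ n, (∃ m, CoSyz c ((q : ZMod (n + 1)) + (c (q : ZMod (n + 1)) : ZMod (n + 1)) - 1)
      (c (q : ZMod (n + 1))) 0 (v : ZMod (n + 1)) m) ↔ e q = v + 1 := by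
    intro q hq
    have h1 := he.le_succ q
    have h2 := he.pos q
    simp only [coSyz_zero_iff, exists_and_left, exists_eq, and_true]
    rw [socle_natCast he hc hq, natCast_inj_of_le hv (by omega)]
    omega
  constructor
  · intro h j hj
    rcases le_total j n with hjn | hjn
    · exact h j ((key j hjn).mpr hj)
    · refine h n ((key n le_rfl).mpr ?_)
      rw [← hj, he.eq_succ j hjn, he.eq_succ n le_rfl]
  · intro h r hr
    obtain ⟨q, hq, rfl⟩ := exists_natCast_eq r
    exact h q ((key q hq).mp hr)

theorem extDim_one_eq_zero (he : IsSupportEnd n e) (hc : HasSupportEnd c e) {v : ℕ}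
    (hv : v < n) (hlt : e v < e (v + 1)) : extDim c (v : ZMod (n + 1)) 1 = 0 := by
  rw [extDim, Finite.card_eq_zero_iff, isEmpty_subtype]
  rintro r ⟨m, hm⟩
  obtain ⟨s, k, hs, hk, hv', -⟩ := coSyz_succ_iff.mp hm
  obtain ⟨rfl, rfl⟩ := coSyz_zero_iff.mp hs
  have hr : r = ((v + 1 : ℕ) : ZMod (n + 1)) := by
    push_cast
    linear_combination -hv'
  subst hr
  have h1 := hc (v + 1) hv
  have h2 := he.le_succ (v + 1)
  have h3 := he.lt_apply (show v + 1 ≤ n from hv)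
  rw [socle_natCast he hc (q := v + 1) hv, coK_natCast he hc (u := v + 1) (by omega) (by omega) (by omega)
    (fun j hj => by
      have := he.mono (Nat.lt_succ_iff.mp hj)
      omega)] at hk
  omega

theorem exists_coSyz_two_iff (he : IsSupportEnd n e) (hc : HasSupportEnd c e) {v q : ℕ}
    (hv : v < n) (hlt : e v < e (v + 1)) (heq : e (e v) = e (v + 1)) (hq : q ≤ n) :
    (∃ m, CoSyz c ((q : ZMod (n + 1)) + (c (q : ZMod (n + 1)) : ZMod (n + 1)) - 1)
      (c (q : ZMod (n + 1))) 2 (v : ZMod (n + 1)) m) ↔ v + 2 ≤ q ∧ q ≤ e v := by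
  have hcq := hc q hq
  have hqe := he.lt_apply hq
  have hen := he.le_succ q
  have hdiff : ∀ t, t < q → ((e q - 1 : ℕ) : ZMod (n + 1)) - (c (q : ZMod (n + 1)) : ZMod (n + 1)) =
      ((q - 1 : ℕ) : ZMod (n + 1)) := by
    intro t ht
    rw [← Nat.cast_sub (by omega)]
    congr 1
    omega
  rw [socle_natCast he hc hq]
  constructor
  · rintro ⟨m, hm⟩
    obtain ⟨s₁, k₁, hs₁, hk₁, hv₁, -⟩ := coSyz_succ_iff.mp hm
    obtain ⟨s, k, hs, hk, rfl, rfl⟩ := coSyz_succ_iff.mp hs₁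
    obtain ⟨rfl, rfl⟩ := coSyz_zero_iff.mp hs
    obtain ⟨t, ht, hte, htlt⟩ := he.exists_first (show e q - 1 ≤ n by omega)
    rw [coK_natCast he hc (by omega) ht hte htlt] at hk hk₁ hv₁
    have htq : t < q := by omega
    rw [hdiff t htq] at hk₁ hv₁
    obtain ⟨u, hu, hue, hult⟩ := he.exists_first (show q - 1 ≤ n by omega)
    rw [coK_natCast he hc (by omega) hu hue hult] at hk₁
    rw [← Nat.cast_sub (by omega), natCast_inj_of_le hv.le (by omega)] at hv₁
    have := he.mono (show u ≤ v by omega)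
    omega
  · rintro ⟨h1, h2⟩
    have h3 := he.mono h2
    have h4 := he.mono (show v + 1 ≤ q by omega)
    have h5 := coK_natCast he hc (v := e q - 1) (u := v + 1) (by omega) (by omega) (by omega)
      (fun j hj => by
        have := he.mono (Nat.lt_succ_iff.mp hj)
        omega)
    obtain ⟨u, hu, hue, hult⟩ := he.exists_first (show q - 1 ≤ n by omega)
    have huv : u ≤ v := by
      by_contra h
      have := hult v (by omega)
      omega
    refine ⟨_, coSyz_succ_iff.mpr ⟨_, _, coSyz_succ_iff.mpr ⟨_, _, coSyz_zero_iff.mpr ⟨rfl, rfl⟩,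
      ?_, rfl, rfl⟩, ?_, ?_, rfl⟩⟩
    · omega
    · rw [hdiff (v + 1) (by omega), coK_natCast he hc (by omega) hu hue hult]
      omega
    · rw [hdiff (v + 1) (by omega), ← Nat.cast_sub (by omega)]
      congr 1
      omega

theorem extDim_two_eq (he : IsSupportEnd n e) (hc : HasSupportEnd c e) {v : ℕ}
    (hv : v < n) (hlt : e v < e (v + 1)) (heq : e (e v) = e (v + 1)) :
    extDim c (v : ZMod (n + 1)) 2 = e v - (v + 1) := by
  have hen := he.le_succ (v + 1)
  have hcard : e v - (v + 1) = Nat.card (Finset.Icc (v + 2) (e v)) := by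
    rw [Nat.card_eq_fintype_card, Fintype.card_coe, Nat.card_Icc]
    omega
  rw [hcard]
  symm
  refine Nat.card_eq_of_bijective (fun q => ⟨((q : ℕ) : ZMod (n + 1)), ?_⟩) ⟨?_, ?_⟩
  · have hq := Finset.mem_Icc.mp q.2
    exact (exists_coSyz_two_iff he hc hv hlt heq (by omega)).mpr hq
  · intro q q' h
    have hq := Finset.mem_Icc.mp q.2
    have hq' := Finset.mem_Icc.mp q'.2
    exact Subtype.ext
      ((natCast_inj_of_le (by omega) (by omega)).mp (congrArg Subtype.val h))
  · rintro ⟨r, hr⟩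
    obtain ⟨q, hq, rfl⟩ := exists_natCast_eq r
    exact ⟨⟨q, Finset.mem_Icc.mpr ((exists_coSyz_two_iff he hc hv hlt heq hq).mp hr)⟩, rfl⟩

theorem isRegular_two_iff (he : IsSupportEnd n e) (hc : HasSupportEnd c e) {v : ℕ} (hv : v ≤ n) :
    IsRegular c 2 (v : ZMod (n + 1)) ↔ IsTwoRegAt n e v := by
  constructor
  · rintro ⟨hpd, h01, h2⟩
    obtain ⟨hvn, hlt, heq⟩ := (pdIs_one_two_iff he hc hv).mp hpd
    rw [extDim_two_eq he hc hvn hlt heq] at h2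
    have h3 : e v = v + 2 := by omega
    have h4 := he.le_succ (v + 1)
    exact ⟨by omega, h3, by rw [← heq, h3],
      (extDim_zero_eq_zero_iff_s11 he hc hv).mp (h01 0 (by omega))⟩
  · rintro ⟨h1, h2, h3, h4⟩
    have hvn : v < n := by omega
    have hlt : e v < e (v + 1) := by
      have := he.add_two_le (v + 1) (by omega)
      omega
    have heq : e (e v) = e (v + 1) := by rw [h2, h3]
    refine ⟨(pdIs_one_two_iff he hc hv).mpr ⟨hvn, hlt, heq⟩, fun j hj => ?_, ?_⟩
    · interval_cases j
      · exact (extDim_zero_eq_zero_iff_s11 he hc hv).mpr h4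
      · exact extDim_one_eq_zero he hc hvn hlt
    · rw [extDim_two_eq he hc hvn hlt heq]
      omega

end Regular

/-- The support ends of the Kupisch series `c`. -/
def supportEnd {n : ℕ} (c : ZMod (n + 1) → ℕ) (j : ℕ) : ℕ :=
  if j ≤ n then j + c (j : ZMod (n + 1)) else n + 1

theorem hasSupportEnd_supportEnd {n : ℕ} (c : ZMod (n + 1) → ℕ) :
    HasSupportEnd c (supportEnd c) :=
  fun _ hj => (if_pos hj).symm

theorem IsLKupisch.isSupportEnd {n : ℕ} {c : ZMod (n + 1) → ℕ} (h : IsLKupisch n c) :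
    IsSupportEnd n (supportEnd c) := by
  obtain ⟨-, hstep, hn, htwo⟩ := h
  have hmono : Monotone (supportEnd c) := by
    refine monotone_nat_of_le_succ fun j => ?_
    have := hstep (j : ZMod (n + 1))
    unfold supportEnd
    split_ifs with h1 h2
    · push_cast
      omega
    · rw [show j = n by omega, hn]
    · omega
    · exact le_rfl
  have heq : ∀ j, n ≤ j → supportEnd c j = n + 1 := by
    intro j hj
    unfold supportEnd
    split_ifs with h1
    · rw [show j = n by omega, hn]
    · rfl
  refine ⟨hmono, fun j hj => ?_, fun j => ?_, heq⟩
  · have := htwo (j : ZMod (n + 1)) (by rw [Ne, natCast_inj_of_le hj.le le_rfl]; omega)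
    rw [supportEnd, if_pos hj.le]
    omega
  · rw [← heq (max j n) (le_max_right _ _)]
    exact hmono (le_max_left _ _)

theorem IsSupportEnd.exists_isLKupisch {n : ℕ} {e : ℕ → ℕ} (he : IsSupportEnd n e) :
    ∃ c : ZMod (n + 1) → ℕ, IsLKupisch n c ∧ supportEnd c = e := by
  have hval : ∀ v ≤ n, (v : ZMod (n + 1)).val = v :=
    fun v hv => ZMod.val_cast_of_lt (by omega)
  refine ⟨fun i => e i.val - i.val, ⟨fun i => ?_, fun i => ?_, ?_, fun i hi => ?_⟩, ?_⟩
  · obtain ⟨v, hv, rfl⟩ := exists_natCast_eq i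
    have := he.lt_apply hv
    dsimp only
    rw [hval v hv]
    omega
  · obtain ⟨v, hv, rfl⟩ := exists_natCast_eq i
    dsimp only
    rw [hval v hv]
    rcases hv.lt_or_eq with hlt | rfl
    · have := he.mono (show v ≤ v + 1 by omega)
      rw [← Nat.cast_succ, Nat.succ_eq_add_one, hval (v + 1) hlt]
      omega
    · have := he.eq_succ v le_rfl
      omega
  · have := he.eq_succ n le_rfl
    dsimp only
    rw [hval n le_rfl]
    omega
  · obtain ⟨v, hv, rfl⟩ := exists_natCast_eq i
    rw [Ne, natCast_inj_of_le hv le_rfl] at hi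
    have := he.add_two_le v (by omega)
    dsimp only
    rw [hval v hv]
    omega
  · funext j
    unfold supportEnd
    split_ifs with h
    · have := he.lt_apply h
      dsimp only
      rw [hval j h]
      omega
    · exact (he.eq_succ j (by omega)).symm

theorem supportEnd_injective {n : ℕ} :
    Function.Injective (supportEnd : (ZMod (n + 1) → ℕ) → ℕ → ℕ) := by
  intro c c' h
  funext i
  obtain ⟨v, hv, rfl⟩ := exists_natCast_eq i
  have h1 := hasSupportEnd_supportEnd c v hv
  have h2 := hasSupportEnd_supportEnd c' v hv
  rw [h] at h1
  omega

theorem card_isLKupisch_no_regular (n : ℕ) :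
    Nat.card {c : ZMod (n + 1) → ℕ // IsLKupisch n c ∧ ∀ i, ¬IsRegular c 2 i} =
      Nat.card {e : {e : ℕ → ℕ // IsSupportEnd n e} // ∀ i, ¬IsTwoRegAt n e.1 i} := by
  refine Nat.card_eq_of_bijective (fun c => ⟨⟨supportEnd c.1, c.2.1.isSupportEnd⟩, fun i hi => ?_⟩)
    ⟨fun c c' h => Subtype.ext (supportEnd_injective ?_), ?_⟩
  · have hin := hi.add_two_le
    exact c.2.2 i ((isRegular_two_iff c.2.1.isSupportEnd (hasSupportEnd_supportEnd c.1)
      (by omega)).mpr hi)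
  · exact congrArg (fun x => x.1.1) h
  · rintro ⟨⟨e, he⟩, hreg⟩
    obtain ⟨c, hc, rfl⟩ := he.exists_isLKupisch
    refine ⟨⟨c, hc, fun i hi => ?_⟩, rfl⟩
    obtain ⟨v, hv, rfl⟩ := exists_natCast_eq i
    exact hreg v ((isRegular_two_iff he (hasSupportEnd_supportEnd c) hv).mp hi)

/-- For `n ≥ 1`, the number of Dyck paths of semilength `n` without
2-hills equals `∑_{k=0}^{⌊n/2⌋} (-1)^k * ((k+1)/(n-k+1)) * binomial (2n-3k) (n-k)`.
Consequently this also equals the number of `(n+1)`-LNakayama algebras without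
2-regular simple modules, i.e. (by Enomoto's theorem) those whose category of finitely
generated projective modules has a unique exact structure. -/
theorem no_two_hill_count (n : ℕ) (hn : 1 ≤ n) :
    (Nat.card {p : List Bool // IsDyck n p ∧ numTwoHills p = 0} : ℚ) =
        ∑ k ∈ Finset.range (n / 2 + 1), (-1 : ℚ) ^ k *
          (((k : ℚ) + 1) / ((n : ℚ) - k + 1)) * ((2 * n - 3 * k).choose (n - k) : ℚ) ∧
      (Nat.card {c : ZMod (n + 1) → ℕ // IsLKupisch n c ∧
            ∀ i, ¬IsRegular c 2 i} : ℚ) =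
        ∑ k ∈ Finset.range (n / 2 + 1), (-1 : ℚ) ^ k *
          (((k : ℚ) + 1) / ((n : ℚ) - k + 1)) * ((2 * n - 3 * k).choose (n - k) : ℚ) := by
  refine ⟨card_isDyck_no_two_hill n, ?_⟩
  rw [card_isLKupisch_no_regular]
  exact card_isSupportEnd_no_two_reg n

end Nak
end

section
/- The number of cyclic compositions of n into parts each of size at least 2 equals (1/n) * Σ_{k | n} φ(n/k) * (F(k-1) + F(k+1)) - 1, where F denotes the Fibonacci sequence with F(1)=F(2)=1, and φ is Euler's totient. -/
namespace Nak

/-- Binary word of a list of parts: a part `x` becomes a marker `true` followed by `x - 1` letters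
`false`. -/
def markerWord : List ℕ → List Bool
  | [] => []
  | x :: l => true :: (List.replicate (x - 1) false ++ markerWord l)

theorem markerWord_append (l m : List ℕ) :
    markerWord (l ++ m) = markerWord l ++ markerWord m := by
  induction l with
  | nil => rfl
  | cons x l ih => simp [markerWord, ih]

theorem length_markerWord {l : List ℕ} (hl : ∀ x ∈ l, 2 ≤ x) :
    (markerWord l).length = l.sum := by
  induction l with
  | nil => rfl
  | cons x l ih =>
    have hx := hl x (by simp)
    have := ih fun y hy => hl y (by simp [hy])
    simp only [markerWord, List.length_cons, List.length_append, List.length_replicate,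
      List.sum_cons]
    omega

theorem head?_markerWord_ne (l : List ℕ) : (markerWord l).head? ≠ some false := by
  cases l <;> simp [markerWord]

theorem replicate_false_append_cancel {a b : ℕ} {p q : List Bool} (hp : p.head? ≠ some false)
    (hq : q.head? ≠ some false)
    (h : List.replicate a false ++ p = List.replicate b false ++ q) : a = b ∧ p = q := by
  induction a generalizing b with
  | zero =>
    cases b with
    | zero => simpa using h
    | succ b => simp [List.replicate_succ] at h; simp [h] at hp
  | succ a ih =>
    cases b with
    | zero => simp [List.replicate_succ] at h; simp [← h] at hq
    | succ b =>
      simp only [List.replicate_succ, List.cons_append, List.cons.injEq, true_and] at h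
      simpa using ih h

theorem markerWord_inj {l m : List ℕ} (hl : ∀ x ∈ l, 2 ≤ x) (hm : ∀ x ∈ m, 2 ≤ x)
    (h : markerWord l = markerWord m) : l = m := by
  induction l generalizing m with
  | nil => cases m <;> simp_all [markerWord]
  | cons x l ih =>
    cases m with
    | nil => simp [markerWord] at h
    | cons y m =>
      simp only [markerWord, List.cons.injEq, true_and] at h
      obtain ⟨hxy, h⟩ :=
        replicate_false_append_cancel (head?_markerWord_ne l) (head?_markerWord_ne m) h
      have := hl x (by simp)
      have := hm y (by simp)
      rw [ih (fun z hz => hl z (by simp [hz])) (fun z hz => hm z (by simp [hz])) h]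
      congr 1
      omega

theorem exists_append_of_markerWord_eq_append {m : List ℕ} {u v : List Bool}
    (hv : v.head? = some true) (h : markerWord m = u ++ v) :
    ∃ m₁ m₂, m = m₁ ++ m₂ ∧ markerWord m₁ = u ∧ markerWord m₂ = v := by
  induction m generalizing u with
  | nil =>
    obtain ⟨rfl, rfl⟩ := List.append_eq_nil_iff.1 h.symm
    simp at hv
  | cons x m ih =>
    cases u with
    | nil => exact ⟨[], x :: m, rfl, rfl, h⟩
    | cons a u =>
      simp only [markerWord, List.cons_append, List.cons.injEq] at h
      obtain ⟨rfl, h⟩ := h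
      rcases List.append_eq_append_iff.1 h with ⟨s, rfl, hs⟩ | ⟨s, hu, rfl⟩
      · obtain ⟨m₁, m₂, rfl, rfl, h₂⟩ := ih hs
        exact ⟨x :: m₁, m₂, rfl, rfl, h₂⟩
      · cases s with
        | nil => exact ⟨[x], m, rfl, by simpa [markerWord] using hu, rfl⟩
        | cons b s =>
          have hb : b ∈ List.replicate (x - 1) false := by simp [hu]
          rw [List.eq_of_mem_replicate hb] at hv
          simp at hv

theorem markerWord_getElem?_succ {l : List ℕ} (hl : ∀ x ∈ l, 2 ≤ x) {i : ℕ}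
    (h : (markerWord l)[i]? = some true) : (markerWord l)[i + 1]? = some false := by
  obtain ⟨hi, h⟩ := List.getElem?_eq_some_iff.1 h
  obtain ⟨m₁, m₂, rfl, h₁, h₂⟩ := exists_append_of_markerWord_eq_append
    (m := l) (u := (markerWord l).take i) (v := (markerWord l).drop i)
    (by simp [List.head?_drop, hi, h]) (by simp)
  have h₃ : (markerWord (m₁ ++ m₂))[i + 1]? = (markerWord m₂)[1]? := by
    rw [h₂, List.getElem?_drop]
  rw [h₃]
  cases m₂ with
  | nil =>
    have := congrArg List.length h₂
    simp [markerWord] at this hi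
    omega
  | cons x m =>
    obtain ⟨y, rfl⟩ := Nat.exists_eq_add_of_le' (hl x (by simp))
    simp [markerWord, List.replicate_succ]

theorem exists_eq_replicate_append_markerWord {w : List Bool}
    (hw : ∀ i : ℕ, w[i]? = some true → w[i + 1]? = some false) :
    ∃ c l, (∀ x ∈ l, 2 ≤ x) ∧ w = List.replicate c false ++ markerWord l := by
  induction w with
  | nil => exact ⟨0, [], by simp, rfl⟩
  | cons a w ih =>
    obtain ⟨c, l, hl, rfl⟩ := ih fun i hi => by simpa using hw (i + 1) (by simpa using hi)
    cases a with
    | false => exact ⟨c + 1, l, hl, by simp [List.replicate_succ]⟩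
    | true =>
      have h₀ := hw 0 rfl
      cases c with
      | zero => exact absurd (by simpa [List.head?_eq_getElem?] using h₀) (head?_markerWord_ne l)
      | succ c =>
        refine ⟨0, (c + 2) :: l, ?_, by simp [markerWord]⟩
        simpa using hl

theorem exists_markerWord_eq {w : List Bool} (h₀ : w.head? ≠ some false)
    (hw : ∀ i : ℕ, w[i]? = some true → w[i + 1]? = some false) :
    ∃ l, (∀ x ∈ l, 2 ≤ x) ∧ markerWord l = w := by
  obtain ⟨c, l, hl, rfl⟩ := exists_eq_replicate_append_markerWord hw
  cases c with
  | zero => exact ⟨l, hl, by simp⟩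
  | succ c => simp [List.replicate_succ] at h₀

theorem isRotated_markerWord_iff {l m : List ℕ} (hl : ∀ x ∈ l, 2 ≤ x) (hm : ∀ x ∈ m, 2 ≤ x) :
    (markerWord l).IsRotated (markerWord m) ↔ l.IsRotated m := by
  constructor
  · intro h
    obtain ⟨k, hk, h⟩ := List.isRotated_iff_mod.1 h
    rw [List.rotate_eq_drop_append_take hk] at h
    rcases eq_or_ne ((markerWord l).drop k) [] with hd | hd
    · rw [hd, List.nil_append, List.take_of_length_le (List.drop_eq_nil_iff.1 hd)] at h
      rw [markerWord_inj hl hm h]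
    · obtain ⟨m₁, m₂, rfl, h₁, h₂⟩ := exists_append_of_markerWord_eq_append
        (m := l) (u := (markerWord l).take k) (v := (markerWord l).drop k) (by
          obtain ⟨b, v, hv⟩ := List.exists_cons_of_ne_nil hd
          have := head?_markerWord_ne m
          rw [← h, hv] at this
          simpa [hv] using this) (by simp)
      rw [← h₁, ← h₂, ← markerWord_append] at h
      rw [← markerWord_inj (by simpa [or_comm, forall_and] using hl) hm h]
      exact List.isRotated_append
  · intro h
    obtain ⟨k, hk, rfl⟩ := List.isRotated_iff_mod.1 h
    rw [List.rotate_eq_drop_append_take hk, markerWord_append]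
    conv_lhs => rw [← List.take_append_drop k l, markerWord_append]
    exact List.isRotated_append

/-- Binary colourings of `ZMod n` in which no two cyclically consecutive letters are `true`. -/
def sparseColoring (n : ℕ) : Set (ZMod n → Bool) :=
  {f | ∀ i, f i = true → f (i + 1) = false}

instance (n : ℕ) : AddAction (ZMod n) (sparseColoring n) where
  vadd j f := ⟨fun i => f.1 (i + j), fun i hi => by
    have := f.2 (i + j) hi
    rwa [add_right_comm] at this⟩
  zero_vadd f := Subtype.ext (funext fun i => congrArg f.1 (add_zero i))
  add_vadd j k f := Subtype.ext (funext fun i => congrArg f.1 (by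
    change i + (j + k) = i + j + k
    rw [add_assoc]))

theorem vadd_sparseColoring_apply {n : ℕ} (j : ZMod n) (f : sparseColoring n) (i : ZMod n) :
    (j +ᵥ f).1 i = f.1 (i + j) := rfl

/-- Colourings of a path with `m + 1` vertices without consecutive `true`s, with first letter `a`,
that may be followed by `b`. -/
def sparsePath (m : ℕ) (a b : Bool) : Set (Fin (m + 1) → Bool) :=
  {h | h 0 = a ∧ (∀ i : Fin m, h i.castSucc = true → h i.succ = false) ∧
    (h (Fin.last m) = true → b = false)}

theorem sparsePath_zero (a b : Bool) :
    sparsePath 0 a b = if a = true ∧ b = true then ∅ else {fun _ => a} := by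
  ext h
  have key : h = (fun _ => a) ↔ h 0 = a := by
    rw [funext_iff]; exact Fin.forall_fin_one
  split_ifs with hab
  · simp [sparsePath, hab]
  · simp only [sparsePath, Set.mem_ofPred_eq, Set.mem_singleton_iff, key]
    constructor
    · exact fun h => h.1
    · rintro rfl
      refine ⟨rfl, fun i => i.elim0, fun h' => ?_⟩
      have : h 0 = true := h'
      simpa [this] using hab

theorem ncard_sparsePath_succ (m : ℕ) (a b : Bool) :
    (sparsePath (m + 1) a b).ncard = (sparsePath m false b).ncard +
      if a = true then 0 else (sparsePath m true b).ncard := by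
  let cons : (Fin (m + 1) → Bool) → (Fin (m + 2) → Bool) :=
    Fin.cons (α := fun _ => Bool) a
  have hinj : Function.Injective cons := Fin.cons_right_injective (α := fun _ => Bool) a
  have h : sparsePath (m + 1) a b = cons '' (sparsePath m false b ∪
      if a = true then ∅ else sparsePath m true b) := by
    ext h
    constructor
    · rintro ⟨rfl, h₁, h₂⟩
      refine ⟨Fin.tail h, ?_, Fin.cons_self_tail h⟩
      rw [Fin.forall_fin_succ] at h₁
      cases h1 : h 1 with
      | false => exact .inl ⟨h1, h₁.2, h₂⟩
      | true =>
        have h0 : h 0 = false := by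
          by_contra h0
          have := h₁.1 (by simpa using h0)
          simp [h1] at this
        right
        rw [if_neg (by simp [h0])]
        exact ⟨h1, h₁.2, h₂⟩
    · rintro ⟨g, hg, rfl⟩
      have : (a = true → g 0 = false) ∧ g ∈ sparsePath m (g 0) b := by
        rcases hg with hg | hg
        · exact ⟨fun _ => hg.1, rfl, hg.2⟩
        · split_ifs at hg with ha
          · simp at hg
          · exact ⟨fun h => absurd h ha, rfl, hg.2⟩
      refine ⟨rfl, ?_, this.2.2.2⟩
      rw [Fin.forall_fin_succ]
      exact ⟨this.1, this.2.2.1⟩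
  rw [h, Set.ncard_image_of_injective _ hinj, Set.ncard_union_eq]
  · split_ifs <;> simp
  · split_ifs
    · simp
    · refine Set.disjoint_left.2 fun g hg hg' => ?_
      simpa using hg.1.symm.trans hg'.1

theorem ncard_sparsePath (m : ℕ) (b : Bool) :
    (sparsePath m false b).ncard = Nat.fib (m + if b = true then 1 else 2) ∧
      (sparsePath m true b).ncard = Nat.fib (m + if b = true then 0 else 1) := by
  induction m with
  | zero => cases b <;> simp [sparsePath_zero]
  | succ m ih =>
    rw [ncard_sparsePath_succ, ncard_sparsePath_succ, ih.1, ih.2]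
    cases b
    · simp [Nat.fib_add_two (n := m + 1), add_assoc, add_comm (Nat.fib (m + 1))]
    · simp [Nat.fib_add_two (n := m), add_assoc, add_comm (Nat.fib m)]

theorem ncard_sparseColoring {n : ℕ} (hn : 0 < n) :
    (sparseColoring n).ncard = Nat.fib (n - 1) + Nat.fib (n + 1) := by
  obtain ⟨m, rfl⟩ := Nat.exists_eq_add_of_lt hn
  rw [zero_add]
  have h : (sparseColoring (m + 1) : Set (Fin (m + 1) → Bool)) =
      sparsePath m false false ∪ sparsePath m true true := by
    refine Set.ext fun (f : Fin (m + 1) → Bool) => ?_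
    have key : f ∈ sparseColoring (m + 1) ↔ f ∈ sparsePath m (f 0) (f 0) := by
      change (∀ i : Fin (m + 1), f i = true → f (i + 1) = false) ↔ _
      rw [Fin.forall_fin_succ']
      simp only [Fin.coeSucc_eq_succ, Fin.last_add_one]
      exact ⟨fun h => ⟨rfl, h⟩, fun h => h.2⟩
    refine key.trans ?_
    constructor
    · intro h
      cases h0 : f 0 <;> rw [h0] at h
      exacts [.inl h, .inr h]
    · rintro (h | h) <;> · rw [show f 0 = _ from h.1]; exact h
  change Set.ncard (α := Fin (m + 1) → Bool) (sparseColoring (m + 1)) = _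
  rw [h, Set.ncard_union_eq, (ncard_sparsePath m false).1, (ncard_sparsePath m true).2, add_comm]
  · rfl
  · refine Set.disjoint_left.2 fun g hg hg' => ?_
    simpa using hg.1.symm.trans hg'.1

theorem card_fixedBy_sparseColoring {n : ℕ} [NeZero n] (j : ZMod n) :
    Nat.card (AddAction.fixedBy (sparseColoring n) j) =
      (sparseColoring (n.gcd j.val)).ncard := by
  set d := n.gcd j.val with hd
  have hdn : d ∣ n := Nat.gcd_dvd_left _ _
  have hsurj := ZMod.castHom_surjective hdn
  rw [← Nat.card_coe_set_eq]
  symm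
  refine Nat.card_eq_of_bijective (fun f => ⟨⟨fun i => f.1 (ZMod.castHom hdn (ZMod d) i),
    fun i hi => by
      beta_reduce
      rw [map_add, map_one]
      exact f.2 _ hi⟩, ?_⟩) ⟨fun f g h => ?_, fun ⟨f, hf⟩ => ?_⟩
  · refine Subtype.ext (funext fun i => congrArg f.1 ?_)
    have : ZMod.castHom hdn (ZMod d) j = 0 := by
      rw [← ZMod.natCast_zmod_val j, map_natCast, ZMod.natCast_eq_zero_iff]
      exact Nat.gcd_dvd_right _ _
    rw [map_add, this, add_zero]
  · refine Subtype.ext (funext fun i => ?_)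
    obtain ⟨i, rfl⟩ := hsurj i
    exact congrFun (congrArg (fun x => x.1.1) h) i
  · have hper : Function.Periodic f.1 j := congrFun (congrArg Subtype.val hf)
    have hperd : Function.Periodic f.1 (d : ZMod n) := by
      have : (d : ZMod n) = (n.gcdB j.val) • j := by
        have := congrArg (Int.cast : ℤ → ZMod n) (Nat.gcd_eq_gcd_ab n j.val)
        push_cast at this
        rw [ZMod.natCast_self, zero_mul, zero_add, ZMod.natCast_zmod_val] at this
        rw [hd, this, zsmul_eq_mul, mul_comm]
      rw [this]
      exact hper.zsmul _
    have hlift : ∀ i k, ZMod.castHom hdn (ZMod d) i = ZMod.castHom hdn (ZMod d) k →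
        f.1 i = f.1 k := by
      intro i k hik
      rw [← sub_eq_zero, ← map_sub, ← ZMod.natCast_zmod_val (i - k), map_natCast,
        ZMod.natCast_eq_zero_iff] at hik
      obtain ⟨c, hc⟩ := hik
      have : i = k + c • (d : ZMod n) := by
        rw [nsmul_eq_mul, mul_comm, ← Nat.cast_mul, ← hc, ZMod.natCast_zmod_val]
        ring
      rw [this]
      exact hperd.nsmul c k
    let s := Function.surjInv hsurj
    have hs : ∀ i, ZMod.castHom hdn (ZMod d) (s i) = i := Function.surjInv_eq hsurj
    refine ⟨⟨fun i => f.1 (s i), fun i hi => ?_⟩, ?_⟩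
    · rw [← f.2 _ hi]
      exact hlift _ _ (by rw [hs, map_add, hs, map_one])
    · exact Subtype.ext (Subtype.ext (funext fun i => hlift _ _ (hs _)))

theorem sum_gcd_val {n : ℕ} [NeZero n] (L : ℕ → ℕ) :
    ∑ j : ZMod n, L (n.gcd j.val) = ∑ d ∈ n.divisors, (n / d).totient * L d := by
  have h : ∑ j : ZMod n, L (n.gcd j.val) = ∑ k ∈ Finset.range n, L (n.gcd k) := by
    obtain ⟨m, rfl⟩ := Nat.exists_eq_succ_of_ne_zero (NeZero.ne n)
    exact (Finset.sum_range fun k => L ((m + 1).gcd k)).symm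
  rw [h, ← Finset.sum_fiberwise_of_maps_to (g := fun k => n.gcd k) (t := n.divisors)
    fun k _ => Nat.mem_divisors.2 ⟨Nat.gcd_dvd_left _ _, NeZero.ne n⟩]
  refine Finset.sum_congr rfl fun d hd => ?_
  rw [Nat.totient_div_of_dvd (Nat.dvd_of_mem_divisors hd), ← smul_eq_mul, ← Finset.sum_const]
  exact Finset.sum_congr rfl fun k hk => by rw [(Finset.mem_filter.1 hk).2]

theorem card_orbits_sparseColoring (n : ℕ) [NeZero n] :
    Nat.card (AddAction.orbitRel.Quotient (ZMod n) (sparseColoring n)) * n =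
      ∑ d ∈ n.divisors, (n / d).totient * (Nat.fib (d - 1) + Nat.fib (d + 1)) := by
  classical
  have := Fintype.ofFinite (AddAction.orbitRel.Quotient (ZMod n) (sparseColoring n))
  have := Fintype.ofFinite (sparseColoring n)
  have h := AddAction.sum_card_fixedBy_eq_card_orbits_mul_card_addGroup (ZMod n) (sparseColoring n)
  rw [ZMod.card, ← Nat.card_eq_fintype_card] at h
  refine h.symm.trans ?_
  simp only [← Nat.card_eq_fintype_card, card_fixedBy_sparseColoring]
  rw [sum_gcd_val fun d => (sparseColoring d).ncard]
  exact Finset.sum_congr rfl fun d hd => by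
    rw [ncard_sparseColoring (Nat.pos_of_mem_divisors hd)]

/-- The colouring of `ZMod n` whose letters are read off from a word. -/
def wordColoring (n : ℕ) (w : List Bool) (i : ZMod n) : Bool := w.getD i.val false

theorem wordColoring_eq_shift_iff {n : ℕ} [NeZero n] {w v : List Bool} (hw : w.length = n)
    (hv : v.length = n) (j : ZMod n) :
    (∀ i, wordColoring n w i = wordColoring n v (i + j)) ↔ w = v.rotate j.val := by
  have key : ∀ i : ℕ, i < n → (wordColoring n v (i + j) = (v.rotate j.val).getD i false) := by
    intro i hi
    rw [wordColoring, ZMod.val_add, ZMod.val_cast_of_lt hi, List.getD_eq_getElem?_getD,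
      List.getD_eq_getElem?_getD, List.getElem?_rotate (hv ▸ hi), hv]
  constructor
  · intro h
    refine List.ext_getElem (by simp [hw, hv]) fun i hi hi' => ?_
    have := h i
    rw [key i (hw ▸ hi), wordColoring, ZMod.val_cast_of_lt (hw ▸ hi), List.getD_eq_getElem _ _ hi,
      List.getD_eq_getElem _ _ hi'] at this
    exact this
  · rintro rfl i
    rw [← ZMod.natCast_zmod_val i, key _ (ZMod.val_lt i), wordColoring,
      ZMod.val_cast_of_lt (ZMod.val_lt i)]

theorem wordColoring_markerWord_mem {n : ℕ} [NeZero n] {l : List ℕ} (hl : ∀ x ∈ l, 2 ≤ x)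
    (hsum : l.sum = n) : wordColoring n (markerWord l) ∈ sparseColoring n := by
  intro i hi
  have h₁ : (markerWord l)[i.val]? = some true := by
    have : i.val < (markerWord l).length := by
      rw [length_markerWord hl, hsum]; exact ZMod.val_lt i
    simpa [wordColoring, List.getD_eq_getElem?_getD, this] using hi
  have h₂ := markerWord_getElem?_succ hl h₁
  have h₃ : i.val + 1 < n := by
    exact ((List.getElem?_eq_some_iff.1 h₂).1).trans_eq ((length_markerWord hl).trans hsum)
  have h₄ : (i + 1).val = i.val + 1 := by
    rw [ZMod.val_add, ZMod.val_one_eq_one_mod, Nat.add_mod_mod, Nat.mod_eq_of_lt h₃]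
  rw [wordColoring, h₄, List.getD_eq_getElem?_getD, h₂]
  rfl

theorem exists_markerWord_of_sparseColoring {n : ℕ} [NeZero n] {f : ZMod n → Bool}
    (hf : f ∈ sparseColoring n) (h₀ : f 0 = true) :
    ∃ l : List ℕ, (∀ x ∈ l, 2 ≤ x) ∧ l.sum = n ∧ wordColoring n (markerWord l) = f := by
  have hget : ∀ i : ℕ, (List.ofFn fun i : Fin n => f (i : ℕ))[i]? =
      if i < n then some (f i) else none := by
    intro i
    simp [List.getElem?_ofFn]
  obtain ⟨l, hl, hlw⟩ := exists_markerWord_eq (w := List.ofFn fun i : Fin n => f (i : ℕ))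
    (by simp [List.head?_eq_getElem?, NeZero.pos, h₀]) (by
      intro i hi
      rw [hget] at hi
      split_ifs at hi with hin
      have h := hf i (by simpa using hi)
      have : i + 1 < n := by
        refine lt_of_le_of_ne hin fun hin => ?_
        rw [← Nat.cast_succ, Nat.succ_eq_add_one, hin, ZMod.natCast_self, h₀] at h
        simp at h
      rw [hget, if_pos this, Nat.cast_succ, h])
  refine ⟨l, hl, by rw [← length_markerWord hl, hlw, List.length_ofFn], funext fun i => ?_⟩
  rw [wordColoring, List.getD_eq_getElem?_getD, hlw, hget, if_pos (ZMod.val_lt i),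
    ZMod.natCast_zmod_val]
  rfl

theorem card_cyclicComposition_add_one (n : ℕ) [NeZero n] :
    Nat.card (Quot (fun (a b : {l : List ℕ // (∀ x ∈ l, 2 ≤ x) ∧ l.sum = n}) =>
        ∃ k, b.1 = a.1.rotate k)) + 1 =
      Nat.card (AddAction.orbitRel.Quotient (ZMod n) (sparseColoring n)) := by
  let C := {l : List ℕ // (∀ x ∈ l, 2 ≤ x) ∧ l.sum = n}
  let Φ : C → sparseColoring n := fun l =>
    ⟨wordColoring n (markerWord l.1), wordColoring_markerWord_mem l.2.1 l.2.2⟩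
  have hlen : ∀ l : C, (markerWord l.1).length = n := fun l => by
    rw [length_markerWord l.2.1, l.2.2]
  have hΦ : ∀ a b : C, (∃ k, b.1 = a.1.rotate k) ↔
      (AddAction.orbitRel (ZMod n) (sparseColoring n)) (Φ a) (Φ b) := by
    intro a b
    have h₁ : (∃ k, b.1 = a.1.rotate k) ↔ a.1.IsRotated b.1 := by
      simp only [List.IsRotated, eq_comm]
    rw [h₁, List.isRotated_comm, ← isRotated_markerWord_iff b.2.1 a.2.1, AddAction.orbitRel_apply,
      AddAction.mem_orbit_iff]
    have h₂ : ∀ j : ZMod n, j +ᵥ Φ b = Φ a ↔ markerWord a.1 = (markerWord b.1).rotate j.val := by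
      intro j
      rw [← wordColoring_eq_shift_iff (hlen a) (hlen b), Subtype.ext_iff, funext_iff]
      exact forall_congr' fun i => eq_comm
    simp only [h₂]
    constructor
    · rintro ⟨k, hk⟩
      refine ⟨k, ?_⟩
      have := List.rotate_mod (markerWord b.1) k
      rw [hlen b] at this
      rw [ZMod.val_natCast, ← hk, this]
    · rintro ⟨j, hj⟩
      exact ⟨j.val, hj.symm⟩
  let z : sparseColoring n := ⟨fun _ => false, fun _ _ => rfl⟩
  have hz : ∀ f : sparseColoring n, AddAction.orbitRel (ZMod n) (sparseColoring n) f z ↔ f = z := by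
    intro f
    rw [AddAction.orbitRel_apply, AddAction.mem_orbit_iff]
    exact ⟨fun ⟨j, hj⟩ => hj.symm, fun h => ⟨0, h.symm⟩⟩
  have hΦ₀ : ∀ l : C, (Φ l).1 0 = true := by
    rintro ⟨l, hl, hsum⟩
    cases l with
    | nil => exact absurd hsum.symm (NeZero.ne n)
    | cons x l => simp [Φ, wordColoring, markerWord]
  let Ψ : Option (Quot fun a b : C => ∃ k, b.1 = a.1.rotate k) →
      AddAction.orbitRel.Quotient (ZMod n) (sparseColoring n) := fun o =>
    o.elim (Quotient.mk _ z)
      (Quot.lift (fun l => Quotient.mk _ (Φ l)) fun a b h => Quotient.sound ((hΦ a b).1 h))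
  have hne : ∀ l : C, Quotient.mk (AddAction.orbitRel (ZMod n) (sparseColoring n)) (Φ l) ≠
      Quotient.mk _ z := by
    intro l h
    have := hΦ₀ l
    rw [(hz _).1 (Quotient.exact h)] at this
    simp [z] at this
  have hbij : Function.Bijective Ψ := by
    constructor
    · rintro (_ | ⟨⟨a⟩⟩) (_ | ⟨⟨b⟩⟩) h
      · rfl
      · exact absurd h.symm (hne b)
      · exact absurd h (hne a)
      · exact congrArg some (Quot.sound ((hΦ a b).2 (Quotient.exact h)))
    · rintro ⟨f⟩
      by_cases hf : f = z
      · exact ⟨none, by rw [hf]; rfl⟩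
      · obtain ⟨j, hj⟩ : ∃ j, f.1 j = true := by
          by_contra! h
          exact hf (Subtype.ext (funext fun i => by simpa using h i))
        obtain ⟨l, hl, hsum, hlf⟩ := exists_markerWord_of_sparseColoring (j +ᵥ f).2
          (by rw [vadd_sparseColoring_apply, zero_add, hj])
        refine ⟨some (Quot.mk _ ⟨l, hl, hsum⟩), Quotient.sound ?_⟩
        exact AddAction.orbitRel_apply.2 ⟨j, Subtype.ext hlf.symm⟩
  have := Finite.of_injective Ψ hbij.1
  have := Finite.of_injective (some : (Quot fun a b : C => ∃ k, b.1 = a.1.rotate k) → _)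
    (Option.some_injective _)
  rw [← Nat.card_eq_of_bijective Ψ hbij, Finite.card_option]

/-- The number of cyclic compositions of `n` into parts of size at
least 2 (lists of integers `≥ 2` summing to `n`, up to cyclic rotation) equals
`(1/n) * ∑_{k ∣ n} φ(n/k) * (F (k-1) + F (k+1)) - 1`, where `F` is the Fibonacci
sequence with `F 1 = F 2 = 1`. -/
theorem cyclic_compositions_count (n : ℕ) (hn : 0 < n) :
    (Nat.card (Quot (fun (a b : {l : List ℕ // (∀ x ∈ l, 2 ≤ x) ∧ l.sum = n}) =>
        ∃ k, b.1 = a.1.rotate k)) : ℚ) =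
      (1 : ℚ) / n *
        (∑ k ∈ n.divisors, ((n / k).totient : ℚ) *
          ((Nat.fib (k - 1) : ℚ) + (Nat.fib (k + 1) : ℚ))) - 1 := by
  have : NeZero n := ⟨hn.ne'⟩
  have h := card_orbits_sparseColoring n
  rw [← card_cyclicComposition_add_one] at h
  have hq := congrArg (Nat.cast : ℕ → ℚ) h
  push_cast at hq
  rw [← hq]
  field_simp
  ring

end Nak
end

section
/- The number of n-periodic Dyck paths with global shift 0 and no 2-hill, other than the path with constant area sequence, equals Σ_{k | n} (φ(k)/k) * Σ_{m=0}^{⌊n/(2k)⌋} ((-1)^m/(n/k - m)) * binomial(2n/k - 3m - 1, n/k - m - 1) - 1. -/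
namespace Nak

open PowerSeries in
/-- The generating function of the Catalan numbers, over `ℚ`. -/
noncomputable def catalanGF : PowerSeries ℚ := PowerSeries.mk fun n => (catalan n : ℚ)

open PowerSeries in
theorem catalanGF_eq : catalanGF = 1 + X * catalanGF ^ 2 := by
  ext n
  cases n with
  | zero => simp [catalanGF]
  | succ n =>
    rw [map_add, coeff_succ_X_mul]
    simp [catalanGF, pow_two, coeff_mul, catalan_succ', coeff_one]

/-- The generating function of the central binomial coefficients, over `ℚ`. -/
noncomputable def centralBinomGF : PowerSeries ℚ := PowerSeries.mk fun n => (n.centralBinom : ℚ)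

open PowerSeries in
theorem coeff_catalanGF_pow_mul_of_eq {D : PowerSeries ℚ} (hD : D = 1 + 2 * (X * catalanGF * D))
    (j m : ℕ) : coeff j (catalanGF ^ m * D) = ((2 * j + m).choose j : ℚ) := by
  induction j generalizing m with
  | zero =>
    have hC : constantCoeff catalanGF = 1 := by rw [catalanGF_eq]; simp
    have h1 : constantCoeff D = 1 := by rw [hD]; simp
    simp [hC, h1]
  | succ j ih =>
    induction m with
    | zero =>
      have h : catalanGF ^ 0 * D = 1 + X * (catalanGF ^ 1 * D + catalanGF ^ 1 * D) := by
        linear_combination hD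
      rw [h, map_add, coeff_succ_X_mul, map_add, ih, coeff_one, if_neg (Nat.succ_ne_zero j)]
      have h2 : (2 * (j + 1) + 0).choose (j + 1) = (2 * j + 1).choose j + (2 * j + 1).choose j := by
        have := Nat.choose_symm_half j
        rw [show 2 * (j + 1) + 0 = (2 * j + 1) + 1 by ring, Nat.choose_succ_succ, Nat.succ_eq_add_one,
          this]
      rw [h2]
      push_cast
      ring
    | succ m ihm =>
      have h : catalanGF ^ (m + 1) * D = catalanGF ^ m * D + X * (catalanGF ^ (m + 2) * D) := by
        have := catalanGF_eq
        linear_combination (catalanGF ^ m * D) * this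
      rw [h, map_add, coeff_succ_X_mul, ih, ihm,
        show 2 * (j + 1) + (m + 1) = (2 * j + (m + 2)) + 1 by ring, Nat.choose_succ_succ,
        show 2 * (j + 1) + m = 2 * j + (m + 2) by ring]
      push_cast
      ring

open PowerSeries in
theorem centralBinomGF_eq : centralBinomGF = 1 + 2 * (X * catalanGF * centralBinomGF) := by
  have h0 : constantCoeff (1 - 2 * (X * catalanGF)) ≠ 0 := by simp
  have hD : (1 - 2 * (X * catalanGF))⁻¹ =
      1 + 2 * (X * catalanGF * (1 - 2 * (X * catalanGF))⁻¹) := by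
    linear_combination PowerSeries.mul_inv_cancel _ h0
  have : centralBinomGF = (1 - 2 * (X * catalanGF))⁻¹ := by
    ext j
    have := coeff_catalanGF_pow_mul_of_eq hD j 0
    rw [pow_zero, one_mul] at this
    rw [this]
    simp [centralBinomGF, Nat.centralBinom]
  rwa [← this] at hD

open PowerSeries in
theorem coeff_catalanGF_pow_mul (j m : ℕ) :
    coeff j (catalanGF ^ m * centralBinomGF) = ((2 * j + m).choose j : ℚ) :=
  coeff_catalanGF_pow_mul_of_eq centralBinomGF_eq j m

open PowerSeries in
theorem coeff_catalanGF_pow_mul_sub (j m : ℕ) (h : 0 < j + m) :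
    coeff j (catalanGF ^ m * (centralBinomGF * (2 - 3 * (X * catalanGF)))) =
      (j + 2 * m : ℚ) * (((j : ℚ) + m)⁻¹ * ((2 * j + m - 1).choose (j + m - 1) : ℚ)) := by
  have hs : catalanGF ^ m * (centralBinomGF * (2 - 3 * (X * catalanGF))) =
      catalanGF ^ m * centralBinomGF + catalanGF ^ m * centralBinomGF -
        X * (catalanGF ^ (m + 1) * centralBinomGF + catalanGF ^ (m + 1) * centralBinomGF +
          catalanGF ^ (m + 1) * centralBinomGF) := by ring
  have hjm : ((j : ℚ) + m) ≠ 0 := by exact_mod_cast h.ne'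
  rw [hs]
  cases j with
  | zero =>
    have hm : (m : ℚ) ≠ 0 := by simpa using hjm
    simp only [map_sub, map_add, coeff_catalanGF_pow_mul]
    simp
    field_simp
    norm_num
  | succ j =>
    simp only [map_sub, map_add, coeff_catalanGF_pow_mul, coeff_succ_X_mul]
    rw [show 2 * (j + 1) + m - 1 = 2 * j + (m + 1) by omega, show j + 1 + m - 1 = j + m by omega,
      show (2 * j + (m + 1)).choose (j + m) = (2 * j + (m + 1)).choose (j + 1) from
        Nat.choose_symm_of_eq_add (by ring),
      show 2 * (j + 1) + m = (2 * j + (m + 1)) + 1 by ring, Nat.choose_succ_succ]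
    have key := Nat.choose_succ_right_eq (2 * j + (m + 1)) j
    rw [show 2 * j + (m + 1) - j = j + m + 1 by omega] at key
    have key' : ((2 * j + (m + 1)).choose (j + 1) : ℚ) * (j + 1) =
        (2 * j + (m + 1)).choose j * (j + m + 1) := by exact_mod_cast key
    push_cast at hjm ⊢
    rw [Nat.succ_eq_add_one]
    field_simp
    linear_combination key'

open PowerSeries in
theorem coeff_catalanGF_pow_mul_of_functional {T : PowerSeries ℚ}
    (hT : T * (1 + X ^ 2 * catalanGF) = centralBinomGF * (2 - 3 * (X * catalanGF)))
    (N m : ℕ) : coeff N (catalanGF ^ m * T) = ∑ i ∈ Finset.range (N / 2 + 1), (-1 : ℚ) ^ i *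
      coeff (N - 2 * i)
        (catalanGF ^ (m + i) * (centralBinomGF * (2 - 3 * (X * catalanGF)))) := by
  induction N using Nat.strong_induction_on generalizing m with
  | _ N ih =>
    have h : catalanGF ^ m * T = catalanGF ^ m * (centralBinomGF * (2 - 3 * (X * catalanGF))) -
        X * (X * (catalanGF ^ (m + 1) * T)) := by
      rw [← hT]; ring
    rw [h, map_sub]
    match N with
    | 0 => simp
    | 1 =>
      have h1 (p : PowerSeries ℚ) : coeff 1 (X * (X * p)) = 0 :=
        (coeff_succ_X_mul 0 _).trans (by simp)
      simp [h1]
    | N + 2 =>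
      rw [coeff_succ_X_mul, coeff_succ_X_mul, ih N (by omega),
        show (N + 2) / 2 + 1 = (N / 2 + 1) + 1 by omega, Finset.sum_range_succ' _ (N / 2 + 1)]
      simp only [pow_zero, one_mul, mul_zero, Nat.sub_zero, add_zero]
      rw [sub_eq_neg_add, ← Finset.sum_neg_distrib]
      congr 1
      refine Finset.sum_congr rfl fun i _ => ?_
      rw [show N + 2 - 2 * (i + 1) = N - 2 * i by omega, show m + (i + 1) = m + 1 + i by ring]
      ring

open PowerSeries in
theorem coeff_mul_of_eq_one_add {L : PowerSeries ℚ} (hL : L = 1 + X * ((catalanGF - X) * L))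
    (N : ℕ) (hN : 0 < N) : coeff N (X * ((centralBinomGF - 2 * X) * L)) =
      N * ∑ m ∈ Finset.range (N / 2 + 1), (-1 : ℚ) ^ m / ((N : ℚ) - m) *
        ((2 * N - 3 * m - 1).choose (N - m - 1) : ℚ) := by
  have hLC : L * (1 + X ^ 2 * catalanGF) = catalanGF := by
    linear_combination catalanGF * hL - L * catalanGF_eq
  have hT : (X * ((centralBinomGF - 2 * X) * L) + 2) * (1 + X ^ 2 * catalanGF) =
      centralBinomGF * (2 - 3 * (X * catalanGF)) := by
    linear_combination (X * (centralBinomGF - 2 * X)) * hLC - 2 * centralBinomGF_eq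
  have := coeff_catalanGF_pow_mul_of_functional hT N 0
  rw [pow_zero, one_mul, map_add] at this
  have h2 : coeff N (2 : PowerSeries ℚ) = 0 := by
    rw [show (2 : PowerSeries ℚ) = C 2 from rfl, coeff_C, if_neg hN.ne']
  rw [h2, add_zero] at this
  rw [this, Finset.mul_sum]
  refine Finset.sum_congr rfl fun m hm => ?_
  have hm' : 2 * m ≤ N := by
    have := Finset.mem_range.1 hm
    omega
  rw [zero_add, coeff_catalanGF_pow_mul_sub _ _ (by omega), Nat.cast_sub hm',
    show 2 * (N - 2 * m) + m - 1 = 2 * N - 3 * m - 1 by omega,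
    show N - 2 * m + m - 1 = N - m - 1 by omega]
  push_cast
  rw [show (N : ℚ) - 2 * m + m = N - m by ring]
  ring

theorem ncard_eq_sum_antidiagonal {α β γ : Type*} (n : ℕ) (A : ℕ → Set α) (B : ℕ → Set β)
    (f : α → β → γ) (S : Set γ) (hA : ∀ i ≤ n, (A i).Finite) (hB : ∀ i ≤ n, (B i).Finite)
    (hmaps : ∀ i j, i + j = n → ∀ a ∈ A i, ∀ b ∈ B j, f a b ∈ S)
    (hinj : ∀ i j i' j', i + j = n → i' + j' = n → ∀ a ∈ A i, ∀ b ∈ B j, ∀ a' ∈ A i', ∀ b' ∈ B j',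
      f a b = f a' b' → i = i' ∧ a = a' ∧ b = b')
    (hsurj : ∀ s ∈ S, ∃ i j, i + j = n ∧ ∃ a ∈ A i, ∃ b ∈ B j, f a b = s) :
    S.Finite ∧
      S.ncard = ∑ p ∈ Finset.HasAntidiagonal.antidiagonal n, (A p.1).ncard * (B p.2).ncard := by
  have hle (p : Finset.HasAntidiagonal.antidiagonal n) : p.1.1 ≤ n ∧ p.1.2 ≤ n := by
    have := Finset.HasAntidiagonal.mem_antidiagonal.1 p.2
    omega
  have (p : Finset.HasAntidiagonal.antidiagonal n) : Finite (A p.1.1) := hA _ (hle p).1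
  have (p : Finset.HasAntidiagonal.antidiagonal n) : Finite (B p.1.2) := hB _ (hle p).2
  let g : (Σ p : Finset.HasAntidiagonal.antidiagonal n, A p.1.1 × B p.1.2) → S := fun x =>
    ⟨f x.2.1 x.2.2, hmaps _ _ (Finset.HasAntidiagonal.mem_antidiagonal.1 x.1.2) _ x.2.1.2 _ x.2.2.2⟩
  have hg : Function.Bijective g := by
    constructor
    · rintro ⟨⟨⟨i, j⟩, hp⟩, ⟨a, ha⟩, ⟨b, hb⟩⟩ ⟨⟨⟨i', j'⟩, hp'⟩, ⟨a', ha'⟩, ⟨b', hb'⟩⟩ h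
      have h' : f a b = f a' b' := congrArg Subtype.val h
      have hp1 := Finset.HasAntidiagonal.mem_antidiagonal.1 hp
      have hp1' := Finset.HasAntidiagonal.mem_antidiagonal.1 hp'
      obtain ⟨rfl, rfl, rfl⟩ := hinj i j i' j' hp1 hp1' a ha b hb a' ha' b' hb' h'
      obtain rfl : j = j' := by omega
      rfl
    · rintro ⟨s, hs⟩
      obtain ⟨i, j, hij, a, ha, b, hb, rfl⟩ := hsurj s hs
      exact ⟨⟨⟨(i, j), Finset.HasAntidiagonal.mem_antidiagonal.2 hij⟩, ⟨a, ha⟩, ⟨b, hb⟩⟩, rfl⟩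
  have e := Equiv.ofBijective g hg
  refine ⟨Finite.of_equiv _ e, ?_⟩
  rw [← Nat.card_coe_set_eq, ← Nat.card_congr e, Nat.card_sigma,
    ← Finset.sum_coe_sort (Finset.HasAntidiagonal.antidiagonal n)]
  refine Finset.sum_congr rfl fun p _ => ?_
  rw [Nat.card_prod, Nat.card_coe_set_eq, Nat.card_coe_set_eq]

theorem append_cons_inj_of_notMem_of_notMem {α : Type*} {a : α} {u v u' v' : List α} (hu : a ∉ u)
    (hu' : a ∉ u') (h : u ++ a :: v = u' ++ a :: v') : u = u' ∧ v = v' := by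
  induction u generalizing u' with
  | nil =>
    cases u' with
    | nil => simpa using h
    | cons y u' => simp_all
  | cons x u ih =>
    cases u' with
    | nil =>
      obtain ⟨rfl, -⟩ := List.cons_eq_cons.1 h
      simp at hu
    | cons y u' =>
      simp only [List.cons_append, List.cons.injEq, List.mem_cons, not_or] at *
      obtain ⟨h1, h2⟩ := ih hu.2 hu'.2 h.2
      exact ⟨⟨h.1, h1⟩, h2⟩

/-- The lists of length `n` that can fill the part of an area sequence strictly between two
consecutive visits to the level `h`. -/
def excursions (h n : ℕ) : Set (List ℕ) :=
  {l | l.length = n ∧ (∀ x ∈ l, h < x) ∧ (l ++ [h]).IsChain (fun a b => a ≤ b + 1)}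

theorem notMem_of_mem_excursions {h n : ℕ} {l : List ℕ} (hl : l ∈ excursions h n) : h ∉ l :=
  fun hm => lt_irrefl _ (hl.2.1 _ hm)

theorem excursions_zero (h : ℕ) : excursions h 0 = {[]} := by
  ext l
  constructor
  · intro hl
    exact List.length_eq_zero_iff.1 hl.1
  · rintro rfl
    simp [excursions]

theorem isChain_cons_of_forall_lt {h x : ℕ} {l : List ℕ} (hx : x ≤ h + 1)
    (hl : ∀ y ∈ l, h < y) (hc : (l ++ [h]).IsChain (fun a b => a ≤ b + 1)) :
    (x :: (l ++ [h])).IsChain (fun a b => a ≤ b + 1) := by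
  cases l with
  | nil => simpa using hx
  | cons y l =>
    have := hl y (by simp)
    exact List.isChain_cons_cons.2 ⟨by omega, hc⟩

theorem finite_ncard_excursions (h n : ℕ) :
    (excursions h n).Finite ∧ (excursions h n).ncard = catalan n := by
  induction n using Nat.strong_induction_on generalizing h with
  | _ n ih =>
    cases n with
    | zero => simp [excursions_zero]
    | succ n =>
      have key := ncard_eq_sum_antidiagonal n (excursions (h + 1)) (excursions h)
        (fun u v => u ++ (h + 1) :: v) (excursions h (n + 1)) (fun i hi => (ih i (by omega) _).1)
        (fun i hi => (ih i (by omega) _).1) ?_ ?_ ?_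
      · refine ⟨key.1, ?_⟩
        rw [key.2, catalan_succ']
        refine Finset.sum_congr rfl fun p hp => ?_
        have := Finset.HasAntidiagonal.mem_antidiagonal.1 hp
        rw [(ih _ (by omega) _).2, (ih _ (by omega) _).2]
      · rintro i j hij u ⟨hu1, hu2, hu3⟩ v ⟨hv1, hv2, hv3⟩
        refine ⟨by simp; omega, ?_, ?_⟩
        · intro x hx
          rcases List.mem_append.1 hx with hx | hx
          · have := hu2 x hx
            omega
          · rcases List.mem_cons.1 hx with rfl | hx
            · omega
            · exact hv2 x hx
        · rw [List.append_assoc, List.cons_append, List.isChain_split]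
          exact ⟨hu3, isChain_cons_of_forall_lt le_rfl hv2 hv3⟩
      · intro i j i' j' _ _ u hu v hv u' hu' v' hv' heq
        obtain ⟨rfl, rfl⟩ := append_cons_inj_of_notMem_of_notMem (notMem_of_mem_excursions hu)
          (notMem_of_mem_excursions hu') heq
        exact ⟨hu.1.symm.trans hu'.1, rfl, rfl⟩
      · rintro l ⟨hl1, hl2, hl3⟩
        have hmem : h + 1 ∈ l := by
          have hne : l ≠ [] := by
            rintro rfl
            simp at hl1
          have hlast := (List.isChain_append.1 hl3).2.2 (l.getLast hne)
            (List.getLast_mem_getLast? hne) h (by simp)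
          have := hl2 _ (List.getLast_mem hne)
          rw [show h + 1 = l.getLast hne by omega]
          exact List.getLast_mem hne
        obtain ⟨u, v, rfl, hu⟩ := List.eq_append_cons_of_mem hmem
        rw [List.append_assoc, List.cons_append, List.isChain_split] at hl3
        refine ⟨u.length, v.length, ?_, u, ⟨rfl, ?_, hl3.1⟩, v, ⟨rfl, ?_, ?_⟩, rfl⟩
        · simp at hl1
          omega
        · intro x hx
          have h1 := hl2 x (by simp [hx])
          have h2 : x ≠ h + 1 := by
            rintro rfl
            exact hu hx
          omega
        · exact fun x hx => hl2 x (by simp [hx])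
        · exact hl3.2.tail

/-- The interiors of length `n` of the primitive blocks of an area sequence, 2-hills excluded. -/
def blocks (n : ℕ) : Set (List ℕ) := excursions 2 n \ {[3]}

/-- The area sequences of length `n` starting at `2` (if non-empty), continued by `2`,
and without 2-hills. -/
def hillFree (n : ℕ) : Set (List ℕ) :=
  {l | l.length = n ∧ (∀ x ∈ l, 2 ≤ x) ∧ (∃ r, l ++ [2] = 2 :: r) ∧
    (l ++ [2]).IsChain (fun a b => a ≤ b + 1) ∧ ¬[2, 3, 2] <:+: l ++ [2]}

theorem finite_blocks (n : ℕ) : (blocks n).Finite := (finite_ncard_excursions 2 n).1.sdiff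

theorem ncard_blocks (n : ℕ) : ((blocks n).ncard : ℚ) = catalan n - if n = 1 then 1 else 0 := by
  rw [blocks, ← (finite_ncard_excursions 2 n).2]
  split_ifs with h
  · subst h
    have hm : [3] ∈ excursions 2 1 := ⟨rfl, by simp, by simp⟩
    rw [Set.ncard_sdiff_singleton_of_mem hm, Nat.cast_pred]
    exact (Set.ncard_pos (finite_ncard_excursions 2 1).1).2 ⟨_, hm⟩
  · rw [Set.sdiff_singleton_eq_self, sub_zero]
    exact fun hm => h hm.1.symm

theorem hillFree_zero : hillFree 0 = {[]} := by
  ext l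
  constructor
  · intro hl
    exact List.length_eq_zero_iff.1 hl.1
  · rintro rfl
    refine ⟨rfl, by simp, ⟨[], rfl⟩, by simp, fun h => ?_⟩
    have := h.length_le
    simp at this

theorem mem_hillFree_of_blocks {i j : ℕ} {w l : List ℕ} (hw : w ∈ blocks i) (hl : l ∈ hillFree j) :
    2 :: (w ++ l) ∈ hillFree (i + j + 1) := by
  obtain ⟨⟨hw1, hw2, hw3⟩, hw4⟩ := hw
  obtain ⟨hl1, hl2, ⟨r, hr⟩, hl4, hl5⟩ := hl
  have hw2' : 2 ∉ w := fun h => lt_irrefl _ (hw2 _ h)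
  refine ⟨by simp; omega, ?_, ⟨_, rfl⟩, ?_, ?_⟩
  · intro x hx
    rcases List.mem_cons.1 hx with rfl | hx
    · exact le_rfl
    · rcases List.mem_append.1 hx with hx | hx
      · exact (hw2 x hx).le
      · exact hl2 x hx
  · rw [hr] at hl4
    rw [List.cons_append, List.append_assoc, hr, ← List.cons_append, List.isChain_split]
    exact ⟨isChain_cons_of_forall_lt (by norm_num) hw2 hw3, hl4⟩
  · rintro ⟨s, t, hst⟩
    rw [List.cons_append, List.append_assoc w, hr] at hst
    rw [hr] at hl5
    cases s with
    | nil =>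
      simp only [List.nil_append, List.cons_append, List.cons.injEq, true_and] at hst
      have := append_cons_inj_of_notMem_of_notMem (u := [3]) (by simp) hw2' hst
      exact hw4 this.1.symm
    | cons y s =>
      simp only [List.append_assoc, List.cons_append, List.cons.injEq] at hst
      rcases List.append_eq_append_iff.1 hst.2 with ⟨a, ha1, ha2⟩ | ⟨b, hb1, hb2⟩
      · cases a with
        | nil => exact hl5 ⟨[], t, by simpa using ha2⟩
        | cons z a =>
          simp only [List.cons_append, List.cons.injEq] at ha2
          exact hw2' (by rw [ha1, ← ha2.1]; simp)
      · exact hl5 ⟨b, t, by rw [hb2]; simp⟩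

theorem exists_blocks_of_mem_hillFree {n : ℕ} {l : List ℕ} (hl : l ∈ hillFree (n + 1)) :
    ∃ i j, i + j = n ∧ ∃ w ∈ blocks i, ∃ l' ∈ hillFree j, 2 :: (w ++ l') = l := by
  obtain ⟨hl1, hl2, ⟨r, hr⟩, hl4, hl5⟩ := hl
  cases l with
  | nil => simp at hl1
  | cons y l =>
    obtain ⟨rfl, -⟩ : y = 2 ∧ _ := List.cons_eq_cons.1 hr
    have split : ∃ w l' r', l = w ++ l' ∧ l' ++ [2] = 2 :: r' ∧ 2 ∉ w := by
      by_cases h : 2 ∈ l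
      · obtain ⟨w, l', rfl, hw⟩ := List.eq_append_cons_of_mem h
        exact ⟨w, 2 :: l', _, rfl, rfl, hw⟩
      · exact ⟨l, [], [], by simp, rfl, h⟩
    obtain ⟨w, l', r', rfl, hr', hw⟩ := split
    rw [List.cons_append, List.append_assoc, hr', ← List.cons_append] at hl4 hl5
    rw [List.isChain_split] at hl4
    refine ⟨w.length, l'.length, ?_, w, ⟨⟨rfl, ?_, hl4.1.tail⟩, ?_⟩, l', ⟨rfl, ?_, ⟨r', hr'⟩, ?_, ?_⟩,
      rfl⟩
    · simp at hl1
      omega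
    · intro x hx
      have h1 := hl2 x (by simp [hx])
      have h2 : x ≠ 2 := by
        rintro rfl
        exact hw hx
      omega
    · rintro rfl
      exact hl5 ⟨[], r', rfl⟩
    · exact fun x hx => hl2 x (by simp [hx])
    · rw [hr']
      exact hl4.2
    · rw [hr']
      rintro ⟨s, t, hst⟩
      exact hl5 ⟨2 :: w ++ s, t, by rw [← hst]; simp⟩

theorem blocks_decomp_inj {i j i' j' : ℕ} {w l w' l' : List ℕ} (hw : w ∈ blocks i)
    (hl : l ∈ hillFree j) (hw' : w' ∈ blocks i') (hl' : l' ∈ hillFree j')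
    (h : 2 :: (w ++ l) = 2 :: (w' ++ l')) : i = i' ∧ w = w' ∧ l = l' := by
  obtain ⟨r, hr⟩ := hl.2.2.1
  obtain ⟨r', hr'⟩ := hl'.2.2.1
  have h2 : w ++ (l ++ [2]) = w' ++ (l' ++ [2]) := by
    rw [← List.append_assoc, ← List.append_assoc, List.tail_eq_of_cons_eq h]
  rw [hr, hr'] at h2
  obtain ⟨rfl, rfl⟩ := append_cons_inj_of_notMem_of_notMem (notMem_of_mem_excursions hw.1)
    (notMem_of_mem_excursions hw'.1) h2
  refine ⟨hw.1.1.symm.trans hw'.1.1, rfl, ?_⟩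
  rw [← hr'] at hr
  exact List.append_cancel_right hr

theorem finite_hillFree_and_ncard_succ (n : ℕ) : (hillFree n).Finite ∧ (hillFree (n + 1)).ncard =
    ∑ p ∈ Finset.HasAntidiagonal.antidiagonal n, (blocks p.1).ncard * (hillFree p.2).ncard := by
  have key (n : ℕ) (hfin : ∀ i ≤ n, (hillFree i).Finite) :=
    ncard_eq_sum_antidiagonal n blocks hillFree (fun w l => 2 :: (w ++ l)) (hillFree (n + 1))
      (fun i _ => finite_blocks i) hfin
      (fun i j hij w hw l hl => hij ▸ mem_hillFree_of_blocks hw hl)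
      (fun _ _ _ _ _ _ _ hw _ hl _ hw' _ hl' h => blocks_decomp_inj hw hl hw' hl' h)
      (fun _ hl => exists_blocks_of_mem_hillFree hl)
  have hfin (n : ℕ) : (hillFree n).Finite := by
    induction n using Nat.strong_induction_on with
    | _ n ih =>
      cases n with
      | zero => simp [hillFree_zero]
      | succ n => exact (key n fun i hi => ih i (by omega)).1
  exact ⟨hfin n, (key n fun i _ => hfin i).2⟩

/-- The generating function of `hillFree`. -/
noncomputable def hillFreeGF : PowerSeries ℚ := PowerSeries.mk fun n => ((hillFree n).ncard : ℚ)

open PowerSeries in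
theorem hillFreeGF_eq : hillFreeGF = 1 + X * ((catalanGF - X) * hillFreeGF) := by
  ext n
  cases n with
  | zero => simp [hillFreeGF, hillFree_zero]
  | succ n =>
    rw [map_add, coeff_succ_X_mul, coeff_mul, coeff_one, if_neg n.succ_ne_zero, zero_add]
    simp only [hillFreeGF, coeff_mk, (finite_hillFree_and_ncard_succ n).2, map_sub, catalanGF,
      coeff_X]
    push_cast
    exact Finset.sum_congr rfl fun p _ => by rw [ncard_blocks]

/-- The area sequences of period `n` without 2-hills, the constant one included. -/
def areaSeqs (n : ℕ) : Set (ℤ → ℕ) :=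
  {c | Function.Periodic c n ∧ (∀ i, 2 ≤ c i) ∧ (∀ i, c i ≤ c (i + 1) + 1) ∧ (∃ i, c i = 2) ∧
    ¬∃ i, c (i - 1) = 2 ∧ c i = 3 ∧ c (i + 1) = 2}

/-- The periodic extension of a list. -/
def periodize (l : List ℕ) : ℤ → ℕ := fun i => l.getD (i % l.length).toNat 2

theorem periodic_periodize (l : List ℕ) : Function.Periodic (periodize l) l.length := fun i => by
  simp [periodize]

theorem exists_nat_of_periodic {c : ℤ → ℕ} {n : ℕ} (hc : Function.Periodic c n) (hn : 0 < n)
    (i : ℤ) : ∃ k < n, ∀ x : ℤ, c (i + x) = c (k + x) := by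
  have h1 := Int.emod_nonneg i (b := (n : ℤ)) (by omega)
  have h2 := Int.emod_lt_of_pos i (b := (n : ℤ)) (by omega)
  refine ⟨(i % n).toNat, by omega, fun x => ?_⟩
  have h3 := hc.int_mul (i / n) ((i % n) + x)
  rw [Int.toNat_of_nonneg h1, ← h3]
  congr 1
  have h4 := Int.mul_ediv_add_emod i n
  linear_combination (-1) * h4

theorem periodize_natCast {l r : List ℕ} (hr : l ++ [2] = 2 :: r) {k : ℕ} (hk : k ≤ l.length) :
    periodize l k = (l ++ [2]).getD k 2 := by
  rcases hk.lt_or_eq with hk | rfl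
  · rw [List.getD_append _ _ _ _ hk, periodize, Int.emod_eq_of_lt (by omega) (by omega),
      Int.toNat_natCast]
  · cases l with
    | nil => simp [periodize]
    | cons y l =>
      obtain ⟨rfl, -⟩ : y = 2 ∧ _ := List.cons_eq_cons.1 hr
      rw [periodize, Int.emod_self]
      simp

theorem periodize_mem_areaSeqs {n : ℕ} (hn : 0 < n) {l : List ℕ} (hl : l ∈ hillFree n) :
    periodize l ∈ areaSeqs n := by
  obtain ⟨rfl, hl2, ⟨r, hr⟩, hl4, hl5⟩ := hl
  have hp := periodic_periodize l
  have hmem : ∀ x ∈ l ++ [2], 2 ≤ x := by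
    intro x hx
    rcases List.mem_append.1 hx with hx | hx
    · exact hl2 x hx
    · exact (List.mem_singleton.1 hx).ge
  have hlen : (l ++ [2]).length = l.length + 1 := by simp
  have hget (k : ℕ) (hk : k ≤ l.length) : periodize l k = (l ++ [2])[k] := by
    rw [periodize_natCast hr hk, List.getD_eq_getElem _ _ (by omega)]
  refine ⟨hp, fun i => ?_, fun i => ?_, ⟨0, ?_⟩, ?_⟩
  · obtain ⟨k, hk, h⟩ := exists_nat_of_periodic hp hn i
    have h0 := h 0
    rw [add_zero, add_zero, hget k hk.le] at h0
    rw [h0]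
    exact hmem _ (List.getElem_mem _)
  · obtain ⟨k, hk, h⟩ := exists_nat_of_periodic hp hn i
    have h0 := h 0
    have h1 := h 1
    rw [add_zero, add_zero, hget k hk.le] at h0
    rw [← Nat.cast_succ, hget (k + 1) hk] at h1
    rw [h0, h1]
    exact List.isChain_iff_getElem.1 hl4 k (by omega)
  · have := hget 0 (Nat.zero_le _)
    simpa [hr] using this
  · rintro ⟨i, h1, h2, h3⟩
    obtain ⟨k, hk, h⟩ := exists_nat_of_periodic hp hn (i - 1)
    have e0 := h 0
    have e1 := h 1
    have e2 := h 2
    rw [add_zero, add_zero, h1, hget k hk.le] at e0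
    rw [sub_add_cancel, h2, ← Nat.cast_succ, hget (k + 1) hk] at e1
    rw [show i - 1 + 2 = i + 1 by ring, h3, show (k : ℤ) + 2 = ((k + 2 : ℕ) : ℤ) by simp] at e2
    have hk2 : k + 1 ≠ l.length := by
      intro hk2
      simp [hk2] at e1
    rw [hget (k + 2) (by omega)] at e2
    refine hl5 (List.infix_iff_getElem?.2 ⟨k, by simp; omega, fun i hi => ?_⟩)
    have hi : i < 3 := hi
    rw [List.getElem?_eq_getElem (by omega)]
    interval_cases i
    · simp only [Nat.zero_add, ← e0]; rfl
    · simp only [Nat.add_comm 1 k, ← e1]; rfl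
    · simp only [Nat.add_comm 2 k, ← e2]; rfl

theorem shift_mem_areaSeqs {n : ℕ} {c : ℤ → ℕ} (hc : c ∈ areaSeqs n) (s : ℤ) :
    (fun i => c (i + s)) ∈ areaSeqs n := by
  obtain ⟨h1, h2, h3, ⟨i, h4⟩, h5⟩ := hc
  refine ⟨fun i => ?_, fun i => h2 _, fun i => ?_, ⟨i - s, by simpa using h4⟩, ?_⟩
  · simp only
    rw [add_right_comm, h1]
  · simp only
    rw [add_right_comm]
    exact h3 _
  · rintro ⟨i, e1, e2, e3⟩
    exact h5 ⟨i + s, by rw [← e1]; ring_nf, e2, by rw [← e3]; ring_nf⟩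

theorem window_mem_hillFree {n : ℕ} {c : ℤ → ℕ} (hc : c ∈ areaSeqs n) (h0 : c 0 = 2) :
    (List.range n).map (fun k : ℕ => c (k : ℤ)) ∈ hillFree n := by
  obtain ⟨h1, h2, h3, -, h5⟩ := hc
  have hw : (List.range n).map (fun k : ℕ => c (k : ℤ)) ++ [2] =
      (List.range (n + 1)).map (fun k : ℕ => c (k : ℤ)) := by
    have := h1 0
    rw [zero_add, h0] at this
    simp [List.range_succ, this]
  refine ⟨by simp, ?_, ⟨((List.range n).map Nat.succ).map fun k : ℕ => c (k : ℤ), ?_⟩, ?_, ?_⟩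
  · intro x hx
    obtain ⟨k, -, rfl⟩ := List.mem_map.1 hx
    exact h2 _
  · rw [hw, List.range_succ_eq_map, List.map_cons, Nat.cast_zero, h0]
  · rw [hw, List.isChain_map, List.isChain_range]
    intro m _
    simpa using h3 m
  · rw [hw]
    intro h
    obtain ⟨k, hk, h⟩ := List.infix_iff_getElem?.1 h
    have hk : 3 + k ≤ n + 1 := by simpa using hk
    have e0 := h 0 (by simp)
    have e1 := h 1 (by simp)
    have e2 := h 2 (by simp)
    rw [List.getElem?_eq_getElem (by simp; omega)] at e0 e1 e2
    simp at e0 e1 e2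
    refine h5 ⟨k + 1, by simpa using e0, by rw [← e1, add_comm], by rw [← e2]; ring_nf⟩

theorem periodize_window {n : ℕ} (hn : 0 < n) {c : ℤ → ℕ} (hc : Function.Periodic c n) :
    periodize ((List.range n).map (fun k : ℕ => c (k : ℤ))) = c := by
  funext i
  obtain ⟨k, hk, h⟩ := exists_nat_of_periodic hc hn i
  have h1 := Int.emod_nonneg i (b := (n : ℤ)) (by omega)
  have h2 := Int.emod_lt_of_pos i (b := (n : ℤ)) (by omega)
  have h3 := hc.int_mul (i / n) (i % n)
  rw [periodize, List.length_map, List.length_range,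
    List.getD_eq_getElem _ _ (by simp; omega), List.getElem_map, List.getElem_range,
    Int.toNat_of_nonneg h1, ← h3]
  congr 1
  have h4 := Int.mul_ediv_add_emod i n
  linear_combination h4

theorem periodize_inj {l l' : List ℕ} (hlen : l.length = l'.length)
    (h : periodize l = periodize l') : l = l' := by
  refine List.ext_getElem hlen fun k hk hk' => ?_
  have := congrFun h k
  rwa [periodize, periodize, Int.emod_eq_of_lt (by omega) (by omega),
    Int.emod_eq_of_lt (by omega) (by omega), Int.toNat_natCast, List.getD_eq_getElem _ _ hk,
    List.getD_eq_getElem _ _ hk'] at this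

theorem periodize_ne_two {i : ℕ} {w : List ℕ} (hw : w ∈ blocks i) (l : List ℕ)
    {k : ℕ} (hk0 : 0 < k) (hk : k ≤ i) : periodize (2 :: (w ++ l)) k ≠ 2 := by
  have hlen : w.length = i := hw.1.1
  obtain ⟨k, rfl⟩ := Nat.exists_eq_succ_of_ne_zero hk0.ne'
  rw [periodize_natCast (r := w ++ l ++ [2]) rfl (by simp; omega), List.cons_append,
    Nat.succ_eq_add_one, List.getD_cons_succ, List.append_assoc,
    List.getD_append _ _ _ _ (by omega), List.getD_eq_getElem _ _ (by omega)]
  exact (hw.1.2.1 _ (List.getElem_mem _)).ne'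

theorem periodize_succ_length {i j : ℕ} {w l : List ℕ} (hw : w ∈ blocks i) (hl : l ∈ hillFree j) :
    periodize (2 :: (w ++ l)) ((i + 1 : ℕ) : ℤ) = 2 := by
  have hlen : w.length = i := hw.1.1
  obtain ⟨r, hr⟩ := hl.2.2.1
  rw [periodize_natCast (r := w ++ l ++ [2]) rfl (by simp; omega), List.cons_append,
    List.getD_cons_succ, List.append_assoc, List.getD_append_right _ _ _ _ (by omega), hr]
  simp [hlen]

theorem shift_le_of_periodize_eq {i n : ℕ} {w l l' : List ℕ} {s s' : ℕ} (hw : w ∈ blocks i)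
    (hs : s ≤ i) (hl' : l' ∈ hillFree (n + 1))
    (h : (fun x : ℤ => periodize (2 :: (w ++ l)) (x + s)) = fun x => periodize l' (x + s')) :
    s ≤ s' := by
  by_contra! hlt
  have := congrFun h (-s')
  obtain ⟨r, hr⟩ := hl'.2.2.1
  have h0 : periodize l' ((0 : ℕ) : ℤ) = 2 := by
    rw [periodize_natCast hr (Nat.zero_le _), hr]
    rfl
  simp only [neg_add_cancel] at this
  rw [show -(s' : ℤ) + s = ((s - s' : ℕ) : ℤ) by omega, show (0 : ℤ) = ((0 : ℕ) : ℤ) from rfl,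
    h0] at this
  exact periodize_ne_two hw l (by omega) (by omega) this

theorem finite_ncard_areaSeqs_succ (n : ℕ) : (areaSeqs (n + 1)).Finite ∧
    (areaSeqs (n + 1)).ncard = ∑ p ∈ Finset.HasAntidiagonal.antidiagonal n,
      ((blocks p.1).ncard * (p.1 + 1)) * (hillFree p.2).ncard := by
  have key := ncard_eq_sum_antidiagonal n (fun i => blocks i ×ˢ Set.Iic i) hillFree
    (fun p l i => periodize (2 :: (p.1 ++ l)) (i + p.2)) (areaSeqs (n + 1))
    (fun i _ => (finite_blocks i).prod (Set.finite_Iic i))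
    (fun i _ => (finite_hillFree_and_ncard_succ i).1) ?_ ?_ ?_
  · refine ⟨key.1, key.2.trans (Finset.sum_congr rfl fun p _ => ?_)⟩
    rw [Set.ncard_prod, ← Nat.card_coe_set_eq (Set.Iic p.1)]
    simp
  · rintro i j rfl ⟨w, s⟩ ⟨hw, -⟩ l hl
    exact shift_mem_areaSeqs (periodize_mem_areaSeqs (Nat.succ_pos _)
      (mem_hillFree_of_blocks hw hl)) _
  · rintro i j i' j' hij hij' ⟨w, s⟩ ⟨hw, hs⟩ l hl ⟨w', s'⟩ ⟨hw', hs'⟩ l' hl' h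
    simp only at hw hw' hs hs' h
    have hll := mem_hillFree_of_blocks hw hl
    have hll' := mem_hillFree_of_blocks hw' hl'
    obtain rfl : s = s' := le_antisymm (shift_le_of_periodize_eq hw hs hll' h)
      (shift_le_of_periodize_eq hw' hs' hll h.symm)
    have heq : periodize (2 :: (w ++ l)) = periodize (2 :: (w' ++ l')) := by
      funext x
      simpa using congrFun h (x - s)
    obtain ⟨rfl, rfl, rfl⟩ := blocks_decomp_inj hw hl hw' hl'
      (periodize_inj (by rw [hll.1, hll'.1, hij, hij']) heq)
    exact ⟨rfl, rfl, rfl⟩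
  · intro c hc
    have hex : ∃ j : ℕ, c (-j) = 2 := by
      obtain ⟨i, hi⟩ := hc.2.2.2.1
      have h3 := hc.1.int_mul (-|i|) i
      rw [Int.cast_id] at h3
      have h4 : |i| ≤ |i| * ((n + 1 : ℕ) : ℤ) :=
        le_mul_of_one_le_right (abs_nonneg i) (by push_cast; omega)
      have h5 := le_abs_self i
      refine ⟨(-(i + -|i| * ((n + 1 : ℕ) : ℤ))).toNat, ?_⟩
      rw [Int.toNat_of_nonneg (by linarith), neg_neg, h3, hi]
    obtain ⟨s, hs, hmin⟩ := (⟨Nat.find hex, Nat.find_spec hex, fun m => Nat.find_min hex⟩ :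
      ∃ s : ℕ, c (-s) = 2 ∧ ∀ m < s, c (-m) ≠ 2)
    have hc0 := shift_mem_areaSeqs hc (-s)
    have hl := window_mem_hillFree hc0 (by simpa using hs)
    have hper := periodize_window n.succ_pos hc0.1
    obtain ⟨i, j, hij, w, hw, l, hl, hwl⟩ := exists_blocks_of_mem_hillFree hl
    rw [Nat.succ_eq_add_one, ← hwl] at hper
    refine ⟨i, j, hij, (w, s), ⟨hw, ?_⟩, l, hl, ?_⟩
    · by_contra hlt
      simp only [Set.mem_Iic, not_le] at hlt
      have h1 := periodize_succ_length hw hl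
      rw [hper] at h1
      refine hmin (s - (i + 1)) (by omega) ?_
      rw [← h1]
      congr 1
      omega
    · simp [hper]

open PowerSeries in
theorem ncard_areaSeqs {n : ℕ} (hn : 0 < n) : ((areaSeqs n).ncard : ℚ) =
    n * ∑ m ∈ Finset.range (n / 2 + 1), (-1 : ℚ) ^ m / ((n : ℚ) - m) *
        ((2 * n - 3 * m - 1).choose (n - m - 1) : ℚ) := by
  rw [← coeff_mul_of_eq_one_add hillFreeGF_eq n hn]
  obtain ⟨n, rfl⟩ := Nat.exists_eq_succ_of_ne_zero hn.ne'
  rw [Nat.succ_eq_add_one, coeff_succ_X_mul, coeff_mul, (finite_ncard_areaSeqs_succ n).2]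
  push_cast
  refine Finset.sum_congr rfl fun p _ => ?_
  rw [ncard_blocks, centralBinomGF, hillFreeGF, coeff_mk, map_sub, coeff_mk,
    ← succ_mul_catalan_eq_centralBinom, show (2 : PowerSeries ℚ) = C 2 from rfl, coeff_C_mul,
    coeff_X]
  push_cast
  split_ifs with h
  · rw [h]
    push_cast
    ring
  · ring

/-- The non-constant area sequences without 2-hills, as functions on `ZMod n`. -/
abbrev CyclicAreaSeq (n : ℕ) : Type :=
  {c : ZMod n → ℕ // (∀ i, 2 ≤ c i) ∧ (∀ i, c i ≤ c (i + 1) + 1) ∧ (∃ i, c i = 2) ∧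
    (¬∃ i, c (i - 1) = 2 ∧ c i = 3 ∧ c (i + 1) = 2) ∧ ¬∀ i, c i = 2}

theorem comp_intCast_mem_iff {n g : ℕ} (f : ZMod n → ℕ)
    (hf : Function.Periodic (fun k : ℤ => f k) g) :
    (fun k : ℤ => f k) ∈ areaSeqs g \ {fun _ => 2} ↔
      (∀ i, 2 ≤ f i) ∧ (∀ i, f i ≤ f (i + 1) + 1) ∧ (∃ i, f i = 2) ∧
        (¬∃ i, f (i - 1) = 2 ∧ f i = 3 ∧ f (i + 1) = 2) ∧ ¬∀ i, f i = 2 := by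
  have hs : Function.Surjective (fun k : ℤ => (k : ZMod n)) := ZMod.intCast_surjective
  simp only [areaSeqs, Set.mem_sdiff, Set.mem_ofPred_eq, hf, true_and, hs.forall, hs.exists,
    Set.mem_singleton_iff, funext_iff, Int.cast_add, Int.cast_sub, Int.cast_one, and_assoc]

instance (n : ℕ) : AddAction (ZMod n) (CyclicAreaSeq n) where
  vadd t a := ⟨fun i => a.1 (i + t), fun i => a.2.1 _,
    fun i => by simpa only [add_right_comm i 1 t] using a.2.2.1 (i + t),
    let ⟨i, h⟩ := a.2.2.2.1; ⟨i - t, by simpa using h⟩,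
    fun ⟨i, h⟩ => a.2.2.2.2.1 ⟨i + t, by rwa [add_sub_right_comm, add_right_comm i t 1]⟩,
    fun h => a.2.2.2.2.2 fun i => by simpa using h (i - t)⟩
  zero_vadd a := Subtype.ext (funext fun i => congrArg a.1 (add_zero i))
  add_vadd s t a := Subtype.ext (funext fun i => congrArg a.1 (add_assoc i s t).symm)

theorem vadd_apply {n : ℕ} (t : ZMod n) (a : CyclicAreaSeq n) (i : ZMod n) :
    (t +ᵥ a).1 i = a.1 (i + t) := rfl

theorem card_fixedBy {n : ℕ} [NeZero n] (t : ZMod n) :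
    Nat.card (AddAction.fixedBy (CyclicAreaSeq n) t) =
      (areaSeqs (n.gcd t.val) \ {fun _ => 2}).ncard := by
  set g := n.gcd t.val with hg
  have hper (a : AddAction.fixedBy (CyclicAreaSeq n) t) :
      Function.Periodic (fun k : ℤ => a.1.1 k) g := by
    have h1 : Function.Periodic (fun k : ℤ => a.1.1 k) (n : ℤ) := fun k => by simp
    have h2 : Function.Periodic (fun k : ℤ => a.1.1 k) (t.val : ℤ) := fun k => by
      have := congrFun (congrArg Subtype.val a.2) (k : ZMod n)
      simpa [vadd_apply] using this
    rw [hg, Nat.gcd_eq_gcd_ab, mul_comm (n : ℤ), mul_comm (t.val : ℤ)]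
    exact (h1.int_mul _).add_period (h2.int_mul _)
  rw [← Nat.card_coe_set_eq]
  refine Nat.card_congr (Equiv.ofBijective
    (fun a => ⟨fun k : ℤ => a.1.1 k, (comp_intCast_mem_iff a.1.1 (hper a)).2 a.1.2⟩) ⟨?_, ?_⟩)
  · intro a b h
    refine Subtype.ext (Subtype.ext (funext fun i => ?_))
    obtain ⟨k, rfl⟩ := ZMod.intCast_surjective i
    exact congrFun (congrArg Subtype.val h) k
  · rintro ⟨c, hc⟩
    have hc1 : Function.Periodic c g := hc.1.1
    have hdvd (d : ℕ) (hd : g ∣ d) : Function.Periodic c d := by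
      obtain ⟨e, rfl⟩ := hd
      have := hc1.int_mul e
      rwa [Int.cast_id, mul_comm, ← Nat.cast_mul] at this
    have hval (k : ℤ) : c ((k : ZMod n).val : ℤ) = c k := by
      rw [ZMod.val_intCast]
      have h3 := (hdvd n (Nat.gcd_dvd_left _ _)).int_mul (k / n) (k % n)
      rw [← h3]
      congr 1
      have h4 := Int.mul_ediv_add_emod k n
      rw [Int.cast_id]
      linear_combination h4
    have heq : (fun k : ℤ => (fun i : ZMod n => c i.val) k) = c := funext hval
    have hmem : (fun k : ℤ => (fun i : ZMod n => c i.val) k) ∈ areaSeqs g \ {fun _ => 2} := by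
      rwa [heq]
    let a : CyclicAreaSeq n := ⟨fun i => c i.val, (comp_intCast_mem_iff _ hmem.1.1).1 hmem⟩
    suffices ha : a ∈ AddAction.fixedBy (CyclicAreaSeq n) t from ⟨⟨a, ha⟩, Subtype.ext heq⟩
    refine Subtype.ext (funext fun i => ?_)
    obtain ⟨k, rfl⟩ := ZMod.intCast_surjective i
    rw [vadd_apply]
    have h1 := hval (k + (t.val : ℤ))
    have h2 := hdvd t.val (Nat.gcd_dvd_right _ _) k
    rw [h2] at h1
    push_cast at h1
    rw [ZMod.natCast_zmod_val] at h1
    exact h1.trans (hval k).symm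

theorem const_mem_areaSeqs (n : ℕ) : (fun _ => 2) ∈ areaSeqs n :=
  ⟨fun _ => rfl, by simp, by simp, ⟨0, rfl⟩, by simp⟩

theorem sum_gcd_eq_sum_divisors (n : ℕ) (hn : 0 < n) (A : ℕ → ℚ) :
    ∑ t ∈ Finset.range n, A (n.gcd t) = ∑ k ∈ n.divisors, (k.totient : ℚ) * A (n / k) := by
  rw [← Finset.sum_fiberwise_of_maps_to (t := n.divisors) (g := fun t => n.gcd t)
    (fun t _ => Nat.mem_divisors.2 ⟨Nat.gcd_dvd_left _ _, hn.ne'⟩),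
    ← Nat.sum_div_divisors n fun k => (k.totient : ℚ) * A (n / k)]
  refine Finset.sum_congr rfl fun d hd => ?_
  have hdvd := Nat.dvd_of_mem_divisors hd
  rw [Nat.totient_div_of_dvd hdvd, Nat.div_div_self hdvd hn.ne', ← nsmul_eq_mul,
    ← Finset.sum_const]
  exact Finset.sum_congr rfl fun t ht => by rw [(Finset.mem_filter.1 ht).2]

theorem card_orbits_mul {n : ℕ} (hn : 0 < n) :
    (Nat.card (Quotient (AddAction.orbitRel (ZMod n) (CyclicAreaSeq n))) : ℚ) * n =
      ∑ k ∈ n.divisors, (k.totient : ℚ) * (((areaSeqs (n / k)).ncard : ℚ) - 1) := by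
  classical
  have : NeZero n := ⟨hn.ne'⟩
  have hfinA {m : ℕ} (hm : 0 < m) : (areaSeqs m).Finite := by
    obtain ⟨m, rfl⟩ := Nat.exists_eq_succ_of_ne_zero hm.ne'
    exact (finite_ncard_areaSeqs_succ m).1
  have hfin : Finite (CyclicAreaSeq n) := by
    have := (hfinA hn).to_subtype
    refine Finite.of_injective (β := areaSeqs n) (fun a => ⟨fun k : ℤ => a.1 k,
      ((comp_intCast_mem_iff a.1 fun k => by simp).2 a.2).1⟩) fun a b h => ?_
    refine Subtype.ext (funext fun i => ?_)
    obtain ⟨k, rfl⟩ := ZMod.intCast_surjective i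
    exact congrFun (congrArg Subtype.val h) k
  have := Fintype.ofFinite (CyclicAreaSeq n)
  have burnside := AddAction.sum_card_fixedBy_eq_card_orbits_mul_card_addGroup (ZMod n)
    (CyclicAreaSeq n)
  simp only [← Nat.card_eq_fintype_card, card_fixedBy, Nat.card_zmod] at burnside
  rw [← Nat.cast_mul, ← burnside,
    ← sum_gcd_eq_sum_divisors n hn fun m => ((areaSeqs m).ncard : ℚ) - 1,
    ← Fin.sum_univ_eq_sum_range (fun t => ((areaSeqs (n.gcd t)).ncard : ℚ) - 1), Nat.cast_sum]
  refine Fintype.sum_equiv (ZMod.finEquiv n).symm.toEquiv _ _ fun t => ?_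
  have hv : (((ZMod.finEquiv n).symm.toEquiv t : Fin n) : ℕ) = t.val := by
    obtain _ | n := n
    · exact absurd rfl hn.ne
    · rfl
  have hpos : 0 < n.gcd t.val := Nat.gcd_pos_of_pos_left _ hn
  rw [hv, Set.ncard_sdiff_singleton_of_mem (const_mem_areaSeqs _), Nat.cast_pred]
  exact (Set.ncard_pos (hfinA hpos)).2 ⟨_, const_mem_areaSeqs _⟩

/-- The number of `n`-periodic Dyck paths with global shift `0` and no
2-hill, other than the path with constant area sequence, equals
`∑_{k ∣ n} (φ(k)/k) * ∑_{m=0}^{⌊n/(2k)⌋} ((-1)^m/(n/k - m)) * binomial (2n/k - 3m - 1) (n/k - m - 1) - 1`.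
Such paths are the necklaces `[c 0, …, c (n-1)]` (up to cyclic rotation) of integers
`≥ 2` with `c i ≤ c (i+1) + 1` and some `c i = 2` (global shift `0`); a 2-hill at
position `i` corresponds to `c (i-1) = 2`, `c i = 3`, `c (i+1) = 2`, and the constant
area sequence is `c ≡ 2`. -/
theorem periodic_no_two_hill_count (n : ℕ) (hn : 0 < n) :
    (Nat.card (Quot (fun (a b : {c : ZMod n → ℕ // (∀ i, 2 ≤ c i) ∧
          (∀ i, c i ≤ c (i + 1) + 1) ∧ (∃ i, c i = 2) ∧
          (¬∃ i, c (i - 1) = 2 ∧ c i = 3 ∧ c (i + 1) = 2) ∧ ¬∀ i, c i = 2}) =>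
        ∃ t : ZMod n, ∀ i, b.1 i = a.1 (i + t))) : ℚ) =
      (∑ k ∈ n.divisors, (k.totient : ℚ) / k *
        ∑ m ∈ Finset.range (n / (2 * k) + 1),
          (-1 : ℚ) ^ m / (((n / k : ℕ) : ℚ) - m) *
            ((2 * (n / k) - 3 * m - 1).choose (n / k - m - 1) : ℚ)) - 1 := by
  have hQ : Nat.card (Quot (fun (a b : CyclicAreaSeq n) =>
        ∃ t : ZMod n, ∀ i, b.1 i = a.1 (i + t))) =
      Nat.card (Quotient (AddAction.orbitRel (ZMod n) (CyclicAreaSeq n))) := by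
    refine Nat.card_congr (Quot.congrRight fun a b => ?_)
    refine Iff.trans ?_ (Setoid.comm' (AddAction.orbitRel (ZMod n) (CyclicAreaSeq n)))
    rw [AddAction.orbitRel_apply, AddAction.mem_orbit_iff]
    exact exists_congr fun t =>
      ⟨fun h => Subtype.ext (funext fun i => (h i).symm), fun h i => by rw [← h, vadd_apply]⟩
  have hn0 : (n : ℚ) ≠ 0 := Nat.cast_ne_zero.2 hn.ne'
  have htot : ∑ k ∈ n.divisors, (k.totient : ℚ) = n := by exact_mod_cast Nat.sum_totient n
  refine (congrArg (Nat.cast (R := ℚ)) hQ).trans ?_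
  rw [← mul_left_inj' hn0, card_orbits_mul hn]
  simp only [mul_sub, mul_one]
  rw [Finset.sum_sub_distrib, htot, sub_mul, one_mul, Finset.sum_mul]
  congr 1
  refine Finset.sum_congr rfl fun k hk => ?_
  have hdvd := Nat.dvd_of_mem_divisors hk
  have hk0 : (k : ℚ) ≠ 0 := Nat.cast_ne_zero.2 (Nat.pos_of_mem_divisors hk).ne'
  rw [ncard_areaSeqs (Nat.div_pos (Nat.le_of_dvd hn hdvd) (Nat.pos_of_mem_divisors hk)),
    Nat.div_div_eq_div_mul, mul_comm k 2]
  have hq : ((n / k : ℕ) : ℚ) * k = n := by exact_mod_cast Nat.div_mul_cancel hdvd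
  rw [← hq]
  field_simp

end Nak
end
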